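/- Large displacement forces bounded positive independence diameter: For every d ≥ 1 there are a constant C = C(d) > 0 and an integer N = N(d) > 0 with the following property. For every local field k and every finite subset Σ of SL_d(k) with 1 ∈ Σ generating a group that is not virtually solvable, if E(Σ) = inf_{h ∈ SL_d(k)} sup_{s ∈ Σ} ‖h·s·h⁻¹‖ > C, then Σ^N contains two positively independent elements. -/

import Mathlib

open Matrix Pointwise

/-- The sup-norm of a vector in `kᵈ`. -/
noncomputable def supVNorm {d : ℕ} {k : Type*} [NormedField k] (x : Fin d → k) : ℝ :=
  sSup (Set.range fun i => ‖x i‖)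

/-- The operator norm of a `d × d` matrix over `k` with respect to the sup norm on `kᵈ`
(supremum over the closed unit ball). -/
noncomputable def kOpNorm {d : ℕ} {k : Type*} [NormedField k]
    (M : Matrix (Fin d) (Fin d) k) : ℝ :=
  sSup {r : ℝ | ∃ x : Fin d → k, supVNorm x ≤ 1 ∧ r = supVNorm (M.mulVec x)}

section
namespace LD

/-- Two elements generating a free semigroup, even modulo scalars. -/
def ProjFree (L : Type*) {A : Type*} [Field L] [Ring A] [Algebra L A] (a b : A) : Prop :=
  ∀ (w w' : FreeMonoid (Fin 2)) (c : L), c ≠ 0 →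
    FreeMonoid.lift ![a, b] w = c • FreeMonoid.lift ![a, b] w' → w = w'

/-- Criterion: words starting with different letters are never proportional. -/
theorem projFree_of_heads {L A : Type*} [Field L] [Ring A] [Algebra L A] (a b : A)
    (ha : ∀ x y : A, a * x = a * y → x = y) (hb : ∀ x y : A, b * x = b * y → x = y)
    (h : ∀ (w w' : FreeMonoid (Fin 2)) (c : L), c ≠ 0 →
      a * FreeMonoid.lift ![a, b] w ≠ c • (b * FreeMonoid.lift ![a, b] w')) :
    ProjFree L a b := by
  have h' : ∀ (w w' : FreeMonoid (Fin 2)) (c : L), c ≠ 0 →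
      b * FreeMonoid.lift ![a, b] w ≠ c • (a * FreeMonoid.lift ![a, b] w') := by
    intro w w' c hc heq
    refine h w' w c⁻¹ (inv_ne_zero hc) ?_
    rw [heq, smul_smul, inv_mul_cancel₀ hc, one_smul]
  have hone : ∀ (w : FreeMonoid (Fin 2)) (i : Fin 2) (c : L), c ≠ 0 →
      FreeMonoid.lift ![a, b] (FreeMonoid.of i * w) ≠ c • 1 := by
    intro w i c hc heq
    have hi : i = 0 ∨ i = 1 := by omega
    rcases hi with rfl | rfl
    · refine h (w * FreeMonoid.of 1) 1 c hc ?_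
      have := congrArg (· * b) heq
      simpa [mul_assoc] using this
    · refine h' (w * FreeMonoid.of 0) 1 c hc ?_
      have := congrArg (· * a) heq
      simpa [mul_assoc] using this
  intro w
  induction w using FreeMonoid.inductionOn' with
  | one =>
    intro w' c hc heq
    induction w' using FreeMonoid.casesOn with
    | one => rfl
    | of_mul i w' =>
      exfalso
      refine hone w' i c⁻¹ (inv_ne_zero hc) ?_
      rw [map_one] at heq
      rw [heq, smul_smul, inv_mul_cancel₀ hc, one_smul]
  | of_mul i w ih =>
    intro w' c hc heq
    induction w' using FreeMonoid.casesOn with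
    | one =>
      exfalso
      exact hone w i c hc (by simpa using heq)
    | of_mul j w' =>
      have hi : i = 0 ∨ i = 1 := by omega
      have hj : j = 0 ∨ j = 1 := by omega
      rw [map_mul, map_mul] at heq
      rcases hi with rfl | rfl <;> rcases hj with rfl | rfl
      · rw [ih w' c hc]
        apply ha
        simpa using heq
      · exact absurd (by simpa using heq) (h w w' c hc)
      · exact absurd (by simpa using heq) (h' w w' c hc)
      · rw [ih w' c hc]
        apply hb
        simpa using heq

section pingpong
variable {L E : Type*} [NormedField L] [NormedAddCommGroup E] [NormedSpace L E]
  [FiniteDimensional L E]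

theorem pingpong (e G x : Module.End L E) (K α β : ℝ)
    (he : ∀ u, e (e u) = e u) (hG : ∀ u, G (e u) = e (G u))
    (hGi : Function.Injective G) (hxi : Function.Injective x) (hK : 1 ≤ K)
    (h1 : ∀ u, ‖x u - e (x u)‖ ≤ K * ‖u‖) (h1' : ∀ u, ‖e (x u)‖ ≤ K * ‖u‖)
    (h2 : ∀ u, ‖e u‖ ≤ K * ‖e (x (e u))‖) (hβ : 0 < β) (hα : 0 ≤ α)
    (h3 : ∀ u, ‖G (u - e u)‖ ≤ α * ‖u - e u‖) (h4 : ∀ u, β * ‖e u‖ ≤ ‖G (e u)‖)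
    (hκ : 40 * K ^ 4 * α ≤ β) (hne : ∃ u, x (e u) ≠ e (x (e u))) :
    ProjFree L G (x * G) := by
  -- the supremum
  let A : Set ℝ := {r | ∃ u, e (x (e u)) ≠ 0 ∧ r = ‖x (e u) - e (x (e u))‖ / ‖e (x (e u))‖}
  have hz : ∀ u, e (x (e u)) = 0 → e u = 0 := by
    intro u hu
    have := h2 u
    rw [hu, norm_zero, mul_zero] at this
    exact norm_le_zero_iff.1 this
  have hK0 : 0 < K := by linarith
  have hAb : ∀ r ∈ A, r ≤ K ^ 2 := by
    rintro r ⟨u, hu, rfl⟩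
    rw [div_le_iff₀ (norm_pos_iff.2 hu)]
    calc ‖x (e u) - e (x (e u))‖ ≤ K * ‖e u‖ := h1 _
      _ ≤ K * (K * ‖e (x (e u))‖) := by gcongr; exact h2 u
      _ = _ := by ring
  obtain ⟨u1, hu1⟩ := hne
  have hu1' : e (x (e u1)) ≠ 0 := by
    intro h0
    apply hu1
    rw [hz u1 h0]; simp
  set r1 := ‖x (e u1) - e (x (e u1))‖ / ‖e (x (e u1))‖ with hr1
  have hr1A : r1 ∈ A := ⟨u1, hu1', rfl⟩
  have hr1pos : 0 < r1 := div_pos (norm_pos_iff.2 (sub_ne_zero.2 hu1)) (norm_pos_iff.2 hu1')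
  have hbdd : BddAbove A := ⟨_, hAb⟩
  set ρ := sSup A with hρdef
  have hρpos : 0 < ρ := lt_of_lt_of_le hr1pos (le_csSup hbdd hr1A)
  have hρK : ρ ≤ K ^ 2 := csSup_le ⟨_, hr1A⟩ hAb
  obtain ⟨r0, ⟨u0, hu0, rfl⟩, hr0⟩ := exists_lt_of_lt_csSup ⟨_, hr1A⟩ (half_lt_self hρpos)
  have ha : ∀ u, ‖x (e u) - e (x (e u))‖ ≤ ρ * ‖e (x (e u))‖ := by
    intro u
    by_cases hu : e (x (e u)) = 0
    · rw [hz u hu]; simp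
    · rw [← div_le_iff₀ (norm_pos_iff.2 hu)]
      exact le_csSup hbdd ⟨u, hu, rfl⟩
  have hb : ρ / 2 * ‖e (x (e u0))‖ ≤ ‖x (e u0) - e (x (e u0))‖ := by
    rw [← le_div_iff₀ (norm_pos_iff.2 hu0)]; exact hr0.le
  clear_value ρ
  clear hρdef hbdd hr1A hr1pos hr0 hAb
  clear r1 hr1
  clear A
  set κ := α / β with hκd
  have hκ0 : 0 ≤ κ := by positivity
  have hκ40 : 40 * K ^ 4 * κ ≤ 1 := by
    rw [hκd, ← mul_div_assoc, div_le_one hβ]; exact hκ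
  have hK24 : K ^ 2 ≤ K ^ 4 := pow_le_pow_right₀ hK (by norm_num)
  have hK14 : 1 ≤ K ^ 4 := one_le_pow₀ hK
  have hκ1 : 40 * κ ≤ 1 := by nlinarith
  have hκ2 : 40 * K ^ 2 * κ ≤ 1 := by nlinarith
  have hκ3 : 40 * K ^ 2 * ρ * κ ≤ 1 := by
    have : K ^ 2 * ρ ≤ K ^ 4 := by nlinarith [sq_nonneg K]
    nlinarith
  let V : Submodule L E := LinearMap.range e
  let Bset : Set (Submodule L E) :=
    {U | Module.finrank L U = Module.finrank L V ∧ ∀ u ∈ U, ‖u - e u‖ ≤ 4 * ρ * ‖e u‖}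
  have hV : V ∈ Bset := by
    refine ⟨rfl, ?_⟩
    rintro u ⟨w, rfl⟩
    rw [he, sub_self, norm_zero]; positivity
  have key1 : ∀ u, ‖u - e u‖ ≤ 4 * ρ * ‖e u‖ → ‖G u - e (G u)‖ ≤ 4 * ρ * κ * ‖e (G u)‖ := by
    intro u hu
    have e1 : G u - e (G u) = G (u - e u) := by rw [map_sub, hG]
    have e2 : ‖e u‖ ≤ ‖e (G u)‖ / β := by
      rw [le_div_iff₀ hβ, ← hG, mul_comm]; exact h4 u
    rw [e1]
    calc ‖G (u - e u)‖ ≤ α * ‖u - e u‖ := h3 u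
      _ ≤ α * (4 * ρ * (‖e (G u)‖ / β)) := by gcongr; exact hu.trans (by gcongr)
      _ = _ := by rw [hκd]; ring
  -- estimates for x applied to u' with ratio ≤ 4ρκ
  have key2 : ∀ u, ‖u - e u‖ ≤ 4 * ρ * κ * ‖e u‖ →
      ‖x (u - e u) - e (x (u - e u))‖ ≤ ρ / 10 * ‖e (x (e u))‖ ∧
      ‖e (x (u - e u))‖ ≤ 1 / 10 * ‖e (x (e u))‖ := by
    intro u hu
    have hh : K * ‖u - e u‖ ≤ 4 * ρ * (K ^ 2 * κ) * ‖e (x (e u))‖ := by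
      calc K * ‖u - e u‖ ≤ K * (4 * ρ * κ * (K * ‖e (x (e u))‖)) := by
            gcongr; exact hu.trans (by gcongr; exact h2 u)
        _ = _ := by ring
    constructor
    · refine (h1 _).trans (hh.trans ?_)
      gcongr
      nlinarith
    · refine (h1' _).trans (hh.trans ?_)
      gcongr
      nlinarith
  have decomp : ∀ u, x u = x (e u) + x (u - e u) := by
    intro u; rw [← map_add]; congr 1; abel
  have key3 : ∀ u, ‖u - e u‖ ≤ 4 * ρ * κ * ‖e u‖ → ‖x u - e (x u)‖ ≤ 4 * ρ * ‖e (x u)‖ := by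
    intro u hu
    obtain ⟨k1, k2⟩ := key2 u hu
    have s1 : ‖x u - e (x u)‖ ≤ ρ * (11 / 10) * ‖e (x (e u))‖ := by
      have : x u - e (x u) = (x (e u) - e (x (e u))) + (x (u - e u) - e (x (u - e u))) := by
        conv_lhs => rw [decomp u, map_add e]
        abel
      rw [this]
      refine (norm_add_le _ _).trans ?_
      have := ha u
      linarith
    have s2 : 9 / 10 * ‖e (x (e u))‖ ≤ ‖e (x u)‖ := by
      have h8 : e (x (e u)) = e (x u) - e (x (u - e u)) := by
        conv_rhs => rw [decomp u, map_add e]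
        abel
      have := norm_sub_le (e (x u)) (e (x (u - e u)))
      rw [← h8] at this
      linarith
    nlinarith [norm_nonneg (e (x (e u)))]
  have hmapG : ∀ U ∈ Bset, U.map G ∈ Bset ∧ ∀ u ∈ U.map G, ‖u - e u‖ ≤ 4 * ρ * κ * ‖e u‖ := by
    rintro U ⟨hU1, hU2⟩
    have : ∀ u ∈ U.map G, ‖u - e u‖ ≤ 4 * ρ * κ * ‖e u‖ := by
      rintro _ ⟨u, hu, rfl⟩
      exact key1 u (hU2 u hu)
    refine ⟨⟨?_, fun u hu => (this u hu).trans ?_⟩, this⟩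
    · rw [← hU1]; exact (Submodule.equivMapOfInjective G hGi U).finrank_eq.symm
    · have : 4 * ρ * κ ≤ 4 * ρ := by nlinarith
      gcongr
  have hmapx : ∀ U ∈ Bset, U.map (x * G) ∈ Bset := by
    intro U hU
    obtain ⟨⟨g1, g2⟩, g3⟩ := hmapG U hU
    refine ⟨?_, ?_⟩
    · rw [← hU.1]; exact (Submodule.equivMapOfInjective (x * G) (hxi.comp hGi) U).finrank_eq.symm
    · rintro _ ⟨u, hu, rfl⟩
      exact key3 (G u) (g3 _ ⟨u, hu, rfl⟩)
  have hdisj : ∀ U1 ∈ Bset, ∀ U2 ∈ Bset, U1.map G ≠ U2.map (x * G) := by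
    intro U1 hU1 U2 hU2 heq
    obtain ⟨_, q1⟩ := hmapG U1 hU1
    obtain ⟨⟨d2, r2⟩, q2⟩ := hmapG U2 hU2
    -- e maps U2.map G onto V
    have hsurj : (U2.map G).map e = V := by
      have hle : (U2.map G).map e ≤ V := by
        rintro _ ⟨u, _, rfl⟩; exact ⟨u, rfl⟩
      refine Submodule.eq_of_le_of_finrank_eq hle ?_
      rw [← d2]
      have hinj : Function.Injective (e.domRestrict (U2.map G)) := by
        rw [injective_iff_map_eq_zero]
        rintro ⟨u, hu⟩ h0
        have h0' : e u = 0 := h0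
        have := r2 u hu
        rw [h0', norm_zero, mul_zero, sub_zero] at this
        exact Subtype.ext (norm_le_zero_iff.1 this)
      have := LinearMap.finrank_range_of_inj hinj
      rw [LinearMap.range_domRestrict] at this
      exact this
    have : e u0 ∈ (U2.map G).map e := by rw [hsurj]; exact ⟨u0, rfl⟩
    obtain ⟨u, huU, hu⟩ := this
    obtain ⟨k1, k2⟩ := key2 u (q2 u huU)
    rw [hu] at k1 k2
    have hxu : x u ∈ U1.map G := by
      rw [heq]
      obtain ⟨w, hw, rfl⟩ := huU
      exact ⟨w, hw, rfl⟩
    have hq := q1 _ hxu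
    have s1 : ρ * (4 / 10) * ‖e (x (e u0))‖ ≤ ‖x u - e (x u)‖ := by
      have h5 : x (e u0) - e (x (e u0)) = (x u - e (x u)) - (x (u - e u0) - e (x (u - e u0))) := by
        have := decomp u
        rw [hu] at this
        rw [this, map_add e]
        abel
      have h6 := norm_sub_le (x u - e (x u)) (x (u - e u0) - e (x (u - e u0)))
      rw [← h5] at h6
      linarith
    have s2 : ‖e (x u)‖ ≤ 11 / 10 * ‖e (x (e u0))‖ := by
      have := decomp u
      rw [hu] at this
      rw [this, map_add e]
      refine (norm_add_le _ _).trans ?_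
      linarith
    have hp : 0 < ‖e (x (e u0))‖ := norm_pos_iff.2 hu0
    have : ρ * (4 / 10) * ‖e (x (e u0))‖ ≤ 4 * ρ * κ * (11 / 10 * ‖e (x (e u0))‖) :=
      s1.trans (hq.trans (by gcongr))
    have h7 : 0 < ρ * ‖e (x (e u0))‖ := by positivity
    nlinarith
  have hword : ∀ w : FreeMonoid (Fin 2), V.map (FreeMonoid.lift ![G, x * G] w) ∈ Bset := by
    intro w
    induction w using FreeMonoid.inductionOn' with
    | one =>
      rw [map_one]
      have : V.map (1 : Module.End L E) = V := Submodule.map_id V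
      rw [this]; exact hV
    | of_mul i w ih =>
      rw [map_mul]
      have : V.map (FreeMonoid.lift ![G, x * G] (FreeMonoid.of i) * FreeMonoid.lift ![G, x * G] w)
        = (V.map (FreeMonoid.lift ![G, x * G] w)).map
          (FreeMonoid.lift ![G, x * G] (FreeMonoid.of i)) := Submodule.map_comp _ _ _
      rw [this]
      have hi : i = 0 ∨ i = 1 := by omega
      rcases hi with rfl | rfl
      · simpa using (hmapG _ ih).1
      · simpa using hmapx _ ih
  apply projFree_of_heads
  · intro y z hyz
    ext u
    exact hGi (congrArg (fun f : Module.End L E => f u) hyz)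
  · intro y z hyz
    ext u
    exact hGi (hxi (congrArg (fun f : Module.End L E => f u) hyz))
  · intro w w' c hc heq
    refine hdisj _ (hword w) _ (hword w') ?_
    have t1 : (V.map (FreeMonoid.lift ![G, x * G] w)).map G
      = V.map (G * FreeMonoid.lift ![G, x * G] w) := (Submodule.map_comp _ _ _).symm
    have t2 : (V.map (FreeMonoid.lift ![G, x * G] w')).map (x * G)
      = V.map (x * G * FreeMonoid.lift ![G, x * G] w') := (Submodule.map_comp _ _ _).symm
    rw [t1, t2, heq]
    exact Submodule.map_smul _ _ c hc

end pingpong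
end LD

end

section
set_option linter.style.haveILetI false

namespace LD

theorem ProjFree.of_algHom_anti {L A B : Type*} [Field L] [Ring A] [Algebra L A] [Ring B]
    [Algebra L B] (f : A → B) (hmul : ∀ x y, f (x * y) = f y * f x) (hone : f 1 = 1)
    (hsmul : ∀ (c : L) x, f (c • x) = c • f x) {a b : A} (h : ProjFree L (f a) (f b)) :
    ProjFree L a b := by
  have key : ∀ w : FreeMonoid (Fin 2), f (FreeMonoid.lift ![a, b] w) =
      FreeMonoid.lift ![f a, f b] (FreeMonoid.reverse w) := by
    intro w
    induction w using FreeMonoid.inductionOn' with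
    | one => rw [map_one, hone]; rfl
    | of_mul i w ih =>
      rw [map_mul, hmul, ih, FreeMonoid.reverse_mul, map_mul]
      congr 1
      have hi : i = 0 ∨ i = 1 := by omega
      rcases hi with rfl | rfl <;> rfl
  intro w w' c hc heq
  have := congrArg f heq
  rw [hsmul, key, key] at this
  have h2 := h _ _ c hc this
  have := congrArg FreeMonoid.reverse h2
  simpa using this

theorem ProjFree.of_algHom {L A B : Type*} [Field L] [Ring A] [Algebra L A] [Ring B]
    [Algebra L B] (f : A → B) (hmul : ∀ x y, f (x * y) = f x * f y) (hone : f 1 = 1)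
    (hsmul : ∀ (c : L) x, f (c • x) = c • f x) {a b : A} (h : ProjFree L (f a) (f b)) :
    ProjFree L a b := by
  have key : ∀ w : FreeMonoid (Fin 2), f (FreeMonoid.lift ![a, b] w) =
      FreeMonoid.lift ![f a, f b] w := by
    intro w
    induction w using FreeMonoid.inductionOn' with
    | one => rw [map_one, hone]; rfl
    | of_mul i w ih =>
      rw [map_mul, hmul, ih, map_mul]
      congr 1
      have hi : i = 0 ∨ i = 1 := by omega
      rcases hi with rfl | rfl <;> rfl
  intro w w' c hc heq
  have := congrArg f heq
  rw [hsmul, key, key] at this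
  exact h _ _ c hc this

/-- Entrywise bound for a matrix. -/
def Bd {m : ℕ} {L : Type*} [Field L] (v : AbsoluteValue L ℝ) (T : ℝ)
    (A : Matrix (Fin m) (Fin m) L) : Prop := ∀ i j, v (A i j) ≤ T

section Bd
variable {m : ℕ} {L : Type*} [Field L] {v : AbsoluteValue L ℝ} {A B : Matrix (Fin m) (Fin m) L}
  {S T : ℝ}

theorem Bd.mono (h : Bd v S A) (hST : S ≤ T) : Bd v T A := fun i j => (h i j).trans hST

theorem Bd.mul (hA : Bd v S A) (hB : Bd v T B) (hS : 0 ≤ S) : Bd v (m * (S * T)) (A * B) := by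
  intro i j
  rw [Matrix.mul_apply]
  refine (v.sum_le _ _).trans ?_
  calc ∑ k, v (A i k * B k j) ≤ ∑ _k : Fin m, S * T := by
        apply Finset.sum_le_sum
        intro k _
        rw [map_mul]
        exact mul_le_mul (hA i k) (hB k j) (v.nonneg _) hS
    _ = _ := by simp

theorem Bd.add (hA : Bd v S A) (hB : Bd v T B) : Bd v (S + T) (A + B) := fun i j =>
  (v.add_le _ _).trans (add_le_add (hA i j) (hB i j))

theorem Bd.neg (hA : Bd v S A) : Bd v S (-A) := fun i j => by
  rw [Matrix.neg_apply, v.map_neg]; exact hA i j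

theorem Bd.sub (hA : Bd v S A) (hB : Bd v T B) : Bd v (S + T) (A - B) := by
  rw [sub_eq_add_neg]; exact hA.add hB.neg

theorem Bd.one : Bd v 1 (1 : Matrix (Fin m) (Fin m) L) := fun i j => by
  rw [Matrix.one_apply]; split_ifs <;> simp

theorem Bd.smul (hA : Bd v S A) (c : L) : Bd v (v c * S) (c • A) := fun i j => by
  rw [Matrix.smul_apply, smul_eq_mul, map_mul]
  exact mul_le_mul_of_nonneg_left (hA i j) (v.nonneg _)

theorem Bd.transpose (hA : Bd v S A) : Bd v S Aᵀ := fun i j => hA j i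

theorem Bd.nonneg (hA : Bd v S A) (i : Fin m) : 0 ≤ S := (v.nonneg _).trans (hA i i)

theorem Bd.pow (hA : Bd v S A) (hS : 1 ≤ S) (n : ℕ) : Bd v (((m + 1) * S) ^ n) (A ^ n) := by
  induction n with
  | zero => simpa using Bd.one
  | succ n ih =>
    rw [pow_succ]
    refine (Bd.mul ih hA (by positivity)).mono ?_
    have : (0 : ℝ) ≤ ((m + 1) * S) ^ n * S := by positivity
    nlinarith

theorem Bd.sum {ι : Type*} (s : Finset ι) (f : ι → Matrix (Fin m) (Fin m) L) (b : ι → ℝ)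
    (h : ∀ i ∈ s, Bd v (b i) (f i)) : Bd v (∑ i ∈ s, b i) (∑ i ∈ s, f i) := by
  intro i j
  rw [Matrix.sum_apply]
  exact (v.sum_le _ _).trans (Finset.sum_le_sum fun k hk => h k hk i j)

theorem Bd.det (hA : Bd v S A) : v A.det ≤ (m.factorial : ℝ) * S ^ m := by
  have := Matrix.det_le (A := A) (abv := v) (x := S) (fun i j => hA i j)
  simpa [nsmul_eq_mul] using this

theorem Bd.adjugate (hA : Bd v S A) (hS : 1 ≤ S) :
    Bd v ((m.factorial : ℝ) * S ^ m) A.adjugate := by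
  intro i j
  rw [Matrix.adjugate_apply]
  refine Bd.det (S := S) ?_
  intro a b
  rw [Matrix.updateRow_apply]
  split_ifs with h
  · by_cases hb : b = i
    · subst hb; simpa using hS
    · rw [Pi.single_eq_of_ne hb]; simpa using (zero_le_one.trans hS)
  · exact hA a b

theorem Bd.trace (hA : Bd v S A) : v A.trace ≤ m * S := by
  rw [Matrix.trace]
  refine (v.sum_le _ _).trans ?_
  refine (Finset.sum_le_sum fun i _ => hA i i).trans ?_
  simp

end Bd

section ppm
variable {m : ℕ} {L : Type*} [Field L] (v : AbsoluteValue L ℝ)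

theorem norm_mulVec_le (A : Matrix (Fin m) (Fin m) L) (S : ℝ) (hS : 0 ≤ S) (hA : Bd v S A) :
    letI := v.toNormedField
    ∀ u : Fin m → L, ‖A.mulVec u‖ ≤ m * S * ‖u‖ := by
  letI := v.toNormedField
  intro u
  rw [pi_norm_le_iff_of_nonneg (by positivity)]
  intro i
  rw [Matrix.mulVec, dotProduct]
  refine (norm_sum_le _ _).trans ?_
  calc ∑ k, ‖A i k * u k‖ ≤ ∑ _k : Fin m, S * ‖u‖ := by
        apply Finset.sum_le_sum
        intro k _
        rw [norm_mul]
        exact mul_le_mul (hA i k) (norm_le_pi_norm u k) (norm_nonneg _) hS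
    _ = _ := by simp [mul_assoc]

theorem pingpong_mat (e G Gi x y : Matrix (Fin m) (Fin m) L) (T α γ : ℝ)
    (he : e * e = e) (hG : G * e = e * G) (hGi : Gi * G = 1) (hx : x.det ≠ 0)
    (hy : y * (1 - e + e * x * e) = 1) (hT : 1 ≤ T) (hα : 0 ≤ α) (hγ : 0 < γ)
    (be : Bd v T e) (bx : Bd v T x) (bY : Bd v T y)
    (ba : Bd v α (G * (1 - e))) (bg : Bd v γ (Gi * e))
    (hκ : 640 * (m + 1) ^ 10 * T ^ 8 * (α * γ) ≤ 1) (hne : (1 - e) * x * e ≠ 0) :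
    ProjFree L G (x * G) := by
  letI := v.toNormedField
  have hm : (0 : ℝ) ≤ m := by positivity
  refine ProjFree.of_algHom (Matrix.toLinAlgEquiv' (R := L) (n := Fin m))
    (map_mul _) (map_one _) (fun c X => map_smul (Matrix.toLinAlgEquiv' (R := L) (n := Fin m)) c X) ?_
  have happ : ∀ (X : Matrix (Fin m) (Fin m) L) u,
    (Matrix.toLinAlgEquiv' (R := L) (n := Fin m) X) u = X.mulVec u := fun X u => rfl
  have hmul : ((Matrix.toLinAlgEquiv' (R := L) (n := Fin m))
    (x * G)) =
    (Matrix.toLinAlgEquiv' (R := L) (n := Fin m) x : Module.End L (Fin m → L)) *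
      (Matrix.toLinAlgEquiv' (R := L) (n := Fin m) G : Module.End L (Fin m → L)) :=
    map_mul _ _ _
  rw [hmul]
  have hT1 : T ≤ T ^ 2 := by nlinarith
  have bex : Bd v (m * (T * T)) (e * x) := be.mul bx (by linarith)
  refine pingpong (L := L) (E := Fin m → L) (Matrix.toLinAlgEquiv' e) (Matrix.toLinAlgEquiv' G)
    (Matrix.toLinAlgEquiv' x) (2 * (m + 1) ^ 2 * T ^ 2) ((m + 1) * α) (1 / ((m + 1) * γ))
    ?_ ?_ ?_ ?_ ?_ ?_ ?_ ?_ ?_ ?_ ?_ ?_ ?_ ?_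
  · intro u; simp only [happ, Matrix.mulVec_mulVec, he]
  · intro u; simp only [happ, Matrix.mulVec_mulVec, hG]
  · intro u w huw
    simp only [happ] at huw
    have := congrArg Gi.mulVec huw
    simpa [Matrix.mulVec_mulVec, hGi] using this
  · intro u w huw
    simp only [happ] at huw
    exact Matrix.mulVec_injective_of_isUnit
      ((Matrix.isUnit_iff_isUnit_det _).2 (isUnit_iff_ne_zero.2 hx)) huw
  · have : (1 : ℝ) ≤ (m + 1) ^ 2 := one_le_pow₀ (by linarith)
    have : (1 : ℝ) ≤ T ^ 2 := one_le_pow₀ hT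
    nlinarith
  · intro u
    simp only [happ, Matrix.mulVec_mulVec, ← Matrix.sub_mulVec]
    refine (norm_mulVec_le v _ (T + m * (T * T)) (by positivity) (bx.sub bex) u).trans ?_
    refine mul_le_mul_of_nonneg_right ?_ (norm_nonneg _)
    have : (m : ℝ) * T ≤ m * T ^ 2 := by gcongr
    nlinarith [sq_nonneg T]
  · intro u
    simp only [happ, Matrix.mulVec_mulVec]
    refine (norm_mulVec_le v _ (m * (T * T)) (by positivity) bex u).trans ?_
    refine mul_le_mul_of_nonneg_right ?_ (norm_nonneg _)
    have : (m : ℝ) * T ≤ m * T ^ 2 := by gcongr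
    nlinarith [sq_nonneg T]
  · intro u
    simp only [happ, Matrix.mulVec_mulVec]
    have h5 : e = y * (e * (x * e)) := by
      have h6 : (1 - e + e * x * e) * e = e * (x * e) := by
        rw [add_mul, sub_mul, one_mul, he, sub_self, zero_add, mul_assoc, mul_assoc, he]
      calc e = 1 * e := (one_mul e).symm
        _ = y * ((1 - e + e * x * e) * e) := by rw [← mul_assoc, hy]
        _ = _ := by rw [h6]
    conv_lhs => rw [h5, ← Matrix.mulVec_mulVec]
    refine (norm_mulVec_le v _ T (by positivity) bY _).trans ?_
    refine mul_le_mul_of_nonneg_right ?_ (norm_nonneg _)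
    have : (m : ℝ) * T ≤ m * T ^ 2 := by gcongr
    have h9 : (m : ℝ) ≤ 2 * (m + 1) ^ 2 := by nlinarith
    exact this.trans (mul_le_mul_of_nonneg_right h9 (sq_nonneg T))
  · positivity
  · positivity
  · intro u
    simp only [happ]
    have h5 : G.mulVec (u - e.mulVec u) = (G * (1 - e)).mulVec (u - e.mulVec u) := by
      rw [← Matrix.mulVec_mulVec, Matrix.sub_mulVec, Matrix.one_mulVec, Matrix.mulVec_sub e,
        Matrix.mulVec_mulVec, he, sub_self, sub_zero]
    rw [h5]
    refine (norm_mulVec_le v _ α hα ba _).trans ?_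
    gcongr
    linarith
  · intro u
    simp only [happ]
    have h5 : e.mulVec u = (Gi * e).mulVec (G.mulVec (e.mulVec u)) := by
      rw [Matrix.mulVec_mulVec, Matrix.mulVec_mulVec]
      congr 1
      rw [mul_assoc, mul_assoc, ← mul_assoc e G e, ← hG, mul_assoc G, he, ← mul_assoc, hGi,
        one_mul]
    have := norm_mulVec_le v _ γ hγ.le bg (G.mulVec (e.mulVec u))
    rw [← h5] at this
    rw [one_div_mul_eq_div, div_le_iff₀ (by positivity)]
    refine this.trans ?_
    rw [mul_comm]
    gcongr
    linarith
  · rw [le_div_iff₀ (by positivity)]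
    refine le_trans (le_of_eq ?_) hκ
    ring
  · by_contra hcon
    push Not at hcon
    apply hne
    have : ∀ u, ((1 - e) * x * e).mulVec u = 0 := by
      intro u
      have h6 := hcon u
      simp only [happ, Matrix.mulVec_mulVec] at h6
      rw [Matrix.sub_mul, one_mul, Matrix.sub_mul, Matrix.sub_mulVec, h6, Matrix.mul_assoc, sub_self]
    refine (Matrix.toLin' (R := L)).injective ?_
    refine LinearMap.ext fun u => ?_
    rw [Matrix.toLin'_apply, this, map_zero, LinearMap.zero_apply]

theorem pingpong_mat' (e G Gi x y : Matrix (Fin m) (Fin m) L) (T α γ : ℝ)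
    (he : e * e = e) (hG : G * e = e * G) (hGi : Gi * G = 1) (hx : x.det ≠ 0)
    (hy : y * (1 - e + e * x * e) = 1) (hT : 1 ≤ T) (hα : 0 ≤ α) (hγ : 0 < γ)
    (be : Bd v T e) (bx : Bd v T x) (bY : Bd v T y)
    (ba : Bd v α (G * (1 - e))) (bg : Bd v γ (Gi * e))
    (hκ : 640 * (m + 1) ^ 10 * T ^ 8 * (α * γ) ≤ 1) (hne : e * x * (1 - e) ≠ 0) :
    ProjFree L G (G * x) := by
  refine ProjFree.of_algHom_anti (fun X : Matrix (Fin m) (Fin m) L => Xᵀ)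
    (fun X Y => Matrix.transpose_mul X Y) Matrix.transpose_one
    (fun c X => Matrix.transpose_smul c X) ?_
  have hGie : Gi * e = e * Gi := by
    have hGi' : G * Gi = 1 := mul_eq_one_comm.1 hGi
    calc Gi * e = Gi * (e * G) * Gi := by rw [mul_assoc, mul_assoc, hGi', mul_one]
      _ = _ := by rw [← hG, ← mul_assoc, hGi, one_mul]
  simp only [Matrix.transpose_mul]
  refine pingpong_mat v eᵀ Gᵀ Giᵀ xᵀ yᵀ T α γ ?_ ?_ ?_ ?_ ?_ hT hα hγ be.transpose bx.transpose
    bY.transpose ?_ ?_ hκ ?_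
  · rw [← Matrix.transpose_mul, he]
  · rw [← Matrix.transpose_mul, ← Matrix.transpose_mul, hG]
  · rw [← Matrix.transpose_mul, mul_eq_one_comm.1 hGi, Matrix.transpose_one]
  · rwa [Matrix.det_transpose]
  · have := congrArg Matrix.transpose (mul_eq_one_comm.1 hy)
    simpa [Matrix.transpose_mul, mul_assoc] using this
  · have := ba.transpose
    rw [mul_sub, mul_one, hG, Matrix.transpose_sub, Matrix.transpose_mul] at this
    rw [mul_sub, mul_one]; exact this
  · rw [← Matrix.transpose_mul, ← hGie]; exact bg.transpose
  · intro h0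
    apply hne
    have := congrArg Matrix.transpose h0
    simpa [Matrix.transpose_mul, mul_assoc] using this
end ppm
end LD

end

section
namespace LD

abbrev SL (m : ℕ) (K : Type*) [CommRing K] := Matrix.SpecialLinearGroup (Fin m) K

theorem coe_map_mul {G K : Type*} [Group G] [Field K] {m : ℕ} (φ : G →* SL m K) (g h : G) :
    (φ (g * h) : Matrix (Fin m) (Fin m) K) = (φ g : Matrix (Fin m) (Fin m) K) * φ h := by
  rw [map_mul]; rfl

section fun_space
variable {G K : Type*} [Group G] [Field K] {m : ℕ}

/-- Left translation on functions. -/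
def transl (K : Type*) [Field K] {G : Type*} [Group G] (h : G) : (G → K) →ₐ[K] (G → K) where
  toFun F := fun g => F (h * g)
  map_one' := rfl
  map_mul' _ _ := rfl
  map_zero' := rfl
  map_add' _ _ := rfl
  commutes' _ := rfl

theorem transl_apply (h : G) (F : G → K) (g : G) : transl K h F g = F (h * g) := rfl

theorem transl_injective (h : G) : Function.Injective (transl K h) := by
  intro F F' hF
  funext g
  have := congrFun hF (h⁻¹ * g)
  simpa [transl_apply] using this

/-- Translation-invariant submodule of functions. -/
def TInv (P : Submodule K (G → K)) : Prop := ∀ (h : G), ∀ F ∈ P, transl K h F ∈ P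

/-- A recurrence principle. -/
theorem recurrence (P : Submodule K (G → K)) [FiniteDimensional K P] (hP : TInv P) (h y : G)
    (F : G → K) (hF : F ∈ P) (hz : ∀ k : ℕ, F (h ^ (k + 1) * y) = 0) : F y = 0 := by
  let W (a : ℕ) : Submodule K (G → K) :=
    { carrier := {F | F ∈ P ∧ ∀ k : ℕ, F (h ^ (k + a) * y) = 0}
      add_mem' := fun {F F'} h1 h2 => ⟨P.add_mem h1.1 h2.1, fun k => by
        rw [Pi.add_apply, h1.2, h2.2, add_zero]⟩
      zero_mem' := ⟨P.zero_mem, fun k => rfl⟩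
      smul_mem' := fun c F h1 => ⟨P.smul_mem c h1.1, fun k => by
        rw [Pi.smul_apply, h1.2, smul_zero]⟩ }
  have hWP : ∀ a, W a ≤ P := fun a F hF => hF.1
  have : ∀ a, FiniteDimensional K (W a) := fun a => Submodule.finiteDimensional_of_le (hWP a)
  have hle : W 0 ≤ W 1 := by
    rintro F ⟨h1, h2⟩
    exact ⟨h1, fun k => h2 (k + 1)⟩
  have hmap : (W 1).map (transl K h).toLinearMap ≤ W 0 := by
    rintro _ ⟨F, ⟨h1, h2⟩, rfl⟩
    refine ⟨hP h F h1, fun k => ?_⟩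
    have := h2 k
    rw [pow_succ', mul_assoc] at this
    exact this
  have hfr : Module.finrank K (W 1) ≤ Module.finrank K (W 0) := by
    rw [(Submodule.equivMapOfInjective (transl K h).toLinearMap (transl_injective h)
      (W 1)).finrank_eq]
    exact Submodule.finrank_mono hmap
  have heq : W 0 = W 1 := Submodule.eq_of_le_of_finrank_le hle hfr
  have : F ∈ W 0 := by rw [heq]; exact ⟨hF, hz⟩
  simpa using this.2 0

theorem one_mem_pow {S : Set G} (h1 : (1 : G) ∈ S) (n : ℕ) : (1 : G) ∈ S ^ n := by
  have := Set.pow_mem_pow (n := n) h1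
  simpa using this

theorem pow_subset {S : Set G} (h1 : (1 : G) ∈ S) {a b : ℕ} (hab : a ≤ b) : S ^ a ⊆ S ^ b :=
  Set.pow_subset_pow_right h1 hab

/-- Escape: a function vanishing on a big ball vanishes on the group. -/
theorem escape (P : Submodule K (G → K)) [FiniteDimensional K P] (hP : TInv P) (S : Set G)
    (h1 : (1 : G) ∈ S) (n : ℕ) (hn : Module.finrank K P ≤ n) (F : G → K) (hF : F ∈ P)
    (hz : ∀ g ∈ S ^ n, F g = 0) : ∀ g ∈ Subgroup.closure S, F g = 0 := by
  let W (a : ℕ) : Submodule K (G → K) :=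
    { carrier := {F | F ∈ P ∧ ∀ g ∈ S ^ a, F g = 0}
      add_mem' := fun {F F'} h1 h2 => ⟨P.add_mem h1.1 h2.1, fun k hk => by
        rw [Pi.add_apply, h1.2 k hk, h2.2 k hk, add_zero]⟩
      zero_mem' := ⟨P.zero_mem, fun k _ => rfl⟩
      smul_mem' := fun c F h1 => ⟨P.smul_mem c h1.1, fun k hk => by
        rw [Pi.smul_apply, h1.2 k hk, smul_zero]⟩ }
  have hWP : ∀ a, W a ≤ P := fun a F hF => hF.1
  have : ∀ a, FiniteDimensional K (W a) := fun a => Submodule.finiteDimensional_of_le (hWP a)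
  have hanti : ∀ a b, a ≤ b → W b ≤ W a := fun a b hab F hF =>
    ⟨hF.1, fun g hg => hF.2 g (pow_subset h1 hab hg)⟩
  have hex : ∃ a ≤ n, W a = W (a + 1) := by
    by_contra hcon
    push Not at hcon
    have : ∀ a ≤ n + 1, Module.finrank K (W a) + a ≤ n := by
      intro a
      induction a with
      | zero => intro _; exact (Submodule.finrank_mono (hWP 0)).trans hn
      | succ a ih =>
        intro ha
        have h2 := ih (by omega)
        have h3 : W (a + 1) < W a :=
          lt_of_le_of_ne (hanti _ _ (by omega)) (fun h => hcon a (by omega) h.symm)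
        have := Submodule.finrank_lt_finrank_of_lt h3
        omega
    have := this (n + 1) le_rfl
    omega
  obtain ⟨a, ha, hWa⟩ := hex
  have hstab : ∀ s ∈ S, (W a).map (transl K s).toLinearMap = W a := by
    intro s hs
    have hle : (W a).map (transl K s).toLinearMap ≤ W a := by
      rintro _ ⟨F, hF, rfl⟩
      rw [SetLike.mem_coe, hWa] at hF
      refine ⟨hP s F hF.1, fun g hg => hF.2 (s * g) ?_⟩
      rw [pow_succ']
      exact Set.mul_mem_mul hs hg
    exact Submodule.eq_of_le_of_finrank_eq hle
      (Submodule.equivMapOfInjective (transl K s).toLinearMap (transl_injective s)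
      (W a)).finrank_eq.symm
  have hall : ∀ g ∈ Subgroup.closure S, ∀ F, F ∈ W a ↔ transl K g F ∈ W a := by
    intro g hg
    induction hg using Subgroup.closure_induction with
    | mem s hs =>
      intro F
      constructor
      · intro hF
        rw [← hstab s hs]; exact ⟨F, hF, rfl⟩
      · intro hF
        rw [← hstab s hs] at hF
        obtain ⟨F', hF', h2⟩ := hF
        rwa [← transl_injective s h2]
    | one =>
      intro F
      have : transl K (1 : G) F = F := by funext g; simp [transl_apply]
      rw [this]
    | mul x y _ _ hx hy =>
      intro F
      have : transl K (x * y) F = transl K y (transl K x F) := by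
        funext g; simp [transl_apply, mul_assoc]
      rw [this, ← hy, ← hx]
    | inv x _ hx =>
      intro F
      rw [hx (transl K x⁻¹ F)]
      have : transl K x (transl K x⁻¹ F) = F := by funext g; simp [transl_apply]
      rw [this]
  intro g hg
  have hFa : F ∈ W a := hanti a n ha ⟨hF, hz⟩
  have := ((hall g hg F).1 hFa).2 1 (one_mem_pow h1 a)
  simpa [transl_apply] using this

/-- Functions spanned by constants and matrix coefficients. -/
def E1 (φ : G →* SL m K) : Submodule K (G → K) :=
  Submodule.span K (Set.range fun o : Option (Fin m × Fin m) =>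
    (o.elim (1 : G → K) fun ij => fun g => (φ g : Matrix (Fin m) (Fin m) K) ij.1 ij.2))

theorem one_mem_E1 (φ : G →* SL m K) : (1 : G → K) ∈ E1 φ :=
  Submodule.subset_span ⟨none, rfl⟩

theorem entry_mem_E1 (φ : G →* SL m K) (i j : Fin m) :
    (fun g => (φ g : Matrix (Fin m) (Fin m) K) i j) ∈ E1 φ :=
  Submodule.subset_span ⟨some (i, j), rfl⟩

theorem const_mem_E1 (φ : G →* SL m K) (c : K) : (fun _ => c : G → K) ∈ E1 φ := by
  have := (E1 φ).smul_mem c (one_mem_E1 φ)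
  convert this using 1
  funext g; simp

theorem tinv_E1 (φ : G →* SL m K) (h : G) :
    (E1 φ).map (transl K h).toLinearMap ≤ E1 φ := by
  rw [E1, Submodule.map_span, Submodule.span_le]
  rintro _ ⟨_, ⟨o, rfl⟩, rfl⟩
  rcases o with _ | ⟨i, j⟩
  · exact one_mem_E1 φ
  · have : (transl K h).toLinearMap (fun g => (φ g : Matrix (Fin m) (Fin m) K) i j)
      = ∑ k, (φ h : Matrix (Fin m) (Fin m) K) i k •
        fun g => (φ g : Matrix (Fin m) (Fin m) K) k j := by
      funext g
      simp only [AlgHom.toLinearMap_apply, transl_apply, coe_map_mul,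
        Matrix.mul_apply, Finset.sum_apply, Pi.smul_apply, smul_eq_mul]
    exact this ▸ Submodule.sum_mem _ fun k _ => Submodule.smul_mem _ _ (entry_mem_E1 φ k j)

theorem tinv_pow (φ : G →* SL m K) (D : ℕ) : TInv (E1 φ ^ D) := by
  intro h F hF
  have : (E1 φ ^ D).map (transl K h).toLinearMap ≤ E1 φ ^ D := by
    rw [Submodule.map_pow]
    exact pow_le_pow_left' (tinv_E1 φ h) D
  exact this ⟨F, hF, rfl⟩

theorem pow_mono_E1 (φ : G →* SL m K) {a b : ℕ} (hab : a ≤ b) : E1 φ ^ a ≤ E1 φ ^ b := by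
  refine pow_le_pow_right' ?_ hab
  rw [Submodule.one_eq_span, Submodule.span_le, Set.singleton_subset_iff]
  exact one_mem_E1 φ

theorem E1_pow_eq (φ : G →* SL m K) (D : ℕ) : ∃ t : Finset (G → K), t.card ≤ (m ^ 2 + 1) ^ D ∧
    E1 φ ^ D = Submodule.span K (t : Set (G → K)) := by
  classical
  let t0 : Finset (G → K) := Finset.univ.image fun o : Option (Fin m × Fin m) =>
    (o.elim (1 : G → K) fun ij => fun g => (φ g : Matrix (Fin m) (Fin m) K) ij.1 ij.2)
  refine ⟨t0 ^ D, ?_, ?_⟩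
  · refine Finset.card_pow_le.trans ?_
    refine Nat.pow_le_pow_left ?_ D
    refine Finset.card_image_le.trans ?_
    simp [sq]
  · rw [E1, Submodule.span_pow]
    congr 1
    rw [Finset.coe_pow]
    congr 1
    simp [t0]

instance fd_E1_pow (φ : G →* SL m K) (D : ℕ) :
    FiniteDimensional K (E1 φ ^ D : Submodule K (G → K)) := by
  obtain ⟨t, _, ht⟩ := E1_pow_eq φ D
  rw [ht]
  exact FiniteDimensional.span_finset K t

theorem finrank_E1_pow (φ : G →* SL m K) (D : ℕ) :
    Module.finrank K (E1 φ ^ D : Submodule K (G → K)) ≤ (m ^ 2 + 1) ^ D := by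
  obtain ⟨t, h1, ht⟩ := E1_pow_eq φ D
  rw [ht]
  exact (finrank_span_finset_le_card t).trans h1

theorem prod_mem_pow {ι : Type*} (P : Submodule K (G → K)) (s : Finset ι) (f : ι → G → K)
    (hf : ∀ i ∈ s, f i ∈ P) : ∏ i ∈ s, f i ∈ P ^ s.card := by
  classical
  induction s using Finset.induction_on with
  | empty => simp [Submodule.one_eq_span]
  | insert a s ha ih =>
    rw [Finset.prod_insert ha, Finset.card_insert_of_notMem ha, pow_succ']
    exact Submodule.mul_mem_mul (hf a (by simp)) (ih fun i hi => hf i (by simp [hi]))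

/-- The determinant of a matrix of functions in `P`. -/
theorem det_mem_pow (P : Submodule K (G → K)) (X : G → Matrix (Fin m) (Fin m) K)
    (hX : ∀ i j, (fun g => X g i j) ∈ P) : (fun g => (X g).det) ∈ P ^ m := by
  have : (fun g => (X g).det) = ∑ σ : Equiv.Perm (Fin m), ((Equiv.Perm.sign σ : ℤ) : K) •
      ∏ i, fun g => X g (σ i) i := by
    funext g
    rw [Matrix.det_apply']
    simp [Finset.sum_apply, Finset.prod_apply]
  rw [this]
  refine Submodule.sum_mem _ fun σ _ => Submodule.smul_mem _ _ ?_
  have := prod_mem_pow P Finset.univ (fun i => fun g => X g (σ i) i) (fun i _ => hX (σ i) i)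
  simpa using this

end fun_space

/-- The rigidity lemma. -/
theorem core {G Ω : Type*} [Group G] [Field Ω] {m : ℕ} (φ : G →* SL m Ω) (Comm : Subgroup G)
    (e : Matrix (Fin m) (Fin m) Ω) (he : e * e = e)
    (hc : ∀ c ∈ Comm, (φ c : Matrix (Fin m) (Fin m) Ω) * e = e * φ c) (M : Submonoid G)
    (hM : ∀ x ∈ M, (1 - e + e * (φ x : Matrix (Fin m) (Fin m) Ω) * e).det ≠ 0 → x ∈ Comm)
    (n : ℕ) (x : Fin n → G) (hx : ∀ i, x i ∈ M) (hxx : ∀ i j, i ≠ j → (x i)⁻¹ * x j ∉ Comm) :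
    n ≤ (m ^ 2 + 1) ^ m := by
  let F : G → Ω := fun g => (1 - e + e * (φ g : Matrix (Fin m) (Fin m) Ω) * e).det
  have hFP : F ∈ E1 φ ^ m := by
    apply det_mem_pow
    intro i j
    have : (fun g => (1 - e + e * (φ g : Matrix (Fin m) (Fin m) Ω) * e) i j) =
      (fun _ => (1 - e) i j) + ∑ l, ∑ k, (e i k * e l j) •
        fun g => (φ g : Matrix (Fin m) (Fin m) Ω) k l := by
      funext g
      simp only [Matrix.add_apply, Matrix.mul_apply, Pi.add_apply, Finset.sum_apply,
        Pi.smul_apply, smul_eq_mul, Finset.sum_mul]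
      congr 1
      refine Finset.sum_congr rfl fun l _ => Finset.sum_congr rfl fun k _ => ?_
      ring
    rw [this]
    refine Submodule.add_mem _ (const_mem_E1 φ _) ?_
    exact Submodule.sum_mem _ fun l _ => Submodule.sum_mem _ fun k _ =>
      Submodule.smul_mem _ _ (entry_mem_E1 φ k l)
  have hmul : ∀ g, ∀ c ∈ Comm, F (g * c) = F g * F c := by
    intro g c hcc
    have h1 := hc c hcc
    have : (1 - e + e * (φ (g * c) : Matrix (Fin m) (Fin m) Ω) * e) =
      (1 - e + e * (φ g : Matrix (Fin m) (Fin m) Ω) * e) *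
      (1 - e + e * (φ c : Matrix (Fin m) (Fin m) Ω) * e) := by
      rw [coe_map_mul]
      have h2 : e * (φ c : Matrix (Fin m) (Fin m) Ω) * e = φ c * e := by
        rw [← h1, mul_assoc, he]
      rw [h2]
      have h3 : (1 - e) * (1 - e) = 1 - e := by
        rw [mul_sub, sub_mul, one_mul, mul_one, sub_mul, one_mul, he, sub_self, sub_zero]
      have h4 : (1 - e) * ((φ c : Matrix (Fin m) (Fin m) Ω) * e) = 0 := by
        rw [sub_mul, one_mul, ← mul_assoc, ← h1, mul_assoc, he, sub_self]
      have h5 : e * (φ g : Matrix (Fin m) (Fin m) Ω) * e * (1 - e) = 0 := by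
        rw [mul_sub, mul_one, mul_assoc _ e e, he, sub_self]
      have h6 : e * (φ g : Matrix (Fin m) (Fin m) Ω) * e * (φ c * e) =
          e * (φ g * φ c) * e := by
        have : e * ((φ c : Matrix (Fin m) (Fin m) Ω) * e) = φ c * e := by
          rw [← mul_assoc, h2]
        rw [mul_assoc _ e, this]
        simp only [mul_assoc]
      rw [add_mul, mul_add, mul_add, h3, h4, h5, h6, add_zero, zero_add]
    change (_ : Matrix (Fin m) (Fin m) Ω).det = _
    rw [this, det_mul]
  have hF1 : F 1 = 1 := by
    simp [F, he]
  have hFc : ∀ c ∈ Comm, F c ≠ 0 := by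
    intro c hcc h0
    have := hmul c⁻¹ c hcc
    rw [inv_mul_cancel, hF1, h0, mul_zero] at this
    exact one_ne_zero this
  have hdiag : ∀ i j, i ≠ j → F ((x i)⁻¹ * x j) = 0 := by
    intro i j hij
    by_contra hne
    obtain ⟨k, hk⟩ : ∃ k : ℕ, F (x i ^ (k + 1) * ((x i)⁻¹ * x j)) ≠ 0 := by
      by_contra hcon
      push Not at hcon
      exact hne (recurrence _ (tinv_pow φ m) (x i) _ F hFP hcon)
    obtain ⟨l, hl⟩ : ∃ l : ℕ, F (x i ^ (l + 1) * 1) ≠ 0 := by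
      by_contra hcon
      push Not at hcon
      have := recurrence _ (tinv_pow φ m) (x i) 1 F hFP hcon
      rw [hF1] at this
      exact one_ne_zero this
    rw [mul_one] at hl
    have hk' : x i ^ k * x j ∈ Comm := by
      apply hM _ (M.mul_mem (M.pow_mem (hx i) k) (hx j))
      rw [pow_succ, mul_assoc, mul_inv_cancel_left] at hk
      exact hk
    have hl' : x i ^ (l + 1) ∈ Comm := hM _ (M.pow_mem (hx i) _) hl
    set c := (x i ^ (l + 1)) ^ (-((k : ℤ) + 1)) * (x i ^ k * x j) with hcd
    have hcC : c ∈ Comm := Comm.mul_mem (Comm.zpow_mem hl' _) hk'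
    have hdec : (x i)⁻¹ * x j = x i ^ (l * (k + 1)) * c := by
      rw [hcd, ← mul_assoc, ← mul_assoc]
      congr 1
      rw [← zpow_natCast (x i) (l + 1), ← _root_.zpow_mul, ← zpow_natCast, ← zpow_natCast, ← _root_.zpow_add,
        ← _root_.zpow_add, ← _root_.zpow_neg_one]
      congr 1
      push_cast
      ring
    rw [hdec, hmul _ c hcC] at hne
    have h7 : x i ^ (l * (k + 1)) ∈ Comm :=
      hM _ (M.pow_mem (hx i) _) (left_ne_zero_of_mul hne)
    apply hxx i j hij
    rw [hdec]
    exact Comm.mul_mem h7 hcC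
  let f : Fin n → (E1 φ ^ m : Submodule Ω (G → Ω)) := fun i =>
    ⟨transl Ω (x i)⁻¹ F, tinv_pow φ m _ F hFP⟩
  have hli : LinearIndependent Ω f := by
    rw [Fintype.linearIndependent_iff]
    intro c hsum j
    have := congrFun (congrArg Subtype.val hsum) (x j)
    simp only [AddSubmonoidClass.coe_finsetSum, SetLike.val_smul, Finset.sum_apply,
      Pi.smul_apply, smul_eq_mul, ZeroMemClass.coe_zero, Pi.zero_apply, f] at this
    rw [Finset.sum_eq_single j] at this
    · simpa [transl_apply, hF1] using this
    · intro i _ hij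
      rw [transl_apply, hdiag i j hij, mul_zero]
    · simp
  have := hli.fintype_card_le_finrank
  rw [Fintype.card_fin] at this
  exact this.trans (finrank_E1_pow φ m)

end LD

end

section
namespace LD

/-- A real sequence bounded by a power of `ρ`, along the ultrafilter. -/
def MB (U : Ultrafilter ℕ) (ρ : ℕ → ℝ) (b : ℕ → ℝ) : Prop := ∃ j : ℕ, ∀ᶠ N in U, b N ≤ ρ N ^ j

section MB
variable {U : Ultrafilter ℕ} {ρ : ℕ → ℝ} {b c : ℕ → ℝ}

theorem MB.mono (hb : MB U ρ b) (h : ∀ᶠ N in U, c N ≤ b N) : MB U ρ c := by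
  obtain ⟨j, hj⟩ := hb
  exact ⟨j, by filter_upwards [hj, h] with N h1 h2 using h2.trans h1⟩

theorem MB.add (hρ : ∀ N, 2 ≤ ρ N) (hb : MB U ρ b) (hc : MB U ρ c) :
    MB U ρ (fun N => b N + c N) := by
  obtain ⟨j, hj⟩ := hb
  obtain ⟨i, hi⟩ := hc
  refine ⟨max j i + 1, ?_⟩
  filter_upwards [hj, hi] with N h1 h2
  have h3 : ρ N ^ j ≤ ρ N ^ max j i := pow_le_pow_right₀ (by linarith [hρ N]) (le_max_left _ _)
  have h4 : ρ N ^ i ≤ ρ N ^ max j i := pow_le_pow_right₀ (by linarith [hρ N]) (le_max_right _ _)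
  have h5 : 0 ≤ ρ N ^ max j i := pow_nonneg (by linarith [hρ N]) _
  rw [pow_succ]
  nlinarith [hρ N]

theorem MB.mul (hρ : ∀ N, 2 ≤ ρ N) (hb : MB U ρ b) (hc : MB U ρ c) (hc0 : ∀ N, 0 ≤ c N) :
    MB U ρ (fun N => b N * c N) := by
  obtain ⟨j, hj⟩ := hb
  obtain ⟨i, hi⟩ := hc
  refine ⟨j + i, ?_⟩
  filter_upwards [hj, hi] with N h1 h2
  rw [pow_add]
  exact mul_le_mul h1 h2 (hc0 N) (pow_nonneg (by linarith [hρ N]) _)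

theorem MB.const (hρ : ∀ N, 2 ≤ ρ N) (r : ℝ) : MB U ρ (fun _ => r) := by
  obtain ⟨j, hj⟩ := pow_unbounded_of_one_lt r (one_lt_two)
  refine ⟨j, Filter.Eventually.of_forall fun N => hj.le.trans ?_⟩
  exact pow_le_pow_left₀ (by norm_num) (hρ N) j

theorem MB.pow (hρ : ∀ N, 2 ≤ ρ N) (hb : MB U ρ b) (hb0 : ∀ N, 0 ≤ b N) (n : ℕ) :
    MB U ρ (fun N => b N ^ n) := by
  induction n with
  | zero => simpa using MB.const hρ 1
  | succ n ih =>
    simp only [pow_succ]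
    exact ih.mul hρ hb hb0

theorem MB.sum (hρ : ∀ N, 2 ≤ ρ N) {ι : Type*} (s : Finset ι) (f : ι → ℕ → ℝ)
    (h : ∀ i ∈ s, MB U ρ (f i)) : MB U ρ (fun N => ∑ i ∈ s, f i N) := by
  classical
  induction s using Finset.induction_on with
  | empty => simpa using MB.const hρ 0
  | insert a s ha ih =>
    simp only [Finset.sum_insert ha]
    exact (h a (by simp)).add hρ (ih fun i hi => h i (by simp [hi]))

theorem MB.self : MB U ρ ρ := ⟨1, by simp⟩
end MB

section ring
variable {L : ℕ → Type} [∀ N, Field (L N)] (v : ∀ N, AbsoluteValue (L N) ℝ) (U : Ultrafilter ℕ)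
  (ρ : ℕ → ℝ) (hρ : ∀ N, 2 ≤ ρ N)

/-- The ring of moderate sequences. -/
def ModR : Subring (∀ N, L N) where
  carrier := {x | MB U ρ (fun N => v N (x N))}
  mul_mem' := fun {x y} hx hy => by
    have := MB.mul hρ hx hy (fun N => (v N).nonneg _)
    simpa [Set.mem_ofPred_eq, map_mul] using this
  one_mem' := by simpa using MB.const hρ 1
  add_mem' := fun {x y} hx hy => (MB.add hρ hx hy).mono
    (Filter.Eventually.of_forall fun N => (v N).add_le _ _)
  zero_mem' := by simpa using MB.const hρ 0
  neg_mem' := fun {x} hx => by simpa using hx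

/-- The ideal of negligible sequences. -/
def Negl : Ideal (ModR v U ρ hρ) where
  carrier := {x | ∀ j : ℕ, ∀ᶠ N in U, v N (x.1 N) * ρ N ^ j ≤ 1}
  add_mem' := fun {x y} hx hy j => by
    filter_upwards [hx (j + 1), hy (j + 1)] with N h1 h2
    have h3 := (v N).add_le (x.1 N) (y.1 N)
    have h5 : 0 ≤ ρ N ^ j := pow_nonneg (by linarith [hρ N]) _
    have h6 : v N ((x + y).1 N) * ρ N ^ j ≤ (v N (x.1 N) + v N (y.1 N)) * ρ N ^ j :=
      mul_le_mul_of_nonneg_right h3 h5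
    rw [pow_succ] at h1 h2
    have h7 : 0 ≤ v N (x.1 N) * ρ N ^ j := mul_nonneg ((v N).nonneg _) h5
    have h8 : 0 ≤ v N (y.1 N) * ρ N ^ j := mul_nonneg ((v N).nonneg _) h5
    have := hρ N
    nlinarith
  zero_mem' := fun j => Filter.Eventually.of_forall fun N => by
    show v N 0 * _ ≤ 1
    simp
  smul_mem' := fun c x hx j => by
    obtain ⟨i, hi⟩ := c.2
    filter_upwards [hx (j + i), hi] with N h1 h2
    have h5 : 0 ≤ ρ N ^ j := pow_nonneg (by linarith [hρ N]) _
    have h6 : 0 ≤ ρ N ^ i := pow_nonneg (by linarith [hρ N]) _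
    have : v N ((c • x).1 N) = v N (c.1 N) * v N (x.1 N) := map_mul _ _ _
    rw [this]
    rw [pow_add] at h1
    calc v N (c.1 N) * v N (x.1 N) * ρ N ^ j ≤ ρ N ^ i * v N (x.1 N) * ρ N ^ j := by
          gcongr
      _ = v N (x.1 N) * (ρ N ^ j * ρ N ^ i) := by ring
      _ ≤ 1 := h1

theorem negl_maximal : (Negl v U ρ hρ).IsMaximal := by
  rw [Ideal.isMaximal_iff]
  refine ⟨?_, ?_⟩
  · intro h
    have h1 := h 1
    obtain ⟨N, hN⟩ := h1.exists
    have : v N ((1 : ModR v U ρ hρ).1 N) = 1 := map_one _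
    rw [this] at hN
    linarith [hρ N]
  · intro J x hJ hx hxJ
    have : ∃ j : ℕ, ∀ᶠ N in U, 1 < v N (x.1 N) * ρ N ^ j := by
      by_contra hcon
      push Not at hcon
      apply hx
      intro j
      exact hcon j
    obtain ⟨j, hj⟩ := this
    let y : ModR v U ρ hρ := ⟨fun N => (x.1 N)⁻¹, j, by
      filter_upwards [hj] with N hN
      have h0 : 0 < v N (x.1 N) := by
        rcases (v N).nonneg (x.1 N) |>.eq_or_lt with h | h
        · rw [← h] at hN; norm_num at hN
        · exact h
      rw [map_inv₀, inv_le_iff_one_le_mul₀ h0]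
      linarith [mul_comm (v N (x.1 N)) (ρ N ^ j)]⟩
    have h1 : 1 - y * x ∈ J := by
      apply hJ
      intro i
      filter_upwards [hj] with N hN
      have h0 : x.1 N ≠ 0 := by
        intro h; rw [h] at hN; norm_num at hN
      have : (1 - y * x).1 N = 0 := by
        show 1 - (x.1 N)⁻¹ * x.1 N = 0
        rw [inv_mul_cancel₀ h0, sub_self]
      rw [this]; norm_num
    have := J.add_mem h1 (J.mul_mem_left y hxJ)
    simpa using this

theorem cauchy_bound {F : Type*} [Field F] (w : AbsoluteValue F ℝ) (n : ℕ) (c : Fin n → F) (r : F)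
    (h : r ^ n + ∑ i, c i * r ^ (i : ℕ) = 0) : w r ≤ 1 + ∑ i, w (c i) := by
  have hs : 0 ≤ ∑ i, w (c i) := Finset.sum_nonneg fun i _ => w.nonneg _
  by_cases h1 : w r ≤ 1
  · linarith
  push Not at h1
  rcases Nat.eq_zero_or_pos n with rfl | hn
  · simp at h
  have h2 : w r ^ n ≤ (∑ i, w (c i)) * w r ^ (n - 1) := by
    have : r ^ n = -∑ i, c i * r ^ (i : ℕ) := eq_neg_of_add_eq_zero_left h
    rw [← map_pow, this, w.map_neg]
    refine (w.sum_le _ _).trans ?_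
    rw [Finset.sum_mul]
    apply Finset.sum_le_sum
    intro i _
    rw [map_mul, map_pow]
    have := i.2
    exact mul_le_mul_of_nonneg_left (pow_le_pow_right₀ h1.le (by omega)) (w.nonneg _)
  have h3 : 0 < w r ^ (n - 1) := by positivity
  have h4 : w r ^ n = w r * w r ^ (n - 1) := by
    rw [← pow_succ']; congr 1; omega
  rw [h4] at h2
  have := le_of_mul_le_mul_right h2 h3
  linarith

theorem exists_residue : ∃ (Ω : Type) (_ : Field Ω) (π : ModR v U ρ hρ →+* Ω),
    Function.Surjective π ∧ (∀ z, π z = 0 ↔ ∀ j : ℕ, ∀ᶠ N in U, v N (z.1 N) * ρ N ^ j ≤ 1) ∧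
    ((∀ N, IsAlgClosed (L N)) → IsAlgClosed Ω) := by
  have := negl_maximal v U ρ hρ
  letI : Field (ModR v U ρ hρ ⧸ Negl v U ρ hρ) := Ideal.Quotient.field _
  refine ⟨ModR v U ρ hρ ⧸ Negl v U ρ hρ, inferInstance, Ideal.Quotient.mk _,
    Ideal.Quotient.mk_surjective, fun z => Ideal.Quotient.eq_zero_iff_mem, ?_⟩
  intro hac
  apply IsAlgClosed.of_exists_root
  intro p hp hirr
  set n := p.natDegree with hn
  have hn0 : 0 < n := hirr.natDegree_pos
  have hlift : ∀ i : Fin n, ∃ c : ModR v U ρ hρ, Ideal.Quotient.mk (Negl v U ρ hρ) c = p.coeff i :=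
    fun i => Ideal.Quotient.mk_surjective _
  choose c hc using hlift
  have hroot : ∀ N, ∃ r : L N, r ^ n + ∑ i, (c i).1 N * r ^ (i : ℕ) = 0 := by
    intro N
    have := hac N
    let q : Polynomial (L N) := Polynomial.X ^ n +
      ∑ i : Fin n, Polynomial.C ((c i).1 N) * Polynomial.X ^ (i : ℕ)
    have hq : q.degree = n := by
      rw [Polynomial.degree_add_eq_left_of_degree_lt, Polynomial.degree_X_pow]
      rw [Polynomial.degree_X_pow]
      exact Polynomial.degree_sum_fin_lt _
    obtain ⟨r, hr⟩ := IsAlgClosed.exists_root q (by rw [hq]; exact_mod_cast hn0.ne')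
    refine ⟨r, ?_⟩
    simpa [q, Polynomial.IsRoot, Polynomial.eval_finsetSum] using hr
  choose r hr using hroot
  have hrm : r ∈ ModR v U ρ hρ := by
    have h1 : MB U ρ (fun N => 1 + ∑ i, v N ((c i).1 N)) :=
      (MB.const hρ 1).add hρ (MB.sum hρ _ _ fun i _ => (c i).2)
    exact h1.mono (Filter.Eventually.of_forall fun N => cauchy_bound (v N) n _ _ (hr N))
  refine ⟨Ideal.Quotient.mk _ ⟨r, hrm⟩, ?_⟩
  rw [hp.as_sum, Polynomial.eval_add, Polynomial.eval_finsetSum, ← hn, Finset.sum_range]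
  simp only [Polynomial.eval_pow, Polynomial.eval_X, Polynomial.eval_mul, Polynomial.eval_C, ← hc,
    ← map_pow, ← map_mul, ← map_sum, ← map_add]
  have hzero : (⟨r, hrm⟩ : ModR v U ρ hρ) ^ n + ∑ i : Fin n, c i * ⟨r, hrm⟩ ^ (i : ℕ) = 0 := by
    apply Subtype.ext
    funext N
    have := hr N
    simpa using this
  rw [hzero, map_zero]

end ring
end LD

end

section
open scoped TensorProduct

namespace LD

theorem burnside {κ V : Type*} [Field κ] [IsAlgClosed κ] [AddCommGroup V] [Module κ V]
    [FiniteDimensional κ V] [Nontrivial V] (A : Subalgebra κ (Module.End κ V))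
    (h : ∀ W : Submodule κ V, (∀ a ∈ A, ∀ w ∈ W, a w ∈ W) → W = ⊥ ∨ W = ⊤) : A = ⊤ := by
  have hsimple : IsSimpleModule A V := by
    rw [isSimpleModule_iff]
    refine { exists_pair_ne := ⟨⊥, ⊤, bot_ne_top⟩, eq_bot_or_eq_top := ?_ }
    intro W
    rcases h (W.restrictScalars κ) (fun a ha w hw => W.smul_mem (⟨a, ha⟩ : A) hw) with h1 | h1
    · left
      apply Submodule.restrictScalars_injective κ
      rw [h1]; rfl
    · right
      apply Submodule.restrictScalars_injective κ
      rw [h1]; rfl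
  rw [eq_top_iff]
  intro f _
  have hS := (IsSimpleModule.algebraMap_end_bijective_of_isAlgClosed (A := A) (V := V) κ).2
  let F : Module.End (Module.End A V) V :=
    { toFun := f
      map_add' := map_add f
      map_smul' := by
        intro g x
        obtain ⟨c, rfl⟩ := hS g
        simp }
  classical
  let b := Module.finBasis κ V
  obtain ⟨r, hr⟩ := jacobson_density (R := A) F (Finset.univ.image b)
  have : f = r.1 := by
    apply b.ext
    intro i
    exact hr (b i) (by simp)
  rw [this]
  exact r.2

/-- A multiplicatively closed set of nilpotent operators has a common kernel vector. -/
theorem common_kernel {κ V : Type*} [Field κ] [IsAlgClosed κ] [AddCommGroup V] [Module κ V]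
    [FiniteDimensional κ V] [Nontrivial V] (S : Set (Module.End κ V))
    (hmul : ∀ x ∈ S, ∀ y ∈ S, x * y ∈ S) (hnil : ∀ x ∈ S, IsNilpotent x) :
    ∃ w : V, w ≠ 0 ∧ ∀ s ∈ S, s w = 0 := by
  classical
  -- minimal nonzero invariant subspace
  have hex : ∃ n : ℕ, ∃ W : Submodule κ V, W ≠ ⊥ ∧ (∀ s ∈ S, ∀ w ∈ W, s w ∈ W) ∧
      Module.finrank κ W = n := ⟨_, ⊤, top_ne_bot, fun _ _ _ _ => trivial, rfl⟩
  obtain ⟨W, hW0, hWinv, hWr⟩ := Nat.find_spec hex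
  have hmin : ∀ W' : Submodule κ V, W' ≤ W → (∀ s ∈ S, ∀ w ∈ W', s w ∈ W') → W' = ⊥ ∨ W' = W := by
    intro W' hle hinv
    by_contra hcon
    push Not at hcon
    have hlt : W' < W := lt_of_le_of_ne hle hcon.2
    have := Submodule.finrank_lt_finrank_of_lt hlt
    rw [hWr] at this
    exact Nat.find_min hex this ⟨W', hcon.1, hinv, rfl⟩
  by_contra hcon
  push Not at hcon
  have : Nontrivial W := Submodule.nontrivial_iff_ne_bot.mpr hW0
  let S' : Set (Module.End κ W) := {x | ∃ s ∈ S, ∀ w : W, (x w : V) = s w}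
  have hS'nil : ∀ x ∈ S', IsNilpotent x := by
    rintro x ⟨s, hs, hx⟩
    obtain ⟨n, hn⟩ := hnil s hs
    refine ⟨n, ?_⟩
    have : ∀ k : ℕ, ∀ w : W, ((x ^ k) w : V) = (s ^ k) w := by
      intro k
      induction k with
      | zero => intro w; simp
      | succ k ih => intro w; rw [pow_succ, pow_succ]; simp [ih, hx]
    ext w
    rw [this, hn]; simp
  have hS'mul : ∀ x ∈ S', ∀ y ∈ S', x * y ∈ S' := by
    rintro x ⟨s, hs, hx⟩ y ⟨u, hu, hy⟩
    exact ⟨s * u, hmul s hs u hu, fun w => by simp [hx, hy]⟩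
  have hS'ex : ∀ s ∈ S, ∃ x ∈ S', ∀ w : W, (x w : V) = s w := by
    intro s hs
    exact ⟨s.restrict (hWinv s hs), ⟨s, hs, fun w => rfl⟩, fun w => rfl⟩
  -- the span is a two-sided ideal in everything
  let A0 : Submodule κ (Module.End κ W) := Submodule.span κ S'
  have hirr : ∀ W' : Submodule κ W, (∀ s ∈ S', ∀ w ∈ W', s w ∈ W') → W' = ⊥ ∨ W' = ⊤ := by
    intro W' hinv
    rcases hmin (W'.map W.subtype) (Submodule.map_subtype_le _ _) (by
      rintro s hs w ⟨w', hw', rfl⟩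
      obtain ⟨x, hx, hxs⟩ := hS'ex s hs
      refine ⟨x w', hinv x hx w' hw', hxs w'⟩) with h1 | h1
    · left
      apply Submodule.map_injective_of_injective W.injective_subtype
      rw [h1]; simp
    · right
      apply Submodule.map_injective_of_injective W.injective_subtype
      rw [h1]; simp
  have hadj : Algebra.adjoin κ S' = ⊤ := by
    apply burnside
    intro W' hinv
    exact hirr W' fun s hs => hinv s (Algebra.subset_adjoin hs)
  have hleft : ∀ a : Module.End κ W, ∀ x ∈ S', a * x ∈ A0 := by
    intro a
    have ha : a ∈ Algebra.adjoin κ S' := by rw [hadj]; trivial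
    induction ha using Algebra.adjoin_induction with
    | mem s hs => intro x hx; exact Submodule.subset_span (hS'mul s hs x hx)
    | algebraMap r =>
      intro x hx
      rw [← Algebra.smul_def]
      exact Submodule.smul_mem _ _ (Submodule.subset_span hx)
    | add a b _ _ iha ihb =>
      intro x hx; rw [add_mul]; exact Submodule.add_mem _ (iha x hx) (ihb x hx)
    | mul a b _ _ iha ihb =>
      intro x hx
      rw [mul_assoc]
      have h1 := ihb x hx
      generalize b * x = z at h1 ⊢
      induction h1 using Submodule.span_induction with
      | mem y hy => exact iha y hy
      | zero => simp
      | add y z _ _ hy hz => rw [mul_add]; exact Submodule.add_mem _ hy hz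
      | smul r y _ hy => rw [mul_smul_comm]; exact Submodule.smul_mem _ _ hy
  have htr0 : ∀ x ∈ A0, LinearMap.trace κ W x = 0 := by
    intro x hx
    induction hx using Submodule.span_induction with
    | mem y hy =>
      exact IsNilpotent.eq_zero (LinearMap.isNilpotent_trace_of_isNilpotent (hS'nil y hy))
    | zero => simp
    | add y z _ _ hy hz => rw [map_add, hy, hz, add_zero]
    | smul r y _ hy => rw [map_smul, hy, smul_zero]
  -- an element acting nontrivially on W
  obtain ⟨w0, hw0⟩ := exists_ne (0 : W)
  obtain ⟨s, hs, hsw⟩ := hcon w0 (by simpa using hw0)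
  obtain ⟨x, hx, hxs⟩ := hS'ex s hs
  have hxw : x w0 ≠ 0 := by
    intro h
    apply hsw
    rw [← hxs, h]; rfl
  obtain ⟨f, hf⟩ := Module.Projective.exists_dual_eq_one κ hxw
  have h1 := htr0 _ (hleft (dualTensorHom κ W W (f ⊗ₜ w0)) x hx)
  have h2 : dualTensorHom κ W W (f ⊗ₜ w0) * x = dualTensorHom κ W W ((f ∘ₗ x) ⊗ₜ w0) := by
    ext w; simp
  rw [h2, LinearMap.trace_eq_contract_apply, contractLeft_apply] at h1
  simp [hf] at h1

theorem repr_mkFinCons {κ V : Type*} [Field κ] [AddCommGroup V] [Module κ V] {n : ℕ}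
    (N : Submodule κ V) (b' : Module.Basis (Fin n) κ N) (b : Module.Basis (Fin (n + 1)) κ V)
    (hb : ∀ i, b (Fin.succ i) = b' i) (x : N) :
    b.repr (x : V) 0 = 0 ∧ ∀ i, b.repr (x : V) (Fin.succ i) = b'.repr x i := by
  have h1 : (x : V) = ∑ i, b'.repr x i • b (Fin.succ i) := by
    have := congrArg (fun z : N => (z : V)) (b'.sum_repr x)
    simp only [Submodule.coe_sum, Submodule.coe_smul] at this
    rw [← this]
    simp [hb]
  have h2 : b.repr (x : V) = ∑ i, b'.repr x i • Finsupp.single (Fin.succ i) 1 := by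
    conv_lhs => rw [h1]
    simp
  constructor
  · rw [h2]; simp [Finsupp.finsetSum_apply]
  · intro i; rw [h2]; simp [Finsupp.finsetSum_apply, Finsupp.single_apply]

theorem strict_tri {κ : Type*} [Field κ] [IsAlgClosed κ] (n : ℕ) : ∀ {V : Type _} [AddCommGroup V]
    [Module κ V] [FiniteDimensional κ V] (S : Set (Module.End κ V))
    (_ : ∀ x ∈ S, ∀ y ∈ S, x * y ∈ S) (_ : ∀ x ∈ S, IsNilpotent x)
    (_ : Module.finrank κ V = n),
    ∃ b : Module.Basis (Fin n) κ V, ∀ s ∈ S, ∀ i j, i ≤ j → b.repr (s (b j)) i = 0 := by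
  induction n with
  | zero =>
    intro V _ _ _ S _ _ hV
    exact ⟨Module.finBasisOfFinrankEq κ V hV, fun s _ i => i.elim0⟩
  | succ n ih =>
    intro V _ _ _ S hmul hnil hV
    have hnt : Nontrivial V := Module.nontrivial_of_finrank_pos (R := κ) (by omega)
    have : Nontrivial (Module.Dual κ V) := Module.nontrivial_of_finrank_pos (R := κ)
      (by rw [Subspace.dual_finrank_eq]; omega)
    obtain ⟨f, hf0, hf⟩ := common_kernel (V := Module.Dual κ V)
      ((fun s : Module.End κ V => (s.dualMap : Module.End κ (Module.Dual κ V))) '' S) (by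
        rintro _ ⟨x, hx, rfl⟩ _ ⟨y, hy, rfl⟩
        exact ⟨y * x, hmul y hy x hx, rfl⟩) (by
        rintro _ ⟨x, hx, rfl⟩
        obtain ⟨k, hk⟩ := hnil x hx
        refine ⟨k, ?_⟩
        have : ∀ k : ℕ, (x.dualMap : Module.End κ (Module.Dual κ V)) ^ k = (x ^ k).dualMap := by
          intro k
          induction k with
          | zero => rfl
          | succ k ihk => rw [pow_succ, ihk, pow_succ']; rfl
        rw [this, hk]; ext g z; simp)
    have hfs : ∀ s ∈ S, ∀ x, f (s x) = 0 := by
      intro s hs x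
      have := hf _ ⟨s, hs, rfl⟩
      exact congrArg (fun g : Module.Dual κ V => g x) this
    obtain ⟨y, hy⟩ : ∃ y, f y ≠ 0 := by
      by_contra hcon
      push Not at hcon
      exact hf0 (LinearMap.ext hcon)
    let N := LinearMap.ker f
    have hN : Module.finrank κ N = n := by
      have h1 := f.finrank_range_add_finrank_ker
      have h2 : Module.finrank κ (LinearMap.range f) = 1 := by
        rw [LinearMap.range_eq_top.mpr (LinearMap.surjective hf0)]
        simp
      show Module.finrank κ (LinearMap.ker f) = n
      omega
    have hmap : ∀ s ∈ S, ∀ x, s x ∈ N := fun s hs x => hfs s hs x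
    let S' : Set (Module.End κ N) := {x | ∃ s ∈ S, ∀ w : N, (x w : V) = s w}
    obtain ⟨b', hb'⟩ := ih S' (by
        rintro x ⟨s, hs, hx⟩ y ⟨u, hu, hy⟩
        exact ⟨s * u, hmul s hs u hu, fun w => by simp [hx, hy]⟩) (by
        rintro x ⟨s, hs, hx⟩
        obtain ⟨n, hn⟩ := hnil s hs
        refine ⟨n, ?_⟩
        have : ∀ k : ℕ, ∀ w : N, ((x ^ k) w : V) = (s ^ k) w := by
          intro k
          induction k with
          | zero => intro w; simp
          | succ k ih => intro w; rw [pow_succ, pow_succ]; simp [ih, hx]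
        ext w
        rw [this, hn]; simp) hN
    let b : Module.Basis (Fin (n + 1)) κ V := Module.Basis.mkFinCons y b' (by
        intro c x hx h
        have : f (c • y + x) = 0 := by rw [h, map_zero]
        rw [map_add, map_smul, (show f x = 0 from hx), add_zero, smul_eq_mul] at this
        exact (mul_eq_zero.mp this).resolve_right hy) (by
        intro z
        refine ⟨-(f z / f y), ?_⟩
        show f _ = 0
        rw [map_add, map_smul, smul_eq_mul]
        field_simp
        ring)
    have hbs : ∀ i, b (Fin.succ i) = b' i := by
      intro i
      simp [b]
    refine ⟨b, fun s hs i j hij => ?_⟩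
    have hr := repr_mkFinCons N b' b hbs ⟨s (b j), hmap s hs _⟩
    induction i using Fin.cases with
    | zero => exact hr.1
    | succ i =>
      rw [hr.2]
      induction j using Fin.cases with
      | zero => simp at hij
      | succ j =>
        have := hb' (s.restrict (fun x _ => hmap s hs x)) ⟨s, hs, fun _ => rfl⟩ i j (by simpa using hij)
        rw [← this]
        congr 2
        apply Subtype.ext
        simp [hbs]

end LD

end

section
namespace LD

theorem strict_tri_mat {κ : Type*} [Field κ] [IsAlgClosed κ] {m : ℕ}
    (S : Set (Matrix (Fin m) (Fin m) κ))
    (hmul : ∀ x ∈ S, ∀ y ∈ S, x * y ∈ S) (hnil : ∀ x ∈ S, IsNilpotent x) :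
    ∃ P Q : Matrix (Fin m) (Fin m) κ, P * Q = 1 ∧ ∀ s ∈ S, ∀ i j, i ≤ j → (P * s * Q) i j = 0 := by
  obtain ⟨b, hb⟩ := strict_tri (κ := κ) m (V := Fin m → κ) (Matrix.toLinAlgEquiv' '' S) (by
    rintro _ ⟨x, hx, rfl⟩ _ ⟨y, hy, rfl⟩
    exact ⟨x * y, hmul x hx y hy, map_mul _ _ _⟩) (by
    rintro _ ⟨x, hx, rfl⟩
    exact (hnil x hx).map _) (by simp)
  refine ⟨b.toMatrix (Pi.basisFun κ (Fin m)), (Pi.basisFun κ (Fin m)).toMatrix b,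
    Module.Basis.toMatrix_mul_toMatrix_flip _ _, fun s hs i j hij => ?_⟩
  have h1 := basis_toMatrix_mul_linearMap_toMatrix_mul_basis_toMatrix b (Pi.basisFun κ (Fin m))
    b (Pi.basisFun κ (Fin m)) (Matrix.toLinAlgEquiv' s)
  have h2 : LinearMap.toMatrix (Pi.basisFun κ (Fin m)) (Pi.basisFun κ (Fin m))
      (Matrix.toLinAlgEquiv' s) = s := by
    rw [LinearMap.toMatrix_eq_toMatrix']
    exact LinearMap.toMatrix'_toLin' s
  rw [h2] at h1
  rw [h1, LinearMap.toMatrix_apply]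
  exact hb _ ⟨s, hs, rfl⟩ i j hij

theorem prod_lower {F : Type*} [Field F] (w : AbsoluteValue F ℝ) (s : Multiset F) (r : ℝ)
    (hr : 0 ≤ r) (h : ∀ x ∈ s, r ≤ w x) : r ^ s.card ≤ w s.prod := by
  induction s using Multiset.induction_on with
  | empty => simp
  | cons a s ih =>
    rw [Multiset.card_cons, Multiset.prod_cons, map_mul, pow_succ']
    exact mul_le_mul (h a (by simp)) (ih fun x hx => h x (by simp [hx])) (by positivity)
      (w.nonneg _)

theorem prod_upper {F : Type*} [Field F] (w : AbsoluteValue F ℝ) (s : Multiset F) (r : ℝ)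
    (h : ∀ x ∈ s, w x ≤ r) : w s.prod ≤ r ^ s.card := by
  induction s using Multiset.induction_on with
  | empty => simp
  | cons a s ih =>
    rw [Multiset.card_cons, Multiset.prod_cons, map_mul, pow_succ']
    exact mul_le_mul (h a (by simp)) (ih fun x hx => h x (by simp [hx])) (w.nonneg _)
      ((w.nonneg _).trans (h a (by simp)))

theorem charpoly_eq_prod {F : Type*} [Field F] [IsAlgClosed F] {m : ℕ}
    (A : Matrix (Fin m) (Fin m) F) :
    A.charpoly = (A.charpoly.roots.map (fun a => Polynomial.X - Polynomial.C a)).prod ∧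
      A.charpoly.roots.card = m := by
  have h1 := IsAlgClosed.splits A.charpoly
  constructor
  · exact h1.eq_prod_roots_of_monic A.charpoly_monic
  · rw [← h1.natDegree_eq_card_roots, Matrix.charpoly_natDegree_eq_dim, Fintype.card_fin]

section seq
variable {L : ℕ → Type} [∀ N, Field (L N)] {v : ∀ N, AbsoluteValue (L N) ℝ} {U : Ultrafilter ℕ}
  {ρ : ℕ → ℝ} {hρ : ∀ N, 2 ≤ ρ N} {m : ℕ}

/-- Evaluation of a moderate sequence. -/
def ev (v : ∀ N, AbsoluteValue (L N) ℝ) (U : Ultrafilter ℕ) (ρ : ℕ → ℝ) (hρ : ∀ N, 2 ≤ ρ N) (N : ℕ) :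
    ModR v U ρ hρ →+* L N := (Pi.evalRingHom _ N).comp (ModR v U ρ hρ).subtype

theorem ev_apply (N : ℕ) (z : ModR v U ρ hρ) : ev v U ρ hρ N z = z.1 N := rfl

theorem mat_bd (z : Matrix (Fin m) (Fin m) (ModR v U ρ hρ)) :
    ∃ J : ℕ, ∀ᶠ N in U, Bd (v N) (ρ N ^ J) (z.map (ev v U ρ hρ N)) := by
  have h := fun i j => (z i j).2
  choose J hJ using h
  refine ⟨∑ i, ∑ j, J i j, ?_⟩
  have : ∀ᶠ N in U, ∀ i j, v N ((z i j).1 N) ≤ ρ N ^ J i j := by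
    rw [Filter.eventually_all]
    intro i
    rw [Filter.eventually_all]
    exact fun j => hJ i j
  filter_upwards [this] with N hN i j
  refine (hN i j).trans (pow_le_pow_right₀ (by linarith [hρ N]) ?_)
  exact (Finset.single_le_sum (f := fun j => J i j) (fun _ _ => Nat.zero_le _)
    (Finset.mem_univ j)).trans (Finset.single_le_sum (f := fun i => ∑ j, J i j)
    (fun _ _ => Nat.zero_le _) (Finset.mem_univ i))

theorem of_ev_bd (g : ∀ N, Matrix (Fin m) (Fin m) (L N)) (J : ℕ)
    (h : ∀ᶠ N in U, Bd (v N) (ρ N ^ J) (g N)) :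
    ∃ z : Matrix (Fin m) (Fin m) (ModR v U ρ hρ), ∀ N, z.map (ev v U ρ hρ N) = g N := by
  refine ⟨fun i j => ⟨fun N => g N i j, J, ?_⟩, fun N => ?_⟩
  · filter_upwards [h] with N hN using hN i j
  · ext i j; rfl

variable {Ω : Type} [Field Ω] {π : ModR v U ρ hρ →+* Ω}

theorem res_congr (hπ : ∀ z, π z = 0 ↔ ∀ j : ℕ, ∀ᶠ N in U, v N (z.1 N) * ρ N ^ j ≤ 1)
    {z z' : ModR v U ρ hρ} (h : ∀ᶠ N in U, ev v U ρ hρ N z = ev v U ρ hρ N z') : π z = π z' := by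
  rw [← sub_eq_zero, ← map_sub, hπ]
  intro j
  filter_upwards [h] with N hN
  have : (z - z').1 N = 0 := by
    have : (z - z').1 N = z.1 N - z'.1 N := rfl
    rw [this]; exact sub_eq_zero.mpr hN
  rw [this]; norm_num

theorem res_ne (hπ : ∀ z, π z = 0 ↔ ∀ j : ℕ, ∀ᶠ N in U, v N (z.1 N) * ρ N ^ j ≤ 1)
    {z : ModR v U ρ hρ} (h : π z ≠ 0) : ∃ j : ℕ, ∀ᶠ N in U, 1 < v N (z.1 N) * ρ N ^ j := by
  by_contra hcon
  push Not at hcon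
  exact h ((hπ z).mpr hcon)

theorem res_inv (hπ : ∀ z, π z = 0 ↔ ∀ j : ℕ, ∀ᶠ N in U, v N (z.1 N) * ρ N ^ j ≤ 1)
    {z : ModR v U ρ hρ} (h : π z ≠ 0) :
    ∃ y : ModR v U ρ hρ, ∀ᶠ N in U, ev v U ρ hρ N y * ev v U ρ hρ N z = 1 := by
  obtain ⟨j, hj⟩ := res_ne hπ h
  refine ⟨⟨fun N => (z.1 N)⁻¹, j, ?_⟩, ?_⟩
  · filter_upwards [hj] with N hN
    have h0 : 0 < v N (z.1 N) := by
      rcases (v N).nonneg (z.1 N) |>.eq_or_lt with h | h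
      · rw [← h] at hN; norm_num at hN
      · exact h
    rw [map_inv₀, inv_le_iff_one_le_mul₀ h0]
    linarith [mul_comm (v N (z.1 N)) (ρ N ^ j)]
  · filter_upwards [hj] with N hN
    have h0 : z.1 N ≠ 0 := by
      intro h; rw [h] at hN; norm_num at hN
    exact inv_mul_cancel₀ h0

/-- Lifting an invertible matrix. -/
theorem lift_inv (hπs : Function.Surjective π)
    (hπ : ∀ z, π z = 0 ↔ ∀ j : ℕ, ∀ᶠ N in U, v N (z.1 N) * ρ N ^ j ≤ 1)
    (P Q : Matrix (Fin m) (Fin m) Ω) (hPQ : P * Q = 1) :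
    ∃ h k : Matrix (Fin m) (Fin m) (ModR v U ρ hρ), h.map π = P ∧ k.map π = Q ∧
      ∀ᶠ N in U, h.map (ev v U ρ hρ N) * k.map (ev v U ρ hρ N) = 1 := by
  choose f hf using hπs
  let h : Matrix (Fin m) (Fin m) (ModR v U ρ hρ) := P.map f
  have hhP : h.map π = P := by ext i j; simp [h, hf]
  have hdet : π h.det ≠ 0 := by
    have : π h.det = P.det := by rw [← hhP]; exact RingHom.map_det π h
    rw [this]
    intro h0
    have := congrArg Matrix.det hPQ
    rw [Matrix.det_mul, h0] at this
    simp at this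
  obtain ⟨y, hy⟩ := res_inv hπ hdet
  have hk : ∀ᶠ N in U, h.map (ev v U ρ hρ N) * (y • h.adjugate).map (ev v U ρ hρ N) = 1 := by
    filter_upwards [hy] with N hN
    rw [← Matrix.map_mul, Matrix.mul_smul, Matrix.mul_adjugate]
    ext i j
    simp only [Matrix.map_apply, Matrix.smul_apply, smul_eq_mul, map_mul, Matrix.one_apply]
    split_ifs <;> simp [hN]
  refine ⟨h, y • h.adjugate, hhP, ?_, hk⟩
  have h1 : h.map π * (y • h.adjugate).map π = 1 := by
    rw [← Matrix.map_mul, Matrix.mul_smul, Matrix.mul_adjugate]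
    have h2 : π (y * h.det) = π 1 := res_congr hπ (by
      filter_upwards [hy] with N hN; rw [map_mul, hN, map_one])
    rw [map_mul, map_one] at h2
    ext i j
    simp only [Matrix.map_apply, Matrix.smul_apply, smul_eq_mul, map_mul, Matrix.one_apply]
    split_ifs <;> simp [h2]
  rw [hhP] at h1
  have h3 : Q * P = 1 := mul_eq_one_comm.mp hPQ
  calc (y • h.adjugate).map π = Q * P * (y • h.adjugate).map π := by rw [h3, one_mul]
    _ = Q := by rw [mul_assoc, h1, mul_one]
end seq

theorem nilpotent_of_roots {F : Type*} [Field F] [IsAlgClosed F] {m : ℕ}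
    (A : Matrix (Fin m) (Fin m) F) (h : ∀ μ, A.charpoly.eval μ = 0 → μ = 0) : IsNilpotent A := by
  refine ⟨m, ?_⟩
  obtain ⟨h1, h2⟩ := charpoly_eq_prod A
  have h3 : A.charpoly.roots = Multiset.replicate m 0 := by
    rw [Multiset.eq_replicate]
    refine ⟨h2, fun b hb => h b ?_⟩
    exact (Polynomial.mem_roots'.mp hb).2
  rw [h3] at h1
  simp only [Multiset.map_replicate, Polynomial.C_0, sub_zero, Multiset.prod_replicate] at h1
  have := A.aeval_self_charpoly
  rw [h1] at this
  simpa using this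

theorem exists_tau {F : Type*} [Field F] [IsAlgClosed F] (w : AbsoluteValue F ℝ) (t : F) (B : ℝ)
    (hB : 1 < B) (ht : B ≤ w t) : ∃ τ : F, B ≤ w τ ∧ w τ ≤ B ^ 2 := by
  obtain ⟨n, hn⟩ := exists_nat_pow_near (by linarith : 1 ≤ w t) hB
  have hn0 : n ≠ 0 := by
    rintro rfl
    have := hn.2
    simp at this; linarith
  obtain ⟨τ, hτ⟩ := IsAlgClosed.exists_pow_nat_eq t (Nat.pos_of_ne_zero hn0)
  rw [← hτ, map_pow] at hn
  refine ⟨τ, ?_, ?_⟩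
  · exact le_of_pow_le_pow_left₀ hn0 (w.nonneg _) hn.1
  · apply le_of_pow_le_pow_left₀ hn0 (by positivity)
    refine hn.2.le.trans ?_
    rw [← pow_mul]
    exact pow_le_pow_right₀ hB.le (by omega)

end LD

end

section
namespace LD

theorem charpoly_smul_root {F : Type*} [Field F] {m : ℕ} (A : Matrix (Fin m) (Fin m) F) (c : F)
    (hc : c ≠ 0) (μ : F) (h : (c • A).charpoly.eval μ = 0) : A.charpoly.eval (c⁻¹ * μ) = 0 := by
  rw [Matrix.eval_charpoly] at h ⊢
  have : Matrix.scalar (Fin m) μ - c • A = c • (Matrix.scalar (Fin m) (c⁻¹ * μ) - A) := by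
    rw [smul_sub]
    congr 1
    ext i j
    by_cases hij : i = j
    · subst hij; simp [hc]
    · simp [hij]
  rw [this, Matrix.det_smul] at h
  rcases mul_eq_zero.mp h with h | h
  · exact absurd (by_contra fun hne => pow_ne_zero _ hne h) hc
  · exact h

theorem eval_map_charpoly {R F : Type*} [CommRing R] [Field F] {m : ℕ} (f : R →+* F)
    (z : Matrix (Fin m) (Fin m) R) (μ : R) :
    (z.map f).charpoly.eval (f μ) = f (z.charpoly.eval μ) := by
  have : (z.map f).charpoly = z.charpoly.map f := Matrix.charpoly_map z f
  rw [this, Polynomial.eval_map, Polynomial.eval₂_hom]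

theorem bochi_seq {m : ℕ} (L : ℕ → Type) [∀ N, Field (L N)] [∀ N, IsAlgClosed (L N)]
    (v : ∀ N, AbsoluteValue (L N) ℝ) (S : ∀ N, Set (Matrix (Fin m) (Fin m) (L N)))
    (t : ∀ N, L N) (ht : ∀ N, (2 : ℝ) ^ N ≤ v N (t N)) (hS : ∀ N, ∀ s ∈ S N, Bd (v N) (v N (t N)) s)
    (hh : ∀ N, ∀ h k : Matrix (Fin m) (Fin m) (L N), h * k = 1 →
      ∃ s ∈ S N, ¬ Bd (v N) (v N (t N) / 2) (h * s * k))
    (hno : ∀ N q, 1 ≤ q → q ≤ N → ∀ g ∈ S N ^ q, ∀ μ : L N, g.charpoly.eval μ = 0 →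
      v N μ < (1 / 2) ^ N * v N (t N) ^ q) : False := by
  classical
  let U : Ultrafilter ℕ := Filter.hyperfilter ℕ
  have hU : ∀ n : ℕ, ∀ᶠ N in U, n ≤ N := fun n =>
    (Nat.hyperfilter_le_atTop (Filter.eventually_ge_atTop n))
  let ρ : ℕ → ℝ := fun _ => 2
  have hρ : ∀ N, 2 ≤ ρ N := fun _ => le_rfl
  obtain ⟨Ω, _, π, hπs, hπ, hac⟩ := exists_residue v U ρ hρ
  have : IsAlgClosed Ω := hac inferInstance
  have ht0 : ∀ N, t N ≠ 0 := by
    intro N h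
    have := ht N
    rw [h, map_zero] at this
    have h2 : (0 : ℝ) < 2 ^ N := by positivity
    linarith
  have htp : ∀ N, 0 < v N (t N) := fun N => (v N).pos (ht0 N)
  let 𝓢 : Set (Matrix (Fin m) (Fin m) Ω) := {x | ∃ q, 1 ≤ q ∧
    ∃ z : Matrix (Fin m) (Fin m) (ModR v U ρ hρ), x = z.map π ∧
      ∀ N, ∃ g ∈ S N ^ q, z.map (ev v U ρ hρ N) = ((t N) ^ q)⁻¹ • g}
  have hmul : ∀ x ∈ 𝓢, ∀ y ∈ 𝓢, x * y ∈ 𝓢 := by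
    rintro x ⟨q, hq, z, rfl, hz⟩ y ⟨q', hq', z', rfl, hz'⟩
    refine ⟨q + q', by omega, z * z', by rw [Matrix.map_mul], fun N => ?_⟩
    obtain ⟨g, hg, h1⟩ := hz N
    obtain ⟨g', hg', h1'⟩ := hz' N
    refine ⟨g * g', by rw [pow_add]; exact Set.mul_mem_mul hg hg', ?_⟩
    rw [Matrix.map_mul, h1, h1', Matrix.smul_mul, Matrix.mul_smul, smul_smul, pow_add, mul_inv]
  have hnil : ∀ x ∈ 𝓢, IsNilpotent x := by
    rintro x ⟨q, hq, z, rfl, hz⟩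
    apply nilpotent_of_roots
    intro μ hμ
    obtain ⟨μ, rfl⟩ := hπs μ
    by_contra hμ0
    obtain ⟨j, hj⟩ := res_ne hπ hμ0
    rw [eval_map_charpoly, hπ] at hμ
    obtain ⟨N, h1, h2, h3⟩ := (hj.and ((hμ ((j + 1) * m + 1)).and (hU (j + 1 + q)))).exists
    have h4 : (z.charpoly.eval μ).1 N = (z.map (ev v U ρ hρ N)).charpoly.eval (μ.1 N) := by
      exact (eval_map_charpoly (ev v U ρ hρ N) z μ).symm
    obtain ⟨g, hg, hgz⟩ := hz N
    obtain ⟨h5, h6⟩ := charpoly_eq_prod (z.map (ev v U ρ hρ N))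
    rw [h4, h5, Polynomial.eval_multiset_prod, Multiset.map_map] at h2
    have h7 := prod_lower (v N) ((z.map (ev v U ρ hρ N)).charpoly.roots.map
      ((Polynomial.eval (μ.1 N)) ∘ fun a => Polynomial.X - Polynomial.C a)) ((1 / 2) ^ (j + 1))
      (by positivity) (by
        intro x hx
        obtain ⟨a, ha, rfl⟩ := Multiset.mem_map.mp hx
        simp only [Function.comp, Polynomial.eval_sub, Polynomial.eval_X, Polynomial.eval_C]
        have ha' : (z.map (ev v U ρ hρ N)).charpoly.eval a = 0 := (Polynomial.mem_roots'.mp ha).2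
        rw [hgz] at ha'
        have h8 := charpoly_smul_root _ _ (inv_ne_zero (pow_ne_zero _ (ht0 N))) _ ha'
        have h9 := hno N q hq (by omega) g hg _ h8
        rw [inv_inv, map_mul, map_pow, mul_comm] at h9
        have h10 : v N a < (1 / 2) ^ N := lt_of_mul_lt_mul_right h9 (by positivity)
        have h11 : ((1 : ℝ) / 2) ^ N ≤ (1 / 2) ^ (j + 1) :=
          pow_le_pow_of_le_one (by norm_num) (by norm_num) (by omega)
        have h12 : ((1 : ℝ) / 2) ^ j ≤ v N (μ.1 N) := by
          rw [div_pow, one_pow, div_le_iff₀ (by positivity)]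
          exact h1.le
        have h13 := (v N).le_sub (μ.1 N) a
        have h14 : ((1 : ℝ) / 2) ^ j = 2 * (1 / 2) ^ (j + 1) := by rw [pow_succ]; ring
        linarith)
    rw [Multiset.card_map, h6, ← pow_mul] at h7
    have h8 : ((1 : ℝ) / 2) ^ ((j + 1) * m) * 2 ^ ((j + 1) * m + 1) = 2 := by
      rw [pow_succ, ← mul_assoc, ← mul_pow]; norm_num
    have h9 := mul_le_mul_of_nonneg_right h7 (by positivity : (0 : ℝ) ≤ 2 ^ ((j + 1) * m + 1))
    rw [h8] at h9
    linarith
  obtain ⟨P, Q, hPQ, htri⟩ := strict_tri_mat 𝓢 hmul hnil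
  obtain ⟨h, k, hh1, hk1, hhk⟩ := lift_inv hπs hπ P Q hPQ
  obtain ⟨J1, hJ1⟩ := mat_bd h
  obtain ⟨J2, hJ2⟩ := mat_bd k
  let X : ℝ := m * ((m * (2 ^ J1 * 1)) * 2 ^ J2)
  have hX : 0 ≤ X := by positivity
  let B : ℝ := 4 * X + 2
  obtain ⟨n0, hn0⟩ := pow_unbounded_of_one_lt B (one_lt_two)
  let good : ℕ → Prop := fun N => n0 ≤ N ∧ h.map (ev v U ρ hρ N) * k.map (ev v U ρ hρ N) = 1
  have hτ : ∀ N, n0 ≤ N → ∃ τ : L N, B ≤ v N τ ∧ v N τ ≤ B ^ 2 := by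
    intro N hN
    apply exists_tau (v N) (t N) B (by simp only [B]; linarith)
    exact hn0.le.trans ((pow_le_pow_right₀ (by norm_num) hN).trans (ht N))
  have hchoice : ∀ N, ∃ s ∈ S N, n0 ≤ N → h.map (ev v U ρ hρ N) * k.map (ev v U ρ hρ N) = 1 →
      ∃ τ : L N, B ≤ v N τ ∧ v N τ ≤ B ^ 2 ∧ ¬ Bd (v N) (v N (t N) / 2)
        ((Matrix.diagonal (fun i : Fin m => (τ⁻¹) ^ (i : ℕ)) * h.map (ev v U ρ hρ N)) * s *
          (k.map (ev v U ρ hρ N) * Matrix.diagonal (fun i : Fin m => τ ^ (i : ℕ)))) := by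
    intro N
    by_cases hg : good N
    · obtain ⟨τ, h1, h2⟩ := hτ N hg.1
      have hτ0 : τ ≠ 0 := by
        rintro rfl; rw [map_zero] at h1; simp only [B] at h1; linarith
      obtain ⟨s, hs, hsb⟩ := hh N (Matrix.diagonal (fun i : Fin m => (τ⁻¹) ^ (i : ℕ)) * h.map (ev v U ρ hρ N))
        (k.map (ev v U ρ hρ N) * Matrix.diagonal (fun i : Fin m => τ ^ (i : ℕ))) (by
          rw [mul_assoc, ← mul_assoc (h.map _), hg.2, one_mul, Matrix.diagonal_mul_diagonal]
          rw [← Matrix.diagonal_one]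
          congr 1
          funext i
          rw [← mul_pow, inv_mul_cancel₀ hτ0, one_pow])
      exact ⟨s, hs, fun _ _ => ⟨τ, h1, h2, hsb⟩⟩
    · obtain ⟨s, hs, -⟩ := hh N 1 1 (one_mul 1)
      exact ⟨s, hs, fun a b => absurd ⟨a, b⟩ hg⟩
  choose s hs hsb using hchoice
  obtain ⟨z, hz⟩ := of_ev_bd (U := U) (hρ := hρ) (v := v) (fun N => (t N)⁻¹ • s N) 0
    (Filter.Eventually.of_forall fun N => by
      have := (hS N _ (hs N)).smul (t N)⁻¹
      rw [map_inv₀, inv_mul_cancel₀ (htp N).ne'] at this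
      simpa using this)
  have hz𝓢 : z.map π ∈ 𝓢 := ⟨1, le_rfl, z, rfl, fun N => ⟨s N, by simpa using hs N, by
    rw [hz, pow_one]⟩⟩
  have hw0 : ∀ i j, i ≤ j → π ((h * z * k) i j) = 0 := by
    intro i j hij
    have := htri _ hz𝓢 i j hij
    rw [← hh1, ← hk1, ← Matrix.map_mul, ← Matrix.map_mul] at this
    exact this
  obtain ⟨K, hK⟩ := pow_unbounded_of_one_lt (2 * (B ^ 2) ^ m) (one_lt_two)
  have hsmall : ∀ᶠ N in U, ∀ i j, i ≤ j → v N (((h * z * k) i j).1 N) * 2 ^ K ≤ 1 := by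
    rw [Filter.eventually_all]
    intro i
    rw [Filter.eventually_all]
    intro j
    by_cases hij : i ≤ j
    · filter_upwards [(hπ _).mp (hw0 i j hij) K] with N hN _ using hN
    · exact Filter.Eventually.of_forall fun N h' => absurd h' hij
  obtain ⟨N, hN1, hN2, hN3, hN4, hN5⟩ :=
    (hsmall.and ((hU n0).and (hhk.and (hJ1.and hJ2)))).exists
  obtain ⟨τ, hτ1, hτ2, hτ3⟩ := hsb N hN2 hN3
  apply hτ3
  intro i j
  have hB2 : 2 ≤ B := by simp only [B]; linarith
  have hτ0 : 0 < v N τ := by linarith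
  have e1 : h.map (ev v U ρ hρ N) * s N * k.map (ev v U ρ hρ N) =
      t N • (h * z * k).map (ev v U ρ hρ N) := by
    rw [Matrix.map_mul, Matrix.map_mul, hz, Matrix.mul_smul, Matrix.smul_mul, smul_smul,
      mul_inv_cancel₀ (ht0 N), one_smul]
  have e2 : (Matrix.diagonal (fun i : Fin m => (τ⁻¹) ^ (i : ℕ)) * h.map (ev v U ρ hρ N)) * s N *
          (k.map (ev v U ρ hρ N) * Matrix.diagonal (fun i : Fin m => τ ^ (i : ℕ))) =
      Matrix.diagonal (fun i : Fin m => (τ⁻¹) ^ (i : ℕ)) *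
        (t N • (h * z * k).map (ev v U ρ hρ N)) * Matrix.diagonal (fun i : Fin m => τ ^ (i : ℕ)) := by
    rw [← e1]; simp only [mul_assoc]
  rw [e2, Matrix.mul_diagonal, Matrix.diagonal_mul, Matrix.smul_apply, smul_eq_mul]
  have e3 : (h * z * k).map (ev v U ρ hρ N) i j = ((h * z * k) i j).1 N := rfl
  simp only [map_mul, map_pow, map_inv₀]
  have hXb : v N ((h * z * k).map (ev v U ρ hρ N) i j) ≤ X := by
    rw [Matrix.map_mul, Matrix.map_mul]
    have hzb : Bd (v N) 1 (z.map (ev v U ρ hρ N)) := by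
      rw [hz]
      have := (hS N _ (hs N)).smul (t N)⁻¹
      rwa [map_inv₀, inv_mul_cancel₀ (htp N).ne'] at this
    exact ((hN4.mul hzb (by positivity)).mul hN5 (by positivity)) i j
  set W := v N ((h * z * k).map (ev v U ρ hρ N) i j) with hW
  have hW0 : 0 ≤ W := (v N).nonneg _
  set τv := v N τ
  suffices hmain : (τv⁻¹) ^ (i : ℕ) * W * τv ^ (j : ℕ) ≤ 1 / 2 by
    have := mul_le_mul_of_nonneg_right hmain (htp N).le
    calc (τv⁻¹) ^ (i : ℕ) * (v N (t N) * W) * τv ^ (j : ℕ)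
        = (τv⁻¹) ^ (i : ℕ) * W * τv ^ (j : ℕ) * v N (t N) := by ring
      _ ≤ _ := by linarith
  by_cases hij : i ≤ j
  · have h1 := hN1 i j hij
    rw [← e3, ← hW] at h1
    have h2 : (τv⁻¹) ^ (i : ℕ) ≤ 1 := pow_le_one₀ (by positivity) (inv_le_one_of_one_le₀ (by linarith))
    have h3 : τv ^ (j : ℕ) ≤ (B ^ 2) ^ m :=
      (pow_le_pow_left₀ hτ0.le hτ2 _).trans (pow_le_pow_right₀ (by nlinarith) j.2.le)
    calc (τv⁻¹) ^ (i : ℕ) * W * τv ^ (j : ℕ) ≤ 1 * W * (B ^ 2) ^ m := by gcongr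
      _ ≤ 1 / 2 := by nlinarith
  · have hij' : (j : ℕ) < i := by simpa using hij
    have h1 : (τv⁻¹) ^ (i : ℕ) * τv ^ (j : ℕ) ≤ τv⁻¹ := by
      obtain ⟨r, hr⟩ : ∃ r, (i : ℕ) = r + 1 + j := ⟨i - j - 1, by omega⟩
      rw [hr, pow_add, mul_assoc, ← mul_pow, inv_mul_cancel₀ hτ0.ne', one_pow, mul_one, pow_succ]
      have : (τv⁻¹) ^ r ≤ 1 := pow_le_one₀ (by positivity) (inv_le_one_of_one_le₀ (by linarith))
      have h0 : 0 ≤ τv⁻¹ := by positivity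
      nlinarith
    have h2 : τv⁻¹ ≤ B⁻¹ := inv_anti₀ (by linarith) hτ1
    calc (τv⁻¹) ^ (i : ℕ) * W * τv ^ (j : ℕ) = (τv⁻¹) ^ (i : ℕ) * τv ^ (j : ℕ) * W := by ring
      _ ≤ B⁻¹ * X := by
        apply mul_le_mul (h1.trans h2) hXb hW0 (by positivity)
      _ ≤ 1 / 2 := by
        rw [inv_mul_le_iff₀ (by linarith)]
        simp only [B]; linarith

/-- A weak Bochi-type inequality. -/
theorem bochi (m : ℕ) : ∃ (Q : ℕ) (c T0 : ℝ), 0 < c ∧ ∀ (L : Type) [Field L] [IsAlgClosed L]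
    (v : AbsoluteValue L ℝ) (S : Set (Matrix (Fin m) (Fin m) L)) (t : L), T0 ≤ v t →
    (∀ s ∈ S, Bd v (v t) s) →
    (∀ h k : Matrix (Fin m) (Fin m) L, h * k = 1 → ∃ s ∈ S, ¬ Bd v (v t / 2) (h * s * k)) →
    ∃ q, 1 ≤ q ∧ q ≤ Q ∧ ∃ g ∈ S ^ q, ∃ μ : L, g.charpoly.eval μ = 0 ∧ c * v t ^ q ≤ v μ := by
  by_contra hcon
  push Not at hcon
  have h1 := fun N : ℕ => hcon N ((1 / 2) ^ N) (2 ^ N) (by positivity)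
  choose L i1 i2 v S t ht hS hh hno using h1
  exact bochi_seq L v S t ht hS hh hno

end LD

end

section
open Matrix Pointwise Polynomial

namespace LD

/-- the polynomial with given roots -/
noncomputable def rp {F : Type*} [Field F] (u : Multiset F) : F[X] := (u.map (fun a => X - C a)).prod

section
variable {F : Type*} [Field F]

theorem rp_cons (b : F) (u : Multiset F) : rp (b ::ₘ u) = (X - C b) * rp u := by
  simp [rp]

theorem rp_zero : rp (0 : Multiset F) = 1 := by simp [rp]

theorem rp_add (u w : Multiset F) : rp (u + w) = rp u * rp w := by simp [rp]

theorem eval_rp (u : Multiset F) (x : F) : (rp u).eval x = (u.map (fun a => x - a)).prod := by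
  rw [rp, eval_multiset_prod, Multiset.map_map]
  congr 1
  apply Multiset.map_congr rfl
  intro a _
  simp

variable {m : ℕ}

theorem aeval_X_sub (A : Matrix (Fin m) (Fin m) F) (b : F) :
    aeval A (X - C b) = A - b • (1 : Matrix (Fin m) (Fin m) F) := by
  simp [Algebra.algebraMap_eq_smul_one]

theorem det_sub_smul [IsAlgClosed F] (A : Matrix (Fin m) (Fin m) F) (b : F) :
    (A - b • (1 : Matrix (Fin m) (Fin m) F)).det = (A.charpoly.roots.map (fun l => l - b)).prod := by
  have h1 : (A - b • (1 : Matrix (Fin m) (Fin m) F)) = -(Matrix.scalar (Fin m) b - A) := by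
    rw [neg_sub]; congr 1; ext i j
    by_cases h : i = j
    · subst h; simp
    · simp [h]
  obtain ⟨h2, h3⟩ := charpoly_eq_prod A
  have h4 : A.charpoly.eval b = (A.charpoly.roots.map (fun a => b - a)).prod := by
    conv_lhs => rw [h2]
    exact eval_rp _ _
  rw [h1, Matrix.det_neg, ← Matrix.eval_charpoly, h4, Fintype.card_fin]
  have h5 : (A.charpoly.roots.map (fun l => l - b)) =
      A.charpoly.roots.map (fun l => (-1) * (b - l)) := by
    apply Multiset.map_congr rfl; intro a _; ring
  rw [h5, Multiset.prod_map_mul]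
  simp [h3]

theorem det_aeval_rp [IsAlgClosed F] (A : Matrix (Fin m) (Fin m) F) (u : Multiset F) :
    (aeval A (rp u)).det = (A.charpoly.roots.map (fun l => (rp u).eval l)).prod := by
  induction u using Multiset.induction_on with
  | empty => simp [rp_zero]
  | cons b u ih =>
    rw [rp_cons, map_mul, Matrix.det_mul, ih, aeval_X_sub, det_sub_smul, ← Multiset.prod_map_mul]
    congr 1
    apply Multiset.map_congr rfl
    intro a _
    simp

theorem det_aeval_eq [IsAlgClosed F] (A : Matrix (Fin m) (Fin m) F) (P : F[X]) :
    (aeval A P).det = (A.charpoly.roots.map (fun l => P.eval l)).prod := by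
  have h1 : P = C P.leadingCoeff * rp P.roots := (IsAlgClosed.splits P).eq_prod_roots
  generalize P.leadingCoeff = c at h1
  generalize P.roots = u at h1
  subst h1
  have : aeval A (C c * rp u) = c • aeval A (rp u) := by
    rw [map_mul, aeval_C, Algebra.smul_def]
  rw [this, Matrix.det_smul, det_aeval_rp]
  simp only [eval_mul, eval_C, Multiset.prod_map_mul]
  simp [(charpoly_eq_prod A).2]

variable {v : AbsoluteValue F ℝ}

theorem Bd.aeval_rp {A : Matrix (Fin m) (Fin m) F} {S : ℝ} (hS : 1 ≤ S) (hA : Bd v S A)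
    (u : Multiset F) (hu : ∀ b ∈ u, v b ≤ S) :
    Bd v (((m + 1) * (2 * S)) ^ u.card) (aeval A (rp u)) := by
  induction u using Multiset.induction_on with
  | empty => simpa [rp_zero] using Bd.one
  | cons b u ih =>
    rw [rp_cons, map_mul, aeval_X_sub, Multiset.card_cons, pow_succ']
    have h1 : Bd v (2 * S) (A - b • (1 : Matrix (Fin m) (Fin m) F)) := by
      have := hA.sub ((Bd.one (v := v) (m := m)).smul b)
      refine this.mono ?_
      have := hu b (by simp)
      linarith
    have h2 := h1.mul (ih fun c hc => hu c (by simp [hc])) (by linarith)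
    refine h2.mono ?_
    have : 0 ≤ 2 * S * ((m + 1) * (2 * S)) ^ u.card := by positivity
    nlinarith

theorem eig_bound {A : Matrix (Fin m) (Fin m) F} {S : ℝ} (hS : 0 ≤ S) (hA : Bd v S A) (μ : F)
    (h : A.charpoly.eval μ = 0) : v μ ≤ m * S := by
  rw [Matrix.eval_charpoly, ← Matrix.exists_mulVec_eq_zero_iff] at h
  obtain ⟨x, hx0, hx⟩ := h
  have hm : Nonempty (Fin m) := by
    by_contra hcon
    rw [not_nonempty_iff] at hcon
    exact hx0 (Subsingleton.elim _ _)
  obtain ⟨i, hi⟩ := Finite.exists_max (fun i => v (x i))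
  have hxi : 0 < v (x i) := by
    apply v.pos
    intro h0
    apply hx0
    funext j
    have := hi j
    rw [h0, map_zero] at this
    exact v.eq_zero.mp (le_antisymm this (v.nonneg _))
  have h1 := congrFun hx i
  rw [Matrix.sub_mulVec] at h1
  have h2 : μ * x i = ∑ j, A i j * x j := by
    have h3 : (Matrix.scalar (Fin m) μ *ᵥ x) i = μ * x i := by
      simp [Matrix.mulVec_diagonal]
    rw [Pi.sub_apply, h3, Pi.zero_apply, sub_eq_zero] at h1
    exact h1
  have h4 : v μ * v (x i) ≤ (m * S) * v (x i) := by
    rw [← map_mul, h2]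
    refine (v.sum_le _ _).trans ?_
    calc ∑ j, v (A i j * x j) ≤ ∑ j : Fin m, S * v (x i) := by
          apply Finset.sum_le_sum
          intro j _
          rw [map_mul]
          exact mul_le_mul (hA i j) (hi j) (v.nonneg _) hS
      _ = _ := by simp; ring
  exact le_of_mul_le_mul_right h4 hxi

/-- Growth bound for powers. -/
theorem contract {A : Matrix (Fin m) (Fin m) F} {S β K : ℝ} (hS : 1 ≤ S) (hA : Bd v S A)
    (hβ : 0 < β) (hβS : β ≤ S) (hK : (m + 1) * (2 * S) ≤ K) (hK' : (m + 1) * (2 * S) ≤ K * β)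
    (u : Multiset F) (hu : ∀ b ∈ u, v b ≤ β) :
    ∀ (E : Matrix (Fin m) (Fin m) F) (T : ℝ), 0 ≤ T → Bd v T E → aeval A (rp u) * E = 0 →
      ∀ p, Bd v (K ^ u.card * T * (2 * β) ^ p) (A ^ p * E) := by
  have hK1 : 1 ≤ K := by
    have : (0 : ℝ) ≤ m := by positivity
    nlinarith
  induction u using Multiset.induction_on with
  | empty =>
    intro E T hT hE h p
    rw [rp_zero, map_one, one_mul] at h
    rw [h, mul_zero]
    intro i j
    simp only [Matrix.zero_apply, map_zero]
    positivity
  | cons b u ih =>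
    intro E T hT hE h p
    let E' := (A - b • (1 : Matrix (Fin m) (Fin m) F)) * E
    have hbβ : v b ≤ β := hu b (by simp)
    have hE' : Bd v ((m + 1) * (2 * S) * T) E' := by
      have h1 : Bd v (2 * S) (A - b • (1 : Matrix (Fin m) (Fin m) F)) := by
        have := hA.sub ((Bd.one (v := v) (m := m)).smul b)
        exact this.mono (by linarith)
      refine (h1.mul hE (by linarith)).mono ?_
      have : 0 ≤ S * T := by positivity
      nlinarith
    have hz : aeval A (rp u) * E' = 0 := by
      rw [← h, rp_cons, mul_comm (X - C b), map_mul, aeval_X_sub, mul_assoc]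
    have ih' := ih (fun c hc => hu c (by simp [hc])) E' ((m + 1) * (2 * S) * T) (by positivity) hE' hz
    rw [Multiset.card_cons]
    induction p with
    | zero =>
      simp only [pow_zero, one_mul, mul_one]
      refine hE.mono ?_
      have : 1 ≤ K ^ (u.card + 1) := one_le_pow₀ hK1
      nlinarith
    | succ p ihp =>
      have e1 : A ^ (p + 1) * E = b • (A ^ p * E) + A ^ p * E' := by
        simp only [E']
        rw [sub_mul, mul_sub, smul_mul_assoc, one_mul, mul_smul_comm, pow_succ, mul_assoc]
        abel
      rw [e1]
      refine ((ihp.smul b).add (ih' p)).mono ?_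
      have h1 : v b * (K ^ (u.card + 1) * T * (2 * β) ^ p) ≤
          β * (K ^ (u.card + 1) * T * (2 * β) ^ p) :=
        mul_le_mul_of_nonneg_right hbβ (by positivity)
      have h2 : K ^ u.card * ((m + 1) * (2 * S) * T) * (2 * β) ^ p ≤
          K ^ u.card * ((K * β) * T) * (2 * β) ^ p := by gcongr
      calc _ ≤ β * (K ^ (u.card + 1) * T * (2 * β) ^ p) +
            K ^ u.card * ((K * β) * T) * (2 * β) ^ p := add_le_add h1 h2
        _ = _ := by ring

theorem aeval_inv_rp {A Ai : Matrix (Fin m) (Fin m) F} (hA : Ai * A = 1) (u : Multiset F)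
    (hu : ∀ b ∈ u, b ≠ 0) :
    ∃ c : Matrix (Fin m) (Fin m) F, Commute c A ∧
      aeval Ai (rp (u.map (fun b => b⁻¹))) = c * aeval A (rp u) := by
  have hA' : A * Ai = 1 := mul_eq_one_comm.mp hA
  induction u using Multiset.induction_on with
  | empty => exact ⟨1, Commute.one_left _, by simp [rp_zero]⟩
  | cons b u ih =>
    obtain ⟨c, hc, h⟩ := ih fun x hx => hu x (by simp [hx])
    have hb : b ≠ 0 := hu b (by simp)
    refine ⟨(-b⁻¹) • (Ai * c), ?_, ?_⟩
    · have : Commute Ai A := by rw [Commute, SemiconjBy, hA, hA']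
      exact (this.mul_left hc).smul_left _
    · rw [Multiset.map_cons, rp_cons, rp_cons, map_mul, map_mul, h, aeval_X_sub, aeval_X_sub]
      have e1 : Ai - b⁻¹ • (1 : Matrix (Fin m) (Fin m) F) =
          (-b⁻¹) • (Ai * (A - b • (1 : Matrix (Fin m) (Fin m) F))) := by
        rw [mul_sub, hA, mul_smul_comm, mul_one, smul_sub, smul_smul, neg_mul, inv_mul_cancel₀ hb]
        simp [sub_eq_add_neg, add_comm]
      have e2 : Commute c (A - b • (1 : Matrix (Fin m) (Fin m) F)) :=
        hc.sub_right ((Commute.one_right c).smul_right b)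
      rw [e1]
      simp only [smul_mul_assoc, mul_assoc]
      rw [← mul_assoc _ c, ← e2.eq, mul_assoc]

/-- finding a spectral gap -/
theorem spectral_gap (s : Multiset F) (hs : s.card = m) (hprod : v s.prod = 1) (μ : F) (hμ : μ ∈ s)
    (Q : ℝ) (hQ : 1 < Q) (hQm : Q ^ m = v μ) :
    ∃ lo : ℝ, 1 ≤ lo ∧ lo * Q ≤ v μ ∧ (∀ l ∈ s, v l ≤ lo ∨ lo * Q ≤ v l) ∧ ∃ l ∈ s, v l ≤ lo := by
  classical
  have hm : 0 < m := by rw [← hs]; exact Multiset.card_pos_iff_exists_mem.mpr ⟨μ, hμ⟩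
  have hgap : ∃ k : Fin m, ∀ l ∈ s, ¬ (Q ^ (k : ℕ) < v l ∧ v l < Q ^ ((k : ℕ) + 1)) := by
    by_contra hcon
    push Not at hcon
    choose f hf1 hf2 hf3 using hcon
    have hinj : Function.Injective f := by
      intro a b hab
      have h1 := hf2 a
      have h2 := hf3 b
      have h3 := hf2 b
      have h4 := hf3 a
      rw [← hab] at h2 h3
      have h5 := (pow_lt_pow_iff_right₀ hQ).mp (h1.trans h2)
      have h6 := (pow_lt_pow_iff_right₀ hQ).mp (h3.trans h4)
      apply Fin.ext; omega
    have hsub : Finset.univ.image f ⊆ s.toFinset.erase μ := by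
      intro x hx
      obtain ⟨k, -, rfl⟩ := Finset.mem_image.mp hx
      rw [Finset.mem_erase, Multiset.mem_toFinset]
      refine ⟨?_, hf1 k⟩
      intro h0
      have := hf3 k
      rw [h0, ← hQm] at this
      have := (pow_lt_pow_iff_right₀ hQ).mp this
      have := k.2
      omega
    have h1 := Finset.card_le_card hsub
    rw [Finset.card_image_of_injective _ hinj, Finset.card_univ, Fintype.card_fin,
      Finset.card_erase_of_mem (by simpa using hμ)] at h1
    have h2 := Multiset.toFinset_card_le s
    omega
  obtain ⟨k, hk⟩ := hgap
  refine ⟨Q ^ (k : ℕ), one_le_pow₀ hQ.le, ?_, ?_, ?_⟩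
  · rw [← pow_succ, ← hQm]
    exact pow_le_pow_right₀ hQ.le k.2
  · intro l hl
    have := hk l hl
    rw [← pow_succ]
    by_contra hcon
    push Not at hcon
    exact this hcon
  · by_contra hcon
    push Not at hcon
    have h1 : ∀ l ∈ s, 1 ≤ v l := fun l hl => (one_le_pow₀ hQ.le).trans (hcon l hl).le
    obtain ⟨s', rfl⟩ := Multiset.exists_cons_of_mem hμ
    rw [Multiset.prod_cons, map_mul] at hprod
    have h2 := prod_lower v s' 1 zero_le_one (fun x hx => h1 x (by simp [hx]))
    rw [one_pow] at h2
    have h3 : 1 < v μ := by rw [← hQm]; exact one_lt_pow₀ hQ hm.ne'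
    nlinarith

theorem v_rp_ge_one (u : Multiset F) (x : F) (h : ∀ b ∈ u, 1 ≤ v (x - b)) :
    1 ≤ v ((rp u).eval x) := by
  rw [eval_rp]
  have := prod_lower v (u.map (fun a => x - a)) 1 zero_le_one (by
    intro y hy
    obtain ⟨b, hb, rfl⟩ := Multiset.mem_map.mp hy
    exact h b hb)
  simpa using this

theorem rp_eval_zero (u : Multiset F) (x : F) (h : x ∈ u) : (rp u).eval x = 0 := by
  rw [eval_rp]
  exact Multiset.prod_eq_zero (Multiset.mem_map.mpr ⟨x, h, by simp⟩)

set_option maxHeartbeats 1600000 in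
theorem gap_aux [IsAlgClosed F] {g : Matrix (Fin m) (Fin m) F} {μ : F} (a : ℕ) (hdet : g.det = 1)
    (hroot : g.charpoly.eval μ = 0) (hT1 : 2 ^ m ≤ v μ) (hT2 : 4 * (m + 1) ≤ v μ)
    (hT3 : (m.factorial : ℝ) ≤ v μ) (hg : Bd v (v μ ^ a) g) (Z W : ℝ)
    (hZ : Z = v μ ^ (a * m + a + 3)) (hW : W = Z ^ (m + m * (m + 1) + 2)) :
    ∃ Q : ℝ, 1 < Q ∧ Q ^ m = v μ ∧ ∃ e : Matrix (Fin m) (Fin m) F, e * e = e ∧ e * g = g * e ∧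
      Bd v W e ∧ e ≠ 0 ∧ e ≠ 1 ∧ ∀ p, ∃ α γ, 0 ≤ α ∧ 0 < γ ∧ Bd v α (g ^ p * (1 - e)) ∧
        Bd v γ (g.adjugate ^ p * e) ∧ α * γ * Q ^ p = 4 ^ p * (Z ^ m * W * (Z * v μ) ^ m * W) := by
  classical
  have hm : m ≠ 0 := by
    rintro rfl
    simp at hroot
  have hm0 : (0:ℝ) ≤ m := by positivity
  have hT4 : (4:ℝ) ≤ v μ := by linarith
  set T := v μ with hT
  have hTp : (0:ℝ) < T := by linarith
  have hT1' : (1:ℝ) ≤ T := by linarith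
  set S := T ^ (a * m + a + 2) with hS
  have hS1 : 1 ≤ S := one_le_pow₀ hT1'
  have hZS : Z = T * S := by rw [hZ, hS]; ring
  have hZT : T ≤ Z := by rw [hZS]; nlinarith
  have hZ1 : 1 ≤ Z := hT1'.trans hZT
  have hZ2 : (m + 1) * (2 * S) ≤ Z := by rw [hZS]; nlinarith
  obtain ⟨hcp, hcard⟩ := charpoly_eq_prod g
  set s := g.charpoly.roots with hs
  have hpow : ∀ i j : ℕ, i ≤ j → T ^ i ≤ T ^ j := fun i j h => pow_le_pow_right₀ hT1' h
  have hgS : Bd v S g := hg.mono (hpow _ _ (by lia))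
  have hgiS : Bd v S g.adjugate := by
    have h1 := hg.adjugate (one_le_pow₀ hT1')
    refine h1.mono ?_
    calc (m.factorial : ℝ) * (T ^ a) ^ m ≤ T * (T ^ a) ^ m := by gcongr
      _ = T ^ (a * m + 1) := by rw [← pow_mul, pow_succ']
      _ ≤ S := hpow _ _ (by lia)
  have hgi : g.adjugate * g = 1 := by rw [Matrix.adjugate_mul, hdet, one_smul]
  have hne0 : g.charpoly ≠ 0 := (Matrix.charpoly_monic g).ne_zero
  have hsS : ∀ b ∈ s, v b ≤ S := by
    intro b hb
    have h1 := eig_bound (by positivity) hg b ((Polynomial.mem_roots hne0).mp hb)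
    refine h1.trans ?_
    calc (m : ℝ) * T ^ a ≤ T * T ^ a := by gcongr; linarith
      _ = T ^ (a + 1) := by rw [pow_succ']
      _ ≤ S := hpow _ _ (by lia)
  have hμs : μ ∈ s := (Polynomial.mem_roots hne0).mpr hroot
  have hprod : s.prod = 1 := by
    rw [hs, ← Matrix.det_eq_prod_roots_charpoly_of_splits (IsAlgClosed.splits _), hdet]
  set Q : ℝ := T ^ ((m : ℝ)⁻¹) with hQ
  have hQm : Q ^ m = T := Real.rpow_inv_natCast_pow hTp.le hm
  have hQ2 : 2 ≤ Q := by
    by_contra hcon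
    push Not at hcon
    have : Q ^ m < 2 ^ m := pow_lt_pow_left₀ hcon (by positivity) hm
    linarith
  obtain ⟨lo, hlo1, hloT, hlo, l0, hl0, hl0'⟩ := spectral_gap (v := v) s hcard (by simp [hprod]) μ hμs Q
    (by linarith) hQm
  set s1 := s.filter (fun l => lo * Q ≤ v l) with hs1
  set s2 := s.filter (fun l => ¬ lo * Q ≤ v l) with hs2
  have hs12 : s1 + s2 = s := Multiset.filter_add_not _ s
  have hm1 : ∀ l, l ∈ s1 ↔ l ∈ s ∧ lo * Q ≤ v l := fun l => Multiset.mem_filter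
  have hm2 : ∀ l, l ∈ s2 ↔ l ∈ s ∧ ¬ lo * Q ≤ v l := fun l => Multiset.mem_filter
  have hm2' : ∀ l ∈ s2, v l ≤ lo := fun l hl =>
    (hlo l ((hm2 l).mp hl).1).resolve_right ((hm2 l).mp hl).2
  have hl0s : l0 ∈ s2 := (hm2 l0).mpr ⟨hl0, by nlinarith⟩
  have hμs1 : μ ∈ s1 := (hm1 μ).mpr ⟨hμs, hloT⟩
  set F1 := aeval g (rp s1) with hF1
  set F2 := aeval g (rp s2) with hF2
  have hF12 : F1 * F2 = 0 := by
    rw [hF1, hF2, ← map_mul, ← rp_add, hs12]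
    have : rp s = g.charpoly := hcp.symm
    rw [this, Matrix.aeval_self_charpoly]
  have hcomm : Commute F1 F2 := by
    rw [Commute, SemiconjBy, hF1, hF2, ← map_mul, ← map_mul, mul_comm]
  have hF1g : Commute F1 g := by
    have := (Commute.all (rp s1) X).map (aeval g)
    simpa using this
  have hF2g : Commute F2 g := by
    have := (Commute.all (rp s2) X).map (aeval g)
    simpa using this
  set Sm := F1 + F2 with hSm
  have hSmdet : 1 ≤ v Sm.det := by
    rw [hSm, hF1, hF2, ← map_add, det_aeval_eq]
    have := prod_lower v (s.map (fun l => (rp s1 + rp s2).eval l)) 1 zero_le_one (by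
      intro y hy
      obtain ⟨l, hl, rfl⟩ := Multiset.mem_map.mp hy
      rw [eval_add]
      by_cases hl1 : lo * Q ≤ v l
      · rw [rp_eval_zero s1 l ((hm1 l).mpr ⟨hl, hl1⟩), zero_add]
        apply v_rp_ge_one
        intro b hb
        have h1 := hm2' b hb
        have h2 := v.le_sub l b
        nlinarith
      · rw [rp_eval_zero s2 l ((hm2 l).mpr ⟨hl, hl1⟩), add_zero]
        apply v_rp_ge_one
        intro b hb
        have h1 := hm2' l ((hm2 l).mpr ⟨hl, hl1⟩)
        have h3 := ((hm1 b).mp hb).2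
        have h2 := v.le_sub b l
        rw [v.map_sub b l] at h2
        nlinarith)
    simpa using this
  have hSmdet0 : Sm.det ≠ 0 := by
    intro h0
    rw [h0, map_zero] at hSmdet
    linarith
  set Y := Sm.det⁻¹ • Sm.adjugate with hY
  have hSmY : Sm * Y = 1 := by
    rw [hY, mul_smul_comm, Matrix.mul_adjugate, smul_smul, inv_mul_cancel₀ hSmdet0, one_smul]
  have hYSm : Y * Sm = 1 := mul_eq_one_comm.mp hSmY
  have hYc : ∀ A, Commute A Sm → Commute A Y := by
    intro A hA
    calc A * Y = (Y * Sm) * A * Y := by rw [hYSm, one_mul]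
      _ = Y * (A * Sm) * Y := by rw [hA.eq, mul_assoc Y]
      _ = Y * A := by rw [mul_assoc, mul_assoc, hSmY, mul_one]
  have hF1Sm : Commute F1 Sm := (Commute.refl F1).add_right hcomm
  have hF2Sm : Commute F2 Sm := hcomm.symm.add_right (Commute.refl F2)
  have hgSm : Commute g Sm := hF1g.symm.add_right hF2g.symm
  have hF1Y := hYc _ hF1Sm
  have hF2Y := hYc _ hF2Sm
  have hgY := hYc _ hgSm
  set e := F2 * Y with he
  have he1 : 1 - e = F1 * Y := by
    rw [← hSmY, hSm, he, add_mul, add_sub_cancel_right]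
  have hF1e : F1 * e = 0 := by rw [he, ← mul_assoc, hF12, zero_mul]
  have hF2e : F2 * (1 - e) = 0 := by rw [he1, ← mul_assoc, ← hcomm.eq, hF12, zero_mul]
  have hee : e * e = e := by
    have : e * (1 - e) = 0 := by
      have h9 : e = Y * F2 := hF2Y.eq
      calc e * (1 - e) = Y * F2 * (1 - e) := by rw [← h9]
        _ = 0 := by rw [mul_assoc, hF2e, mul_zero]
    rw [mul_sub, mul_one, sub_eq_zero] at this
    exact this.symm
  have heg : e * g = g * e := (hF2g.mul_left hgY.symm).eq
  have hc1 : s1.card ≤ m := by rw [← hcard, ← hs12]; simp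
  have hc2 : s2.card ≤ m := by rw [← hcard, ← hs12]; simp
  have hmS : (0:ℝ) ≤ (m + 1) * (2 * S) := by positivity
  have hFb : ∀ u : Multiset F, u.card ≤ m → (∀ b ∈ u, v b ≤ S) → Bd v (Z ^ m) (aeval g (rp u)) := by
    intro u hu hub
    refine (hgS.aeval_rp hS1 u hub).mono ?_
    exact (pow_le_pow_left₀ hmS hZ2 _).trans (pow_le_pow_right₀ hZ1 hu)
  have hF1b : Bd v (Z ^ m) F1 := hFb s1 hc1 fun b hb => hsS b ((hm1 b).mp hb).1
  have hF2b : Bd v (Z ^ m) F2 := hFb s2 hc2 fun b hb => hsS b ((hm2 b).mp hb).1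
  have hSmb : Bd v (Z ^ (m + 1)) Sm := (hF1b.add hF2b).mono (by
    rw [pow_succ]
    have : 0 < Z ^ m := by positivity
    nlinarith)
  have hYb : Bd v (Z ^ (m * (m + 1) + 1)) Y := by
    have h1 := (hSmb.adjugate (one_le_pow₀ hZ1)).smul Sm.det⁻¹
    refine h1.mono ?_
    have h2 : v Sm.det⁻¹ ≤ 1 := by
      rw [map_inv₀]; exact inv_le_one_of_one_le₀ hSmdet
    calc v Sm.det⁻¹ * (m.factorial * (Z ^ (m + 1)) ^ m) ≤ 1 * (Z * (Z ^ (m + 1)) ^ m) := by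
          gcongr
          exact hT3.trans hZT
      _ = _ := by rw [one_mul, ← pow_mul, pow_succ', mul_comm m]
  have hprodb : ∀ A, Bd v (Z ^ m) A → Bd v W (A * Y) := by
    intro A hA
    refine (hA.mul hYb (by positivity)).mono ?_
    calc (m:ℝ) * (Z ^ m * Z ^ (m * (m + 1) + 1)) ≤ Z * (Z ^ m * Z ^ (m * (m + 1) + 1)) := by
          gcongr
          linarith
      _ = W := by rw [hW]; ring
  have heb : Bd v W e := hprodb F2 hF2b
  have he1b : Bd v W (1 - e) := by rw [he1]; exact hprodb F1 hF1b
  have hW0 : 0 < W := by rw [hW]; positivity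
  refine ⟨Q, by linarith, hQm, e, hee, heg, heb, ?_, ?_, ?_⟩
  · intro h0
    have h1 : F1 = Sm := by
      rw [h0, sub_zero] at he1
      rw [← one_mul Sm, he1, mul_assoc, hYSm, mul_one]
    have h2 : F1.det = 0 := by
      rw [hF1, det_aeval_eq]
      exact Multiset.prod_eq_zero (Multiset.mem_map.mpr ⟨μ, hμs, rp_eval_zero _ _ hμs1⟩)
    exact hSmdet0 (h1 ▸ h2)
  · intro h0
    have h1 : F2 = Sm := by
      rw [← one_mul Sm, ← h0, he, mul_assoc, hYSm, mul_one]
    have h2 : F2.det = 0 := by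
      rw [hF2, det_aeval_eq]
      exact Multiset.prod_eq_zero (Multiset.mem_map.mpr ⟨l0, hl0, rp_eval_zero _ _ hl0s⟩)
    exact hSmdet0 (h1 ▸ h2)
  · intro p
    have hloS : lo ≤ S := by
      have : T ≤ S := by simpa using hpow 1 (a * m + a + 2) (by lia)
      nlinarith
    have hQp : 0 < Q := by linarith
    have hlop : 0 < lo := by linarith
    refine ⟨Z ^ m * W * (2 * lo) ^ p, (Z * T) ^ m * W * (2 * (lo * Q)⁻¹) ^ p, by positivity,
      by positivity, ?_, ?_, ?_⟩
    · have h1 := contract hS1 hgS (by linarith) hloS hZ2 (by nlinarith) s2 hm2' (1 - e) W hW0.le he1b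
        hF2e p
      refine h1.mono ?_
      gcongr
    · have h0 : ∀ b ∈ s1, b ≠ 0 := by
        rintro b hb rfl
        have := ((hm1 _).mp hb).2
        rw [map_zero] at this
        have : 0 < lo * Q := by positivity
        linarith
      obtain ⟨c, hc, hce⟩ := aeval_inv_rp hgi s1 h0
      have hβ : (lo * Q)⁻¹ ≤ S := (inv_le_one_of_one_le₀ (by nlinarith)).trans hS1
      have h1 := contract hS1 hgiS (β := (lo * Q)⁻¹) (K := Z * T) (by positivity) hβ
        (by nlinarith) (by
          have : 1 ≤ T * (lo * Q)⁻¹ := by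
            rw [← div_eq_mul_inv, one_le_div (by positivity)]; exact hloT
          rw [mul_assoc]
          nlinarith) (s1.map (fun b => b⁻¹)) (by
          intro b' hb'
          obtain ⟨b, hb, rfl⟩ := Multiset.mem_map.mp hb'
          rw [map_inv₀]
          exact inv_anti₀ (by positivity) ((hm1 _).mp hb).2) e W hW0.le heb
        (by rw [hce, mul_assoc, hF1e, mul_zero]) p
      refine h1.mono ?_
      rw [Multiset.card_map]
      have : 1 ≤ Z * T := by nlinarith
      gcongr
    · rw [mul_pow 2 lo, mul_pow 2 (lo * Q)⁻¹, inv_pow, mul_pow lo Q]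
      have h4 : (4:ℝ) ^ p = 2 ^ p * 2 ^ p := by rw [← mul_pow]; norm_num
      rw [h4]
      field_simp

theorem gap (m a : ℕ) : ∃ (E : ℕ) (T0 : ℝ), ∀ (L : Type) [Field L] [IsAlgClosed L]
    (v : AbsoluteValue L ℝ) (g : Matrix (Fin m) (Fin m) L) (μ : L), g.det = 1 →
    g.charpoly.eval μ = 0 → T0 ≤ v μ → Bd v (v μ ^ a) g →
    ∃ Q : ℝ, 1 < Q ∧ Q ^ m = v μ ∧ ∃ e : Matrix (Fin m) (Fin m) L, e * e = e ∧ e * g = g * e ∧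
      Bd v (v μ ^ E) e ∧ e ≠ 0 ∧ e ≠ 1 ∧ ∀ p, ∃ α γ, 0 ≤ α ∧ 0 < γ ∧ Bd v α (g ^ p * (1 - e)) ∧
        Bd v γ (g.adjugate ^ p * e) ∧ α * γ * Q ^ p ≤ 4 ^ p * v μ ^ E := by
  set b := a * m + a + 3
  set c := m + m * (m + 1) + 2
  refine ⟨b * m + b * c + (b + 1) * m + b * c, max (2 ^ m) (max (4 * (m + 1)) m.factorial), ?_⟩
  intro L _ _ v g μ hdet hroot hT hg
  simp only [max_le_iff] at hT
  obtain ⟨Q, hQ, hQm, e, he1, he2, he3, he4, he5, he6⟩ := gap_aux a hdet hroot hT.1 hT.2.1 hT.2.2 hg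
    _ _ rfl rfl
  have hT1 : 1 ≤ v μ := by
    have := hT.2.1
    have : (0:ℝ) ≤ m := by positivity
    linarith
  refine ⟨Q, hQ, hQm, e, he1, he2, he3.mono ?_, he4, he5, ?_⟩
  · rw [← pow_mul]
    exact pow_le_pow_right₀ hT1 (by lia)
  · intro p
    obtain ⟨α, γ, h1, h2, h3, h4, h5⟩ := he6 p
    refine ⟨α, γ, h1, h2, h3, h4, ?_⟩
    rw [h5]
    apply le_of_eq
    congr 1
    ring
end

end LD

end

section
namespace LD

/-- every subgroup of index at most `R` spans the matrix algebra -/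
def SpanR {K : Type*} [Field K] {m : ℕ} (R : ℕ) (Γ : Subgroup (SL m K)) : Prop :=
  ∀ H : Subgroup (SL m K), H ≤ Γ → H.relIndex Γ ≠ 0 → H.relIndex Γ ≤ R →
    Submodule.span K ((fun g : SL m K => (g : Matrix (Fin m) (Fin m) K)) '' H) = ⊤

/-- the centralizer of a matrix -/
def centr {K : Type*} [CommRing K] {m : ℕ} (e : Matrix (Fin m) (Fin m) K) : Subgroup (SL m K) where
  carrier := {x | (x : Matrix (Fin m) (Fin m) K) * e = e * x}
  mul_mem' := fun {x y} hx hy => by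
    simp only [Set.mem_ofPred_eq, Matrix.SpecialLinearGroup.coe_mul] at *
    rw [mul_assoc, hy, ← mul_assoc, hx, mul_assoc]
  one_mem' := by simp
  inv_mem' := fun {x} hx => by
    simp only [Set.mem_ofPred_eq] at *
    have h1 : ((x⁻¹ : SL m K) : Matrix (Fin m) (Fin m) K) * (x : Matrix (Fin m) (Fin m) K) = 1 := by
      rw [← Matrix.SpecialLinearGroup.coe_mul]; simp
    have h2 : (x : Matrix (Fin m) (Fin m) K) * ((x⁻¹ : SL m K) : Matrix (Fin m) (Fin m) K) = 1 := by
      rw [← Matrix.SpecialLinearGroup.coe_mul]; simp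
    calc ((x⁻¹ : SL m K) : Matrix (Fin m) (Fin m) K) * e
        = ((x⁻¹ : SL m K) : Matrix (Fin m) (Fin m) K) * e *
          ((x : Matrix (Fin m) (Fin m) K) * ((x⁻¹ : SL m K) : Matrix (Fin m) (Fin m) K)) := by
          rw [h2, mul_one]
      _ = ((x⁻¹ : SL m K) : Matrix (Fin m) (Fin m) K) * (e * (x : Matrix (Fin m) (Fin m) K)) *
          ((x⁻¹ : SL m K) : Matrix (Fin m) (Fin m) K) := by simp only [mul_assoc]
      _ = _ := by rw [← hx, ← mul_assoc, h1, one_mul]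

theorem mem_centr {K : Type*} [CommRing K] {m : ℕ} {e : Matrix (Fin m) (Fin m) K} {x : SL m K} :
    x ∈ centr e ↔ (x : Matrix (Fin m) (Fin m) K) * e = e * x := Iff.rfl

/-- a matrix commuting with everything is scalar -/
theorem scalar_of_central {K : Type*} [Field K] {m : ℕ} (e : Matrix (Fin m) (Fin m) K)
    (h : ∀ x : Matrix (Fin m) (Fin m) K, x * e = e * x) : ∃ c : K, e = c • 1 := by
  have h1 := Matrix.mem_range_scalar_of_commute_single (M := e) (by
    intro i j _
    exact h _)
  obtain ⟨c, hc⟩ := h1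
  refine ⟨c, ?_⟩
  rw [← hc, Matrix.scalar_apply, Matrix.smul_one_eq_diagonal]

theorem central_of_span {K : Type*} [Field K] {m : ℕ} (e : Matrix (Fin m) (Fin m) K)
    (T : Set (Matrix (Fin m) (Fin m) K)) (hT : Submodule.span K T = ⊤)
    (h : ∀ x ∈ T, x * e = e * x) : ∃ c : K, e = c • 1 := by
  apply scalar_of_central
  intro x
  have hx : x ∈ Submodule.span K T := by rw [hT]; trivial
  induction hx using Submodule.span_induction with
  | mem x hx => exact h x hx
  | zero => simp
  | add x y _ _ h1 h2 => rw [add_mul, mul_add, h1, h2]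
  | smul c x _ h1 => rw [smul_mul_assoc, mul_smul_comm, h1]

/-- proper idempotents have centralizers of large index -/
def NC {K : Type*} [Field K] {m : ℕ} (R : ℕ) (Γ : Subgroup (SL m K)) : Prop :=
  ∀ e : Matrix (Fin m) (Fin m) K, e * e = e → e ≠ 0 → e ≠ 1 →
    (centr e).relIndex Γ = 0 ∨ R < (centr e).relIndex Γ

theorem SpanR.nc {K : Type*} [Field K] {m : ℕ} {R : ℕ} {Γ : Subgroup (SL m K)} (h : SpanR R Γ) :
    NC R Γ := by
  intro e he h0 h1
  by_contra hcon
  push Not at hcon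
  have h2 := h (centr e ⊓ Γ) inf_le_right (by rw [Subgroup.inf_relIndex_right]; exact hcon.1)
    (by rw [Subgroup.inf_relIndex_right]; exact hcon.2)
  obtain ⟨c, rfl⟩ := central_of_span e _ h2 (by
    rintro _ ⟨x, hx, rfl⟩
    exact hx.1)
  rw [smul_mul_assoc, one_mul, smul_smul] at he
  by_cases hm : m = 0
  · subst hm
    exact h0 (Subsingleton.elim _ _)
  · have h3 := congrFun (congrFun he ⟨0, by omega⟩) ⟨0, by omega⟩
    have h4 : c * c = c := by simpa [Matrix.smul_apply, -mul_eq_left₀, -mul_eq_right₀] using h3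
    have h5 : c * (c - 1) = 0 := by rw [mul_sub, h4, mul_one, sub_self]
    rcases mul_eq_zero.mp h5 with h6 | h6
    · exact h0 (by rw [h6, zero_smul])
    · exact h1 (by rw [sub_eq_zero.mp h6, one_smul])

theorem finite_pow {G : Type*} [Monoid G] {S : Set G} (hS : S.Finite) (n : ℕ) : (S ^ n).Finite := by
  induction n with
  | zero => simp
  | succ n ih => rw [pow_succ]; exact ih.mul hS

/-- orbit growth, dichotomy -/
theorem growth_aux {G : Type*} [Group G] (S : Set G) (hS : S.Finite) (h1 : (1 : G) ∈ S) (H : Subgroup G)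
    (R : ℕ) :
    (∃ x : Fin (R + 1) → G, (∀ i, x i ∈ S ^ R) ∧ ∀ i j, i ≠ j → (x i)⁻¹ * x j ∉ H) ∨
    (H.relIndex (Subgroup.closure S) ≠ 0 ∧ H.relIndex (Subgroup.closure S) ≤ R ∧
      ∀ g ∈ Subgroup.closure S, ∃ r ∈ S ^ R, g⁻¹ * r ∈ H) := by
  classical
  let A : ℕ → Set (G ⧸ H) := fun n => (fun g : G => (g : G ⧸ H)) '' (S ^ n)
  have hAf : ∀ n, (A n).Finite := fun n => (finite_pow hS n).image _
  have hAmono : ∀ n, A n ⊆ A (n + 1) := fun n => Set.image_mono (pow_subset h1 (Nat.le_succ n))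
  have key : ∀ n, n + 1 ≤ (A n).ncard ∨ ∃ k < n, A k = A (k + 1) ∧ (A k).ncard ≤ n := by
    intro n
    induction n with
    | zero =>
      left
      have : (A 0).Nonempty := ⟨_, 1, by simp, rfl⟩
      have := (Set.ncard_pos (hAf 0)).mpr this
      omega
    | succ n ih =>
      rcases ih with ih | ⟨k, hk, hk1, hk2⟩
      · by_cases h2 : A n = A (n + 1)
        · by_cases h3 : n + 2 ≤ (A n).ncard
          · left; rw [← h2]; omega
          · right; exact ⟨n, by omega, h2, by omega⟩
        · left
          have := Set.ncard_lt_ncard ((hAmono n).ssubset_of_ne h2) (hAf (n + 1))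
          omega
      · right; exact ⟨k, by omega, hk1, by omega⟩
  rcases key R with hR | ⟨k, hk, hk1, hk2⟩
  · left
    have := hAf R
    obtain ⟨f, hf⟩ : ∃ f : Fin (R + 1) → A R, Function.Injective f := by
      have := (hAf R).fintype
      have : Fintype.card (Fin (R + 1)) ≤ Fintype.card (A R) := by
        rw [Fintype.card_fin, ← Nat.card_eq_fintype_card]
        exact hR
      obtain ⟨f⟩ := Function.Embedding.nonempty_of_card_le this
      exact ⟨f, f.injective⟩
    choose x hx1 hx2 using fun i => (f i).2
    refine ⟨x, hx1, fun i j hij hmem => hij (hf (Subtype.ext ?_))⟩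
    rw [← hx2 i, ← hx2 j]
    exact QuotientGroup.eq.mpr hmem
  · right
    have hstab : ∀ s ∈ S, ∀ a ∈ A k, s • a ∈ A k := by
      rintro s hs _ ⟨g, hg, rfl⟩
      rw [hk1]
      refine ⟨s * g, ?_, rfl⟩
      rw [pow_succ']
      exact Set.mul_mem_mul hs hg
    have hstab' : ∀ γ ∈ Subgroup.closure S, ∀ a ∈ A k, γ • a ∈ A k := by
      have hst : ∀ s ∈ S, s ∈ MulAction.stabilizer G (A k) := by
        intro s hs
        rw [MulAction.mem_stabilizer_set]
        have h3 : s • A k = A k := by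
          apply Set.eq_of_subset_of_ncard_le _ _ (hAf k)
          · rintro _ ⟨a, ha, rfl⟩; exact hstab s hs a ha
          · rw [Set.ncard_smul_set]
        intro b
        constructor
        · intro hb
          rw [← h3] at hb
          exact (Set.smul_mem_smul_set_iff).mp hb
        · exact hstab s hs b
      have hcl : Subgroup.closure S ≤ MulAction.stabilizer G (A k) := (Subgroup.closure_le _).mpr hst
      intro γ hγ a ha
      exact (MulAction.mem_stabilizer_set.mp (hcl hγ) a).mpr ha
    have horb : MulAction.orbit (Subgroup.closure S) ((1 : G) : G ⧸ H) ⊆ A k := by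
      rintro _ ⟨γ, rfl⟩
      exact hstab' γ γ.2 _ ⟨1, one_mem_pow h1 k, rfl⟩
    have hst2 : MulAction.stabilizer (Subgroup.closure S) ((1 : G) : G ⧸ H) =
        H.subgroupOf (Subgroup.closure S) := by
      ext γ
      rw [MulAction.mem_stabilizer_iff, Subgroup.mem_subgroupOf]
      have : γ • ((1 : G) : G ⧸ H) = ((γ.1 * 1 : G) : G ⧸ H) := rfl
      rw [this, mul_one, eq_comm, QuotientGroup.eq]
      simp
    have hidx : H.relIndex (Subgroup.closure S) =
        (MulAction.orbit (Subgroup.closure S) ((1 : G) : G ⧸ H)).ncard := by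
      rw [Subgroup.relIndex, ← hst2, MulAction.index_stabilizer]
    have hle := Set.ncard_le_ncard horb (hAf k)
    have hpos : 0 < (MulAction.orbit (Subgroup.closure S) ((1 : G) : G ⧸ H)).ncard :=
      (Set.ncard_pos ((hAf k).subset horb)).mpr ⟨_, MulAction.mem_orbit_self _⟩
    refine ⟨by omega, by omega, ?_⟩
    intro g hg
    obtain ⟨r, hr, hr'⟩ := hstab' g hg _ ⟨1, one_mem_pow h1 k, rfl⟩
    refine ⟨r, pow_subset h1 hk.le hr, ?_⟩
    have h5 : ((g * 1 : G) : G ⧸ H) = (r : G ⧸ H) := hr'.symm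
    rw [mul_one] at h5
    exact QuotientGroup.eq.mp h5

/-- orbit growth -/
theorem growth {G : Type*} [Group G] (S : Set G) (hS : S.Finite) (h1 : (1 : G) ∈ S) (H : Subgroup G)
    (R : ℕ) (h : H.relIndex (Subgroup.closure S) = 0 ∨ R < H.relIndex (Subgroup.closure S)) :
    ∃ x : Fin (R + 1) → G, (∀ i, x i ∈ S ^ R) ∧ ∀ i j, i ≠ j → (x i)⁻¹ * x j ∉ H := by
  rcases growth_aux S hS h1 H R with h2 | h2
  · exact h2
  · omega

/-- conjugation -/
def conjHom {K : Type*} [Field K] {m : ℕ} (h k : Matrix (Fin m) (Fin m) K) (hk : h * k = 1) :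
    SL m K →* SL m K where
  toFun x := ⟨h * x * k, by
    rw [Matrix.det_mul, Matrix.det_mul, x.2, mul_one, ← Matrix.det_mul, hk, Matrix.det_one]⟩
  map_one' := by ext i j; simp [hk]
  map_mul' x y := by
    apply Subtype.ext
    simp only [Matrix.SpecialLinearGroup.coe_mul]
    have hkh : k * h = 1 := mul_eq_one_comm.mp hk
    calc h * ((x : Matrix (Fin m) (Fin m) K) * y) * k = h * x * 1 * y * k := by
          simp only [mul_assoc, one_mul]
      _ = h * x * (k * h) * y * k := by rw [hkh]
      _ = (h * x * k) * (h * y * k) := by simp only [mul_assoc]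

theorem conjHom_coe {K : Type*} [Field K] {m : ℕ} (h k : Matrix (Fin m) (Fin m) K) (hk : h * k = 1)
    (x : SL m K) : (conjHom h k hk x : Matrix (Fin m) (Fin m) K) = h * x * k := rfl

theorem NC.conj {K : Type*} [Field K] {m : ℕ} {R : ℕ} {Γ : Subgroup (SL m K)} (hn : NC R Γ)
    (h k : Matrix (Fin m) (Fin m) K) (hk : h * k = 1) : NC R (Γ.map (conjHom h k hk)) := by
  intro e he h0 h1
  have hkh : k * h = 1 := mul_eq_one_comm.mp hk
  rw [← Subgroup.relIndex_comap]
  have hcm : (centr e).comap (conjHom h k hk) = centr (k * e * h) := by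
    ext x
    rw [Subgroup.mem_comap, mem_centr, mem_centr, conjHom_coe]
    constructor
    · intro hx
      calc (x : Matrix (Fin m) (Fin m) K) * (k * e * h) = (k * h) * x * (k * e * h) := by
            rw [hkh, one_mul]
        _ = k * (h * x * k * e) * h := by simp only [mul_assoc]
        _ = k * e * h * x * (k * h) := by rw [hx]; simp only [mul_assoc]
        _ = _ := by rw [hkh, mul_one]
    · intro hx
      calc h * x * k * e = h * x * k * e * (h * k) := by rw [hk, mul_one]
        _ = h * (x * (k * e * h)) * k := by simp only [mul_assoc]
        _ = (h * k) * e * (h * x * k) := by rw [hx]; simp only [mul_assoc]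
        _ = _ := by rw [hk, one_mul]
  rw [hcm]
  have back : h * (k * e * h) * k = e := by
    calc h * (k * e * h) * k = (h * k) * e * (h * k) := by simp only [mul_assoc]
      _ = e := by rw [hk, one_mul, mul_one]
  apply hn
  · calc k * e * h * (k * e * h) = k * e * (h * k) * e * h := by simp only [mul_assoc]
      _ = k * (e * e) * h := by rw [hk, mul_one]; simp only [mul_assoc]
      _ = _ := by rw [he]
  · intro h2
    apply h0
    rw [← back, h2]; simp
  · intro h2
    apply h1
    rw [← back, h2, mul_one, hk]

end LD

end

section
namespace LD

/-- normalized counterexample data -/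
structure Data (m Qn E N : ℕ) where
  L : Type
  [fld : Field L]
  v : AbsoluteValue L ℝ
  S : Set (SL m L)
  fin : S.Finite
  one_mem : (1 : SL m L) ∈ S
  nc : NC ((m ^ 2 + 1) ^ m) (Subgroup.closure S)
  ρ : ℝ
  two_le : 2 ≤ ρ
  le_ρ : (N : ℝ) ≤ ρ
  bdS : ∀ s ∈ S, Bd v (ρ ^ 2) (s : Matrix (Fin m) (Fin m) L)
  e : Matrix (Fin m) (Fin m) L
  he : e * e = e
  ebd : Bd v (ρ ^ E) e
  e0 : e ≠ 0
  e1 : e ≠ 1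
  g : SL m L
  hg : g ∈ S ^ Qn
  heg : e * (g : Matrix (Fin m) (Fin m) L) = g * e
  q : ℝ
  hq : q ^ m = ρ
  hαγ : ∀ p, ∃ α γ, 0 ≤ α ∧ 0 < γ ∧ Bd v α ((g : Matrix (Fin m) (Fin m) L) ^ p * (1 - e)) ∧
        Bd v γ ((g : Matrix (Fin m) (Fin m) L).adjugate ^ p * e) ∧ α * γ * q ^ p ≤ 4 ^ p * ρ ^ E
  nofree : ∀ a ∈ S ^ N, ∀ b ∈ S ^ N, ¬ ProjFree L (a : Matrix (Fin m) (Fin m) L) (b : Matrix (Fin m) (Fin m) L)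

attribute [instance] Data.fld

theorem bd_pow_set {L : Type*} [Field L] {m : ℕ} {v : AbsoluteValue L ℝ} {S : Set (SL m L)} {B : ℝ}
    (hB : 1 ≤ B) (hS : ∀ s ∈ S, Bd v B (s : Matrix (Fin m) (Fin m) L)) (n : ℕ) :
    ∀ x ∈ S ^ n, Bd v (((m + 1) * B) ^ n) (x : Matrix (Fin m) (Fin m) L) := by
  induction n with
  | zero =>
    intro x hx
    rw [pow_zero, Set.mem_one] at hx
    subst hx
    simpa using Bd.one
  | succ n ih =>
    intro x hx
    rw [pow_succ] at hx
    obtain ⟨a, ha, b, hb, rfl⟩ := hx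
    have := (ih a ha).mul (hS b hb) (by positivity)
    rw [Matrix.SpecialLinearGroup.coe_mul]
    refine this.mono ?_
    rw [pow_succ]
    have : 0 ≤ ((m + 1) * B) ^ n * B := by positivity
    nlinarith

theorem no_data (m Qn E : ℕ) (hD : ∀ N, Nonempty (Data m Qn E N)) : False := by
  classical
  let D : ∀ N, Data m Qn E N := fun N => (hD N).some
  let U : Ultrafilter ℕ := Filter.hyperfilter ℕ
  let L : ℕ → Type := fun N => (D N).L
  let v : ∀ N, AbsoluteValue (L N) ℝ := fun N => (D N).v
  let ρ : ℕ → ℝ := fun N => (D N).ρ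
  have hρ : ∀ N, 2 ≤ ρ N := fun N => (D N).two_le
  have hρ1 : ∀ N, 1 ≤ ρ N := fun N => by linarith [hρ N]
  have hlarge : ∀ B : ℝ, ∀ᶠ N in U, B ≤ ρ N := by
    intro B
    obtain ⟨n, hn⟩ := exists_nat_ge B
    have : ∀ᶠ N in Filter.atTop, B ≤ ρ N := by
      filter_upwards [Filter.eventually_ge_atTop n] with N hN
      have h1 := (D N).le_ρ
      have h2 : (n : ℝ) ≤ N := by exact_mod_cast hN
      exact hn.trans (h2.trans h1)
    exact Nat.hyperfilter_le_atTop this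
  have hlargeN : ∀ n : ℕ, ∀ᶠ N in U, n ≤ N := fun n =>
    Nat.hyperfilter_le_atTop (Filter.eventually_ge_atTop n)
  obtain ⟨Ω, _, π, hπs, hπ, -⟩ := exists_residue v U ρ hρ
  obtain ⟨e, he⟩ := of_ev_bd (v := v) (U := U) (ρ := ρ) (hρ := hρ) (fun N => (D N).e) E
    (Filter.Eventually.of_forall fun N => (D N).ebd)
  let G := SL m (ModR v U ρ hρ)
  let φ : G →* SL m Ω := Matrix.SpecialLinearGroup.map π
  let evG : ∀ N, G →* SL m (L N) := fun N => Matrix.SpecialLinearGroup.map (ev v U ρ hρ N)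
  have evG_coe : ∀ N (x : G), (evG N x : Matrix (Fin m) (Fin m) (L N)) =
      (x : Matrix (Fin m) (Fin m) (ModR v U ρ hρ)).map (ev v U ρ hρ N) := fun N x => rfl
  let Comm : Subgroup G :=
    { carrier := {x | ∀ᶠ N in U, evG N x ∈ centr (D N).e}
      mul_mem' := fun {x y} hx hy => by
        filter_upwards [hx, hy] with N h1 h2
        rw [map_mul]; exact mul_mem h1 h2
      one_mem' := Filter.Eventually.of_forall fun N => by rw [map_one]; exact one_mem _
      inv_mem' := fun {x} hx => by
        filter_upwards [hx] with N h1
        rw [map_inv]; exact inv_mem h1 }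
  let M : Submonoid G :=
    { carrier := {x | ∃ n, ∀ᶠ N in U, evG N x ∈ (D N).S ^ n}
      mul_mem' := fun {x y} hx hy => by
        obtain ⟨a, ha⟩ := hx
        obtain ⟨b, hb⟩ := hy
        refine ⟨a + b, ?_⟩
        filter_upwards [ha, hb] with N h1 h2
        rw [map_mul, pow_add]; exact Set.mul_mem_mul h1 h2
      one_mem' := ⟨0, Filter.Eventually.of_forall fun N => by rw [map_one]; simp⟩ }
  let eb : Matrix (Fin m) (Fin m) Ω := e.map π
  have hee : e * e = e := by
    apply Matrix.ext
    intro i j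
    apply Subtype.ext
    funext N
    have h1 := (D N).he
    have h2 : (e * e).map (ev v U ρ hρ N) = e.map (ev v U ρ hρ N) := by
      rw [Matrix.map_mul, he]; exact h1
    exact congrFun (congrFun h2 i) j
  have heb : eb * eb = eb := by
    rw [← Matrix.map_mul, hee]
  have hcomm : ∀ c ∈ Comm, (φ c : Matrix (Fin m) (Fin m) Ω) * eb = eb * φ c := by
    intro c hc
    have h0 : (φ c : Matrix (Fin m) (Fin m) Ω) = (c : Matrix (Fin m) (Fin m) (ModR v U ρ hρ)).map π := rfl
    rw [h0, ← Matrix.map_mul, ← Matrix.map_mul]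
    ext i j
    rw [Matrix.map_apply, Matrix.map_apply]
    apply res_congr hπ
    filter_upwards [hc] with N hN
    have h1 := mem_centr.mp hN
    rw [evG_coe] at h1
    have h2 : ((c : Matrix (Fin m) (Fin m) (ModR v U ρ hρ)) * e).map (ev v U ρ hρ N) =
        (e * (c : Matrix (Fin m) (Fin m) (ModR v U ρ hρ))).map (ev v U ρ hρ N) := by
      rw [Matrix.map_mul, Matrix.map_mul, he]; exact h1
    exact congrFun (congrFun h2 i) j
  have hM : ∀ x ∈ M, (1 - eb + eb * (φ x : Matrix (Fin m) (Fin m) Ω) * eb).det ≠ 0 → x ∈ Comm := by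
    rintro x ⟨n, hn⟩ hdet
    by_contra hcon
    have hcon' : ∀ᶠ N in U, ¬ evG N x ∈ centr (D N).e := Ultrafilter.eventually_not.mpr hcon
    let X : Matrix (Fin m) (Fin m) (ModR v U ρ hρ) := x
    let B := 1 - e + e * X * e
    have hB : B.map π = 1 - eb + eb * (φ x : Matrix (Fin m) (Fin m) Ω) * eb := by
      have h0 : (φ x : Matrix (Fin m) (Fin m) Ω) = X.map π := rfl
      simp only [B]
      rw [h0, Matrix.map_add _ (map_add π), Matrix.map_sub _ (map_sub π), Matrix.map_mul, Matrix.map_mul,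
        Matrix.map_one _ (map_zero π) (map_one π)]
    have hdet' : π B.det ≠ 0 := by
      rw [RingHom.map_det]
      have : π.mapMatrix B = B.map π := rfl
      rw [this, hB]; exact hdet
    obtain ⟨y0, hy0⟩ := res_inv hπ hdet'
    let Y := y0 • B.adjugate
    obtain ⟨J1, hJ1⟩ := mat_bd X
    obtain ⟨J2, hJ2⟩ := mat_bd Y
    let J := J1 + J2 + E
    let p' := 8 * J + E + 1
    let p := m * p'
    have hc1 := hlarge (640 * (m + 1) ^ 10 * 4 ^ p)
    have hc2 := hlargeN (n + Qn * p)
    obtain ⟨N, hN1, hN2, hN3, hN4, hN5, hN6, hN7⟩ :=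
      (hn.and (hcon'.and (hy0.and (hJ1.and (hJ2.and (hc1.and hc2)))))).exists
    let d := D N
    let xN : SL m d.L := evG N x
    let yN : Matrix (Fin m) (Fin m) d.L := Y.map (ev v U ρ hρ N)
    have hXN : X.map (ev v U ρ hρ N) = (xN : Matrix (Fin m) (Fin m) d.L) := rfl
    have hBN : B.map (ev v U ρ hρ N) = 1 - d.e + d.e * (xN : Matrix (Fin m) (Fin m) d.L) * d.e := by
      simp only [B]
      rw [Matrix.map_add _ (map_add _), Matrix.map_sub _ (map_sub _), Matrix.map_mul, Matrix.map_mul,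
        Matrix.map_one _ (map_zero _) (map_one _), he, hXN]
    have hy : yN * (1 - d.e + d.e * (xN : Matrix (Fin m) (Fin m) d.L) * d.e) = 1 := by
      rw [← hBN]
      simp only [yN]
      rw [← Matrix.map_mul]
      have : Y * B = (y0 * B.det) • (1 : Matrix (Fin m) (Fin m) (ModR v U ρ hρ)) := by
        simp only [Y]
        rw [smul_mul_assoc, Matrix.adjugate_mul, smul_smul]
      rw [this]
      ext i j
      rw [Matrix.map_apply, Matrix.smul_apply, smul_eq_mul, map_mul, map_mul, hN3, one_mul]
      by_cases hij : i = j <;> simp [hij, Matrix.one_apply]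
    have hρN : 1 ≤ d.ρ := hρ1 N
    have hTle : ∀ i j : ℕ, i ≤ j → d.ρ ^ i ≤ d.ρ ^ j := fun i j h => pow_le_pow_right₀ hρN h
    have be : Bd d.v (d.ρ ^ J) d.e := d.ebd.mono (hTle _ _ (by simp only [J]; omega))
    have bx : Bd d.v (d.ρ ^ J) (xN : Matrix (Fin m) (Fin m) d.L) :=
      Bd.mono hN4 (hTle _ _ (by simp only [J]; omega))
    have bY : Bd d.v (d.ρ ^ J) yN := Bd.mono hN5 (hTle _ _ (by simp only [J]; omega))
    obtain ⟨α, γ, hα, hγ, ba, bg, hab⟩ := d.hαγ p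
    have hκ : 640 * (m + 1) ^ 10 * (d.ρ ^ J) ^ 8 * (α * γ) ≤ 1 := by
      have hqp : d.q ^ p = d.ρ ^ p' := by rw [pow_mul, d.hq]
      rw [hqp] at hab
      have hpos : 0 < d.ρ ^ p' := by positivity
      have h9 : 640 * (m + 1) ^ 10 * (d.ρ ^ J) ^ 8 * (α * γ) * d.ρ ^ p' ≤ 1 * d.ρ ^ p' := by
        calc 640 * (m + 1) ^ 10 * (d.ρ ^ J) ^ 8 * (α * γ) * d.ρ ^ p'
            = 640 * (m + 1) ^ 10 * (d.ρ ^ J) ^ 8 * (α * γ * d.ρ ^ p') := by ring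
          _ ≤ 640 * (m + 1) ^ 10 * (d.ρ ^ J) ^ 8 * (4 ^ p * d.ρ ^ E) := by gcongr
          _ = (640 * (m + 1) ^ 10 * 4 ^ p) * (d.ρ ^ (8 * J + E)) := by ring
          _ ≤ d.ρ * (d.ρ ^ (8 * J + E)) := by gcongr
          _ = 1 * d.ρ ^ p' := by simp only [p']; ring
      exact le_of_mul_le_mul_right h9 hpos
    have hG : ((d.g : Matrix (Fin m) (Fin m) d.L) ^ p) * d.e = d.e * (d.g : Matrix (Fin m) (Fin m) d.L) ^ p :=
      (Commute.pow_right (show Commute d.e (d.g : Matrix (Fin m) (Fin m) d.L) from d.heg) p).eq.symm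
    have hgi : (d.g : Matrix (Fin m) (Fin m) d.L).adjugate * (d.g : Matrix (Fin m) (Fin m) d.L) = 1 := by
      rw [Matrix.adjugate_mul, d.g.2, one_smul]
    have hgi' : (d.g : Matrix (Fin m) (Fin m) d.L) * (d.g : Matrix (Fin m) (Fin m) d.L).adjugate = 1 := by
      rw [Matrix.mul_adjugate, d.g.2, one_smul]
    have hGi : (d.g : Matrix (Fin m) (Fin m) d.L).adjugate ^ p * (d.g : Matrix (Fin m) (Fin m) d.L) ^ p = 1 := by
      have hcg : Commute (d.g : Matrix (Fin m) (Fin m) d.L).adjugate (d.g : Matrix (Fin m) (Fin m) d.L) := by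
        rw [Commute, SemiconjBy, hgi, hgi']
      rw [← hcg.mul_pow, hgi, one_pow]
    have hxdet : (xN : Matrix (Fin m) (Fin m) d.L).det ≠ 0 := by rw [xN.2]; exact one_ne_zero
    have hgp : d.g ^ p ∈ d.S ^ (Qn * p) := by
      rw [pow_mul]; exact Set.pow_mem_pow d.hg
    have hNp : d.S ^ (n + Qn * p) ⊆ d.S ^ N := pow_subset d.one_mem hN7
    have hgpN : d.g ^ p ∈ d.S ^ N := pow_subset d.one_mem (by omega) hgp
    have hgcoe : ((d.g ^ p : SL m d.L) : Matrix (Fin m) (Fin m) d.L) = (d.g : Matrix (Fin m) (Fin m) d.L) ^ p :=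
      Matrix.SpecialLinearGroup.coe_pow _ _
    by_cases hne : (1 - d.e) * (xN : Matrix (Fin m) (Fin m) d.L) * d.e ≠ 0
    · have := pingpong_mat d.v d.e _ _ _ yN _ α γ d.he hG hGi hxdet hy (one_le_pow₀ hρN) hα hγ be bx bY ba bg
        hκ hne
      refine d.nofree (d.g ^ p) hgpN (xN * d.g ^ p) (hNp ?_) ?_
      · rw [pow_add]; exact Set.mul_mem_mul hN1 hgp
      · rw [Matrix.SpecialLinearGroup.coe_mul, hgcoe]; exact this
    · by_cases hne' : d.e * (xN : Matrix (Fin m) (Fin m) d.L) * (1 - d.e) ≠ 0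
      · have := pingpong_mat' d.v d.e _ _ _ yN _ α γ d.he hG hGi hxdet hy (one_le_pow₀ hρN) hα hγ be bx bY ba bg
          hκ hne'
        refine d.nofree (d.g ^ p) hgpN (d.g ^ p * xN) (hNp ?_) ?_
        · rw [add_comm, pow_add]; exact Set.mul_mem_mul hgp hN1
        · rw [Matrix.SpecialLinearGroup.coe_mul, hgcoe]; exact this
      · push Not at hne hne'
        apply hN2
        rw [mem_centr]
        change (xN : Matrix (Fin m) (Fin m) d.L) * d.e = d.e * xN
        rw [sub_mul, sub_mul, one_mul, sub_eq_zero] at hne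
        rw [mul_sub, mul_one, sub_eq_zero] at hne'
        rw [hne]; exact hne'.symm
  have hgrow := fun N => growth (D N).S (D N).fin (D N).one_mem (centr (D N).e) ((m ^ 2 + 1) ^ m)
    ((D N).nc (D N).e (D N).he (D N).e0 (D N).e1)
  obtain ⟨R, hR⟩ : ∃ R, R = (m ^ 2 + 1) ^ m := ⟨_, rfl⟩
  rw [← hR] at hgrow
  choose x hx hxx using hgrow
  have hbd : ∀ i : Fin (R + 1), ∀ᶠ N in U, Bd (v N) (ρ N ^ (3 * R)) ((x N i : SL m (L N)) : Matrix (Fin m) (Fin m) (L N)) := by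
    intro i
    filter_upwards [hlarge (m + 1)] with N hN
    refine (bd_pow_set (one_le_pow₀ (hρ1 N)) (D N).bdS R (x N i) (hx N i)).mono ?_
    rw [pow_mul]
    apply pow_le_pow_left₀ (by have := hρ1 N; positivity)
    calc (m + 1) * (D N).ρ ^ 2 ≤ ρ N * ρ N ^ 2 := by gcongr
      _ = ρ N ^ 3 := by ring
  choose z hz using fun i => of_ev_bd (v := v) (U := U) (ρ := ρ) (hρ := hρ)
    (fun N => ((x N i : SL m (L N)) : Matrix (Fin m) (Fin m) (L N))) (3 * R) (hbd i)
  have hzdet : ∀ i, (z i).det = 1 := by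
    intro i
    apply Subtype.ext
    funext N
    have h1 : ev v U ρ hρ N (z i).det = 1 := by
      rw [RingHom.map_det]
      have : (ev v U ρ hρ N).mapMatrix (z i) = (z i).map (ev v U ρ hρ N) := rfl
      rw [this, hz]
      exact (x N i).2
    exact h1
  let zz : Fin (R + 1) → G := fun i => ⟨z i, hzdet i⟩
  have hfin := core φ Comm eb heb hcomm M hM (R + 1) (fun i => zz i) (by
    intro i
    refine ⟨R, Filter.Eventually.of_forall fun N => ?_⟩
    have : evG N (zz i) = x N i := Subtype.ext (hz i N)
    rw [this]; exact hx N i) (by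
    intro i j hij hmem
    obtain ⟨N, hN⟩ := hmem.exists
    have h1 : evG N (zz i) = x N i := Subtype.ext (hz i N)
    have h2 : evG N (zz j) = x N j := Subtype.ext (hz j N)
    rw [map_mul, map_inv, h1, h2] at hN
    exact hxx N i j hij hN)
  omega

end LD

end

section
namespace LD

theorem normalize {L : Type*} [Field L] {m : ℕ} (v : AbsoluteValue L ℝ) (S : Set (SL m L))
    (hS : S.Finite) (C : ℝ) (hC0 : 0 < C)
    (hC : ∀ h k : Matrix (Fin m) (Fin m) L, h * k = 1 → ∃ s ∈ S, ¬ Bd v C (h * (s : Matrix (Fin m) (Fin m) L) * k)) :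
    ∃ h k : Matrix (Fin m) (Fin m) L, h * k = 1 ∧ ∃ t : L, C ≤ v t ∧
      (∀ s ∈ S, Bd v (v t) (h * (s : Matrix (Fin m) (Fin m) L) * k)) ∧ ∀ h' k' : Matrix (Fin m) (Fin m) L, h' * k' = 1 →
        ∃ s ∈ S, ¬ Bd v (v t / 2) (h' * (h * (s : Matrix (Fin m) (Fin m) L) * k) * k') := by
  have hmax : ∀ h k : Matrix (Fin m) (Fin m) L, h * k = 1 → ∃ t : L, C ≤ v t ∧
      (∀ s ∈ S, Bd v (v t) (h * (s : Matrix (Fin m) (Fin m) L) * k)) ∧ ∃ s ∈ S, ∃ i j, t = (h * (s : Matrix (Fin m) (Fin m) L) * k) i j := by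
    intro h k hk
    obtain ⟨s, hs, hns⟩ := hC h k hk
    simp only [Bd, not_forall, not_le] at hns
    obtain ⟨i, j, hij⟩ := hns
    have hf : (S ×ˢ (Set.univ : Set (Fin m × Fin m))).Finite := hS.prod Set.finite_univ
    obtain ⟨⟨s0, i0, j0⟩, h0, h1⟩ := Set.exists_max_image _
      (fun q : SL m L × Fin m × Fin m => v ((h * (q.1 : Matrix (Fin m) (Fin m) L) * k) q.2.1 q.2.2)) hf
      ⟨(s, i, j), hs, trivial⟩
    refine ⟨_, ?_, ?_, s0, h0.1, i0, j0, rfl⟩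
    · exact hij.le.trans (h1 (s, i, j) ⟨hs, trivial⟩)
    · intro s' hs' i' j'
      exact h1 (s', i', j') ⟨hs', trivial⟩
  by_contra hcon
  push Not at hcon
  obtain ⟨t0, -, ht0, -⟩ := hmax 1 1 (by simp)
  have key : ∀ n : ℕ, ∃ h k : Matrix (Fin m) (Fin m) L, h * k = 1 ∧
      ∀ s ∈ S, Bd v (v t0 / 2 ^ n) (h * (s : Matrix (Fin m) (Fin m) L) * k) := by
    intro n
    induction n with
    | zero => exact ⟨1, 1, by simp, by simpa using ht0⟩
    | succ n ih =>
      obtain ⟨h, k, hk, hb⟩ := ih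
      obtain ⟨t, htC, ht, s0, hs0, i, j, hij⟩ := hmax h k hk
      obtain ⟨h', k', hk', hb'⟩ := hcon h k hk t htC ht
      have hle : v t ≤ v t0 / 2 ^ n := by rw [hij]; exact hb s0 hs0 i j
      refine ⟨h' * h, k * k', ?_, ?_⟩
      · calc h' * h * (k * k') = h' * (h * k) * k' := by simp only [mul_assoc]
          _ = 1 := by rw [hk, mul_one, hk']
      · intro s hs
        have h2 := (hb' s hs).mono (T := v t0 / 2 ^ (n + 1)) (by
          rw [pow_succ, ← div_div]; linarith)
        have e1 : h' * h * (s : Matrix (Fin m) (Fin m) L) * (k * k') =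
            h' * (h * (s : Matrix (Fin m) (Fin m) L) * k) * k' := by simp only [mul_assoc]
        rw [e1]; exact h2
  obtain ⟨n, hn⟩ := pow_unbounded_of_one_lt (v t0 / C) (one_lt_two)
  obtain ⟨h, k, hk, hb⟩ := key n
  obtain ⟨s, hs, hns⟩ := hC h k hk
  apply hns
  refine (hb s hs).mono ?_
  rw [div_lt_iff₀ hC0] at hn
  rw [div_le_iff₀ (by positivity)]
  linarith

/-- the coercion as a monoid hom -/
def coeHom (m : ℕ) (K : Type*) [CommRing K] : SL m K →* Matrix (Fin m) (Fin m) K where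
  toFun x := x
  map_one' := by simp
  map_mul' x y := by simp

/-- **Theorem A**: large displacement at one place gives a free pair. -/
theorem theoremA (m : ℕ) : ∃ (C : ℝ) (N0 : ℕ), 1 ≤ C ∧ ∀ (L : Type) [Field L] [IsAlgClosed L]
    (v : AbsoluteValue L ℝ) (S : Set (SL m L)), S.Finite → (1 : SL m L) ∈ S →
    SpanR ((m ^ 2 + 1) ^ m) (Subgroup.closure S) →
    (∀ h k : Matrix (Fin m) (Fin m) L, h * k = 1 → ∃ s ∈ S, ¬ Bd v C (h * (s : Matrix (Fin m) (Fin m) L) * k)) →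
    ∃ a ∈ S ^ N0, ∃ b ∈ S ^ N0,
      ProjFree L (a : Matrix (Fin m) (Fin m) L) (b : Matrix (Fin m) (Fin m) L) := by
  by_contra hcon
  push Not at hcon
  obtain ⟨Qb, c, T0, hc, hb⟩ := bochi m
  obtain ⟨E, T1, hgap⟩ := gap m (1 + 2 * Qb)
  refine no_data m Qb E ?_
  intro N
  let B : ℝ := max (max 2 N) (max T1 (max c⁻¹ ((m + 1) ^ Qb)))
  have hB2 : 2 ≤ B := (le_max_left _ _).trans (le_max_left _ _)
  have hBN : (N : ℝ) ≤ B := (le_max_right _ _).trans (le_max_left _ _)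
  have hBT : T1 ≤ B := (le_max_left _ _).trans (le_max_right _ _)
  have hBc : c⁻¹ ≤ B := (le_max_left _ _).trans ((le_max_right _ _).trans (le_max_right _ _))
  have hBm : ((m : ℝ) + 1) ^ Qb ≤ B := (le_max_right _ _).trans ((le_max_right _ _).trans (le_max_right _ _))
  let C : ℝ := max 1 (max T0 (B / c))
  have hC1 : 1 ≤ C := le_max_left _ _
  have hCT : T0 ≤ C := (le_max_left _ _).trans (le_max_right _ _)
  have hCB : B / c ≤ C := (le_max_right _ _).trans (le_max_right _ _)
  obtain ⟨L, i1, i2, v, S, hSf, h1S, hspan, hdisp, hfree⟩ := hcon C N hC1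
  obtain ⟨h, k, hk, t, htC, ht1, ht2⟩ := normalize v S hSf C (by linarith) hdisp
  let f := conjHom h k hk
  obtain ⟨q, hq1, hqQ, g, hg, μ, hμ, hμt⟩ := hb L v ((coeHom m L) '' (f '' S)) t (hCT.trans htC) (by
    rintro _ ⟨_, ⟨s, hs, rfl⟩, rfl⟩
    exact ht1 s hs) (by
    intro h' k' hk'
    obtain ⟨s, hs, hns⟩ := ht2 h' k' hk'
    exact ⟨_, ⟨_, ⟨s, hs, rfl⟩, rfl⟩, hns⟩)
  rw [← Set.image_pow] at hg
  obtain ⟨g, hg, rfl⟩ := hg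
  have hvt1 : 1 ≤ v t := hC1.trans htC
  have hvt : c * v t ≤ v μ := by
    refine le_trans ?_ hμt
    gcongr
    exact le_self_pow₀ hvt1 (by omega)
  have hBμ : B ≤ v μ := by
    have h1 : B / c ≤ v t := hCB.trans htC
    rw [div_le_iff₀ hc] at h1
    linarith
  have hμ1 : 1 ≤ v μ := by linarith
  have htμ : v t ≤ v μ ^ 2 := by
    have h1 : v t ≤ v μ * c⁻¹ := by
      rw [← div_eq_mul_inv, le_div_iff₀ hc]; linarith
    have h2 : v μ * c⁻¹ ≤ v μ * v μ := by gcongr; linarith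
    nlinarith
  have hbdS : ∀ s ∈ f '' S, Bd v (v μ ^ 2) (s : Matrix (Fin m) (Fin m) L) := by
    rintro _ ⟨s, hs, rfl⟩
    exact (ht1 s hs).mono htμ
  have h1f : (1 : SL m L) ∈ f '' S := ⟨1, h1S, map_one f⟩
  have hgq : g ∈ (f '' S) ^ Qb := pow_subset h1f hqQ hg
  have hgb : Bd v (v μ ^ (1 + 2 * Qb)) (g : Matrix (Fin m) (Fin m) L) := by
    refine (bd_pow_set (one_le_pow₀ hμ1) hbdS Qb g hgq).mono ?_
    rw [mul_pow, pow_add, pow_one, pow_mul]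
    gcongr
    linarith
  obtain ⟨Q, hQ1, hQm, e, he1, he2, he3, he4, he5, he6⟩ := hgap L v g μ g.2 hμ (hBT.trans hBμ) hgb
  have hnc : NC ((m ^ 2 + 1) ^ m) (Subgroup.closure (f '' S)) := by
    rw [← MonoidHom.map_closure]
    exact hspan.nc.conj h k hk
  refine ⟨⟨L, v, f '' S, hSf.image _, h1f, hnc, v μ, by linarith, by linarith, hbdS, e, he1, he3,
    he4, he5, g, hgq, he2, Q, hQm, he6, ?_⟩⟩
  · intro a ha b hb hab
    rw [← Set.image_pow] at ha hb
    obtain ⟨a, ha, rfl⟩ := ha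
    obtain ⟨b, hb, rfl⟩ := hb
    refine hfree a ha b hb ?_
    refine ProjFree.of_algHom (fun X : Matrix (Fin m) (Fin m) L => h * X * k) ?_ ?_ ?_ hab
    · intro x y
      have hkh : k * h = 1 := mul_eq_one_comm.mp hk
      calc h * (x * y) * k = h * x * 1 * y * k := by simp only [mul_assoc, one_mul]
        _ = h * x * (k * h) * y * k := by rw [hkh]
        _ = (h * x * k) * (h * y * k) := by simp only [mul_assoc]
    · simp [hk]
    · intro c x; simp

end LD

end

section
namespace LD

theorem many_iff {G : Type*} [Group G] (H Γ : Subgroup G) (R : ℕ) :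
    (H.relIndex Γ = 0 ∨ R < H.relIndex Γ) ↔
      ∃ x : Fin (R + 1) → G, (∀ i, x i ∈ Γ) ∧ ∀ i j, i ≠ j → (x i)⁻¹ * x j ∉ H := by
  classical
  constructor
  · intro h
    have hex : Nonempty (Fin (R + 1) ↪ (Γ ⧸ H.subgroupOf Γ)) := by
      rcases h with h | h
      · have : Infinite (Γ ⧸ H.subgroupOf Γ) := by
          rw [Subgroup.relIndex, Subgroup.index, Nat.card_eq_zero] at h
          rcases h with h | h
          · exact (h.false (1 : Γ)).elim
          · exact h
        exact ⟨(Fin.valEmbedding).trans (Infinite.natEmbedding _)⟩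
      · have hc : R < Nat.card (Γ ⧸ H.subgroupOf Γ) := h
        have : Finite (Γ ⧸ H.subgroupOf Γ) := Nat.finite_of_card_ne_zero (by omega)
        have := Fintype.ofFinite (Γ ⧸ H.subgroupOf Γ)
        rw [Nat.card_eq_fintype_card] at hc
        apply Function.Embedding.nonempty_of_card_le
        rw [Fintype.card_fin]; omega
    obtain ⟨f⟩ := hex
    choose x hx using fun i => QuotientGroup.mk_surjective (f i)
    refine ⟨fun i => x i, fun i => (x i).2, fun i j hij hmem => hij (f.injective ?_)⟩
    rw [← hx i, ← hx j]
    exact QuotientGroup.eq.mpr (Subgroup.mem_subgroupOf.mpr hmem)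
  · rintro ⟨x, hx, hxx⟩
    by_contra hcon
    push Not at hcon
    have hc : Nat.card (Γ ⧸ H.subgroupOf Γ) ≤ R := hcon.2
    have hc0 : Nat.card (Γ ⧸ H.subgroupOf Γ) ≠ 0 := hcon.1
    have : Finite (Γ ⧸ H.subgroupOf Γ) := Nat.finite_of_card_ne_zero hc0
    have hinj : Function.Injective
        (fun i : Fin (R + 1) => (QuotientGroup.mk (⟨x i, hx i⟩ : Γ) : Γ ⧸ H.subgroupOf Γ)) := by
      intro i j hij
      by_contra hne
      exact hxx i j hne (Subgroup.mem_subgroupOf.mp (QuotientGroup.eq.mp hij))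
    have := Nat.card_le_card_of_injective _ hinj
    rw [Nat.card_eq_fintype_card, Fintype.card_fin] at this
    omega

theorem pow_subset_closure {G : Type*} [Group G] (S : Set G) (n : ℕ) :
    S ^ n ⊆ (Subgroup.closure S : Set G) := by
  induction n with
  | zero => intro x hx; rw [pow_zero, Set.mem_one] at hx; subst hx; exact one_mem _
  | succ n ih =>
    rw [pow_succ]
    rintro _ ⟨a, ha, b, hb, rfl⟩
    exact mul_mem (ih ha) (Subgroup.subset_closure hb)

theorem reach {G : Type*} [Group G] (S : Set G) (hS : S.Finite) (h1 : (1 : G) ∈ S) (H : Subgroup G)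
    (R : ℕ) (h0 : H.relIndex (Subgroup.closure S) ≠ 0) (hR : H.relIndex (Subgroup.closure S) ≤ R) :
    ∀ g ∈ Subgroup.closure S, ∃ r ∈ S ^ R, g⁻¹ * r ∈ H := by
  rcases growth_aux S hS h1 H R with ⟨x, hx, hxx⟩ | h
  · have := (many_iff H (Subgroup.closure S) R).mpr ⟨x, fun i => pow_subset_closure S R (hx i), hxx⟩
    omega
  · exact h.2.2

/-- a finite set stable under `S` is stable under the group -/
theorem stable_closure {G X : Type*} [Group G] [MulAction G X] (S : Set G) (A : Set X) (hA : A.Finite)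
    (h : ∀ s ∈ S, ∀ a ∈ A, s • a ∈ A) : ∀ g ∈ Subgroup.closure S, ∀ a ∈ A, g • a ∈ A := by
  have hst : Subgroup.closure S ≤ MulAction.stabilizer G A := by
    rw [Subgroup.closure_le]
    intro s hs
    rw [SetLike.mem_coe, MulAction.mem_stabilizer_iff]
    apply Set.eq_of_subset_of_ncard_le _ _ hA
    · rintro _ ⟨a, ha, rfl⟩; exact h s hs a ha
    · rw [Set.ncard_smul_set]
  intro g hg a ha
  have := hst hg
  rw [MulAction.mem_stabilizer_iff] at this
  rw [← this]
  exact Set.smul_mem_smul_set ha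

theorem reach' {G : Type*} [Group G] (S : Set G) (hS : S.Finite) (h1 : (1 : G) ∈ S) (H : Subgroup G)
    (R : ℕ) (h0 : H.relIndex (Subgroup.closure S) ≠ 0) (hR : H.relIndex (Subgroup.closure S) ≤ R) :
    ∀ g ∈ Subgroup.closure S, ∃ u ∈ S ^ R, u * g ∈ H := by
  intro g hg
  have hmem : ∀ x, x ∈ H.map (MulAut.conj g).toMonoidHom ↔ g⁻¹ * x * g ∈ H := by
    intro x
    constructor
    · rintro ⟨y, hy, rfl⟩
      simpa [mul_assoc] using hy
    · intro h
      exact ⟨_, h, by simp [mul_assoc]⟩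
  rcases growth_aux S hS h1 (H.map (MulAut.conj g).toMonoidHom) R with ⟨x, hx, hxx⟩ | h
  · have := (many_iff H (Subgroup.closure S) R).mpr ⟨fun i => x i * g,
      fun i => mul_mem (pow_subset_closure S R (hx i)) hg, fun i j hij hm => hxx i j hij (by
        rw [hmem]
        simpa [mul_assoc] using hm)⟩
    omega
  · obtain ⟨r, hr, hrr⟩ := h.2.2 g⁻¹ (inv_mem hg)
    rw [hmem] at hrr
    exact ⟨r, hr, by simpa [mul_assoc] using hrr⟩

/-- positive Schreier generators -/
theorem schreier {G : Type*} [Group G] (S : Set G) (hS : S.Finite) (h1 : (1 : G) ∈ S) (H : Subgroup G)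
    (hH : H ≤ Subgroup.closure S)
    (R : ℕ) (h0 : H.relIndex (Subgroup.closure S) ≠ 0) (hR : H.relIndex (Subgroup.closure S) ≤ R) :
    Subgroup.closure (S ^ (2 * R + 1) ∩ (H : Set G)) = H := by
  have hreach := reach S hS h1 H R h0 hR
  set H0 := Subgroup.closure (S ^ (2 * R + 1) ∩ (H : Set G)) with hH0
  have hle : H0 ≤ H := (Subgroup.closure_le _).mpr Set.inter_subset_right
  have hsub : ∀ x ∈ S ^ (2 * R + 1), x ∈ H → x ∈ H0 := fun x hx hx' =>
    Subgroup.subset_closure ⟨hx, hx'⟩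
  refine le_antisymm hle ?_
  have hreach' := reach' S hS h1 H R h0 hR
  have hst := stable_closure S ((fun g : G => (g : G ⧸ H0)) '' (S ^ R)) ((finite_pow hS R).image _) (by
    rintro t ht _ ⟨r, hr, rfl⟩
    have hrΓ := pow_subset_closure S R hr
    obtain ⟨r', hr', h2⟩ := hreach (t * r) (mul_mem (Subgroup.subset_closure ht) hrΓ)
    obtain ⟨u, hu, h3⟩ := hreach' r' (pow_subset_closure S R hr')
    refine ⟨r', hr', ?_⟩
    show ((r' : G) : G ⧸ H0) = ((t * r : G) : G ⧸ H0)
    rw [QuotientGroup.eq]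
    have h4 : u * r' ∈ H0 := hsub _ (pow_subset h1 (by omega : R + R ≤ 2 * R + 1) (by
      rw [pow_add]; exact Set.mul_mem_mul hu hr')) h3
    have h5 : u * (t * r) ∈ H0 := hsub _ (by
      rw [show 2 * R + 1 = R + (1 + R) by ring, pow_add, pow_add, pow_one]
      exact Set.mul_mem_mul hu (Set.mul_mem_mul ht hr)) (by
        have := mul_mem h3 (inv_mem h2)
        simpa [mul_assoc] using this)
    have := mul_mem (inv_mem h4) h5
    simpa [mul_assoc] using this)
  intro g hg
  obtain ⟨r, hr, h2⟩ := hst g (hH hg) ((1 : G) : G ⧸ H0) ⟨1, one_mem_pow h1 R, rfl⟩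
  have h3 : ((r : G) : G ⧸ H0) = ((g * 1 : G) : G ⧸ H0) := h2
  rw [mul_one, QuotientGroup.eq] at h3
  have h4 : r ∈ H := by
    have h5 := mul_mem hg (inv_mem (hle h3))
    simpa using h5
  have h6 : r ∈ H0 := hsub r (pow_subset h1 (by omega) hr) h4
  simpa using mul_mem h6 h3

end LD

end

section
namespace LD

/-- iterated commutator subgroups inside the big group -/
def der {G : Type*} [Group G] (H : Subgroup G) : ℕ → Subgroup G
  | 0 => H
  | n + 1 => ⁅der H n, der H n⁆

theorem der_mono {G : Type*} [Group G] {H H' : Subgroup G} (h : H ≤ H') (n : ℕ) : der H n ≤ der H' n := by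
  induction n with
  | zero => exact h
  | succ n ih => exact Subgroup.commutator_mono ih ih

theorem der_succ_le {G : Type*} [Group G] (H : Subgroup G) (n : ℕ) : der H (n + 1) ≤ der H n := by
  show ⁅der H n, der H n⁆ ≤ der H n
  rw [Subgroup.commutator_le]
  intro a ha b hb
  exact mul_mem (mul_mem (mul_mem ha hb) (inv_mem ha)) (inv_mem hb)

theorem der_anti {G : Type*} [Group G] (H : Subgroup G) {n k : ℕ} (h : n ≤ k) : der H k ≤ der H n := by
  induction k, h using Nat.le_induction with
  | base => exact le_rfl
  | succ k _ ih => exact (der_succ_le H k).trans ih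

theorem der_le {G : Type*} [Group G] (H : Subgroup G) (n : ℕ) : der H n ≤ H := der_anti H (Nat.zero_le n)

section
variable {K V G : Type*} [Field K] [AddCommGroup V] [Module K V] [Group G]

/-- virtually solvable action on a subquotient -/
def VS (ρ : G →* Module.End K V) (H : Subgroup G) (W' W : Submodule K V) : Prop :=
  ∃ H1 ≤ H, H1.relIndex H ≠ 0 ∧ ∃ n, ∀ h ∈ der H1 n, ∀ w ∈ W, ρ h w - w ∈ W'

/-- invariance of a subspace -/
def Inv (ρ : G →* Module.End K V) (H : Subgroup G) (W : Submodule K V) : Prop :=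
  ∀ h ∈ H, ∀ w ∈ W, ρ h w ∈ W

theorem Inv.mono {ρ : G →* Module.End K V} {H H' : Subgroup G} {W : Submodule K V} (h : Inv ρ H W)
    (hH : H' ≤ H) : Inv ρ H' W := fun g hg => h g (hH hg)

theorem rho_mul (ρ : G →* Module.End K V) (a b : G) (v : V) : ρ (a * b) v = ρ a (ρ b v) := by
  rw [map_mul]; rfl

theorem rho_inv (ρ : G →* Module.End K V) (a : G) (v : V) : ρ a⁻¹ (ρ a v) = v := by
  rw [← rho_mul, inv_mul_cancel, map_one]; rfl

theorem rho_inv' (ρ : G →* Module.End K V) (a : G) (v : V) : ρ a (ρ a⁻¹ v) = v := by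
  rw [← rho_mul, mul_inv_cancel, map_one]; rfl

/-- elements acting trivially on a subquotient -/
def fixer (ρ : G →* Module.End K V) (H : Subgroup G) (W' W : Submodule K V) (hW' : Inv ρ H W')
    (hW : Inv ρ H W) : Subgroup G where
  carrier := {g | g ∈ H ∧ ∀ w ∈ W, ρ g w - w ∈ W'}
  one_mem' := ⟨one_mem _, fun w _ => by simp⟩
  mul_mem' := by
    rintro a b ⟨ha, ha'⟩ ⟨hb, hb'⟩
    refine ⟨mul_mem ha hb, fun w hw => ?_⟩
    have : ρ (a * b) w - w = ρ a (ρ b w - w) + (ρ a w - w) := by rw [rho_mul, map_sub]; abel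
    rw [this]
    exact add_mem (hW' a ha _ (hb' w hw)) (ha' w hw)
  inv_mem' := by
    rintro a ⟨ha, ha'⟩
    refine ⟨inv_mem ha, fun w hw => ?_⟩
    have : ρ a⁻¹ w - w = - ρ a⁻¹ (ρ a w - w) := by rw [map_sub, rho_inv]; abel
    rw [this]
    exact neg_mem (hW' _ (inv_mem ha) _ (ha' w hw))

theorem VS.split {ρ : G →* Module.End K V} {H : Subgroup G} {W' X W : Submodule K V}
    (hW' : Inv ρ H W') (hX : Inv ρ H X) (hW : Inv ρ H W) (h1 : VS ρ H W' X) (h2 : VS ρ H X W)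
    (hXW : X ≤ W) : VS ρ H W' W := by
  obtain ⟨H1, hH1, hi1, n1, hn1⟩ := h1
  obtain ⟨H2, hH2, hi2, n2, hn2⟩ := h2
  refine ⟨H1 ⊓ H2, inf_le_left.trans hH1, Subgroup.relIndex_inf_ne_zero hi1 hi2, max n1 n2 + 1, ?_⟩
  set N := max n1 n2
  have hle : der (H1 ⊓ H2) (N + 1) ≤ fixer ρ H W' W hW' hW := by
    show ⁅der (H1 ⊓ H2) N, der (H1 ⊓ H2) N⁆ ≤ _
    rw [Subgroup.commutator_le]
    have key : ∀ a ∈ der (H1 ⊓ H2) N, a ∈ H ∧ (∀ w ∈ X, ρ a w - w ∈ W') ∧ ∀ w ∈ W, ρ a w - w ∈ X := by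
      intro a ha
      refine ⟨hH1 (der_le _ _ ha).1, hn1 a (der_anti _ (le_max_left _ _) (der_mono inf_le_left _ ha)),
        hn2 a (der_anti _ (le_max_right _ _) (der_mono inf_le_right _ ha))⟩
    intro h hh g hg
    obtain ⟨hhH, hh1, hh2⟩ := key h hh
    obtain ⟨hgH, hg1, hg2⟩ := key g hg
    refine ⟨mul_mem (mul_mem (mul_mem hhH hgH) (inv_mem hhH)) (inv_mem hgH), fun w hw => ?_⟩
    rw [commutatorElement_def]
    set u := ρ h⁻¹ (ρ g⁻¹ w) with hu
    have huW : u ∈ W := hW _ (inv_mem hhH) _ (hW _ (inv_mem hgH) _ hw)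
    have hwu : w = ρ g (ρ h u) := by rw [hu, rho_inv', rho_inv']
    have h3 : ρ (h * g * h⁻¹ * g⁻¹) w - w = (ρ h (ρ g u - u) - (ρ g u - u)) -
        (ρ g (ρ h u - u) - (ρ h u - u)) := by
      rw [rho_mul, rho_mul, rho_mul, ← hu]
      nth_rewrite 1 [hwu]
      simp only [map_sub]
      abel
    rw [h3]
    exact sub_mem (hh1 _ (hg2 u huW)) (hg1 _ (hh2 u huW))
  intro h hh
  exact (hle hh).2

theorem VS.of_finite {ρ : G →* Module.End K V} {H H' : Subgroup G} {W' W : Submodule K V}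
    (hH : H' ≤ H) (hi : H'.relIndex H ≠ 0) (h : VS ρ H' W' W) : VS ρ H W' W := by
  obtain ⟨H1, hH1, hi1, h2⟩ := h
  exact ⟨H1, hH1.trans hH, Subgroup.relIndex_ne_zero_trans hi1 hi, h2⟩

/-- irreducibility of all subgroups of small index on a subquotient -/
def Irr (ρ : G →* Module.End K V) (R : ℕ) (Γ : Subgroup G) (W' W : Submodule K V) : Prop :=
  ∀ H ≤ Γ, H.relIndex Γ ≠ 0 → H.relIndex Γ ≤ R → ∀ X : Submodule K V, W' ≤ X → X ≤ W →
    Inv ρ H X → X = W' ∨ X = W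

theorem reduce [FiniteDimensional K V] (ρ : G →* Module.End K V) (R n : ℕ) :
    ∀ (T : Set G) (W' W : Submodule K V), T.Finite → (1 : G) ∈ T → W' ≤ W →
      Inv ρ (Subgroup.closure T) W' → Inv ρ (Subgroup.closure T) W →
      Module.finrank K W ≤ Module.finrank K W' + n → ¬ VS ρ (Subgroup.closure T) W' W →
      ∃ T' ⊆ T ^ ((2 * R + 1) ^ n), T'.Finite ∧ (1 : G) ∈ T' ∧ ∃ W1' W1 : Submodule K V, W1' ≤ W1 ∧
        Inv ρ (Subgroup.closure T') W1' ∧ Inv ρ (Subgroup.closure T') W1 ∧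
        ¬ VS ρ (Subgroup.closure T') W1' W1 ∧ Irr ρ R (Subgroup.closure T') W1' W1 := by
  induction n with
  | zero =>
    intro T W' W hT h1 hle hW' hW hfin hVS
    exfalso
    have : W' = W := Submodule.eq_of_le_of_finrank_le hle (by simpa using hfin)
    subst this
    exact hVS ⟨_, le_rfl, by simp, 0, fun h hh w hw => sub_mem (hW h hh w hw) hw⟩
  | succ n ih =>
    intro T W' W hT h1 hle hW' hW hfin hVS
    by_cases hirr : Irr ρ R (Subgroup.closure T) W' W
    · refine ⟨T, ?_, hT, h1, W', W, hle, hW', hW, hVS, hirr⟩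
      have := pow_subset h1 (Nat.one_le_pow (n + 1) (2 * R + 1) (by omega))
      rwa [pow_one] at this
    · unfold Irr at hirr
      push Not at hirr
      obtain ⟨H, hH, hi0, hiR, X, hX1, hX2, hXinv, hne1, hne2⟩ := hirr
      set T1 := T ^ (2 * R + 1) ∩ (H : Set G) with hT1
      have hcl : Subgroup.closure T1 = H := schreier T hT h1 H hH R hi0 hiR
      have hT1f : T1.Finite := (finite_pow hT _).inter_of_left _
      have hT11 : (1 : G) ∈ T1 := ⟨one_mem_pow h1 _, one_mem _⟩
      have hlt1 : Module.finrank K W' < Module.finrank K X :=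
        Submodule.finrank_lt_finrank_of_lt (lt_of_le_of_ne hX1 (Ne.symm hne1))
      have hlt2 : Module.finrank K X < Module.finrank K W :=
        Submodule.finrank_lt_finrank_of_lt (lt_of_le_of_ne hX2 hne2)
      have hfinish : ∀ Y' Y : Submodule K V, Y' ≤ Y → Inv ρ H Y' → Inv ρ H Y →
          Module.finrank K Y ≤ Module.finrank K Y' + n → ¬ VS ρ H Y' Y →
          ∃ T' ⊆ T ^ ((2 * R + 1) ^ (n + 1)), T'.Finite ∧ (1 : G) ∈ T' ∧ ∃ W1' W1 : Submodule K V,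
            W1' ≤ W1 ∧ Inv ρ (Subgroup.closure T') W1' ∧ Inv ρ (Subgroup.closure T') W1 ∧
            ¬ VS ρ (Subgroup.closure T') W1' W1 ∧ Irr ρ R (Subgroup.closure T') W1' W1 := by
        intro Y' Y hY i1 i2 hf hv
        obtain ⟨T', hT', h⟩ := ih T1 Y' Y hT1f hT11 hY (by rwa [hcl]) (by rwa [hcl]) hf (by rwa [hcl])
        refine ⟨T', hT'.trans ?_, h⟩
        rw [pow_succ', pow_mul]
        exact Set.pow_subset_pow_left Set.inter_subset_left
      have hVSH : ¬ VS ρ H W' W := fun h => hVS (h.of_finite hH hi0)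
      by_cases h3 : VS ρ H W' X
      · have h4 : ¬ VS ρ H X W := fun h4 =>
          hVSH (VS.split (hW'.mono hH) hXinv (hW.mono hH) h3 h4 hX2)
        exact hfinish X W hX2 hXinv (hW.mono hH) (by omega) h4
      · exact hfinish W' X hX1 (hW'.mono hH) hXinv (by omega) h3

end

end LD

end

section
namespace LD

section
variable {K V G : Type*} [Field K] [AddCommGroup V] [Module K V] [Group G]

theorem coords [FiniteDimensional K V] (W' W : Submodule K V) :
    ∃ m ≤ Module.finrank K V, ∃ (P : V →ₗ[K] (Fin m → K)) (I : (Fin m → K) →ₗ[K] V),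
      (∀ w ∈ W, P w = 0 ↔ w ∈ W') ∧ (∀ x, I x ∈ W) ∧ ∀ x, P (I x) = x := by
  let Q := W ⧸ (W'.comap W.subtype)
  have hm : Module.finrank K Q ≤ Module.finrank K V :=
    (Submodule.finrank_quotient_le _).trans (Submodule.finrank_le _)
  let e : Q ≃ₗ[K] (Fin (Module.finrank K Q) → K) := (Module.finBasis K Q).equivFun
  obtain ⟨I0, hI0⟩ := LinearMap.exists_rightInverse_of_surjective (W'.comap W.subtype).mkQ
    (Submodule.range_mkQ _)
  obtain ⟨P, hP⟩ := LinearMap.exists_extend (e.toLinearMap ∘ₗ (W'.comap W.subtype).mkQ)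
  have hP' : ∀ w : W, P w = e ((W'.comap W.subtype).mkQ w) := fun w => LinearMap.congr_fun hP w
  refine ⟨_, hm, P, W.subtype ∘ₗ I0 ∘ₗ e.symm.toLinearMap, ?_, ?_, ?_⟩
  · intro w hw
    rw [hP' ⟨w, hw⟩, LinearEquiv.map_eq_zero_iff, Submodule.mkQ_apply,
      Submodule.Quotient.mk_eq_zero]
    rfl
  · intro x; simp
  · intro x
    have h1 := hP' (I0 (e.symm x))
    have h2 : (W'.comap W.subtype).mkQ (I0 (e.symm x)) = e.symm x := LinearMap.congr_fun hI0 _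
    rw [h2, LinearEquiv.apply_symm_apply] at h1
    exact h1

/-- matrix of the action on a subquotient -/
noncomputable def phi {m : ℕ} (ρ : G →* Module.End K V) (P : V →ₗ[K] (Fin m → K))
    (I : (Fin m → K) →ₗ[K] V) (g : G) : Matrix (Fin m) (Fin m) K :=
  LinearMap.toMatrix' (P ∘ₗ ρ g ∘ₗ I)

theorem phi_apply {m : ℕ} (ρ : G →* Module.End K V) (P : V →ₗ[K] (Fin m → K))
    (I : (Fin m → K) →ₗ[K] V) (g : G) (x : Fin m → K) : (phi ρ P I g) *ᵥ x = P (ρ g (I x)) := by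
  rw [phi, LinearMap.toMatrix'_mulVec]; rfl

theorem mat_ext {m : ℕ} {A B : Matrix (Fin m) (Fin m) K} (h : ∀ x, A *ᵥ x = B *ᵥ x) : A = B :=
  Matrix.ext_of_mulVec_single fun i => h _

/-- compatible pairs -/
def relS {m : ℕ} (ρ : G →* Module.End K V) (P : V →ₗ[K] (Fin m → K))
    (I : (Fin m → K) →ₗ[K] V) (Γ : Subgroup G)
    (hmul : ∀ a ∈ Γ, ∀ b ∈ Γ, phi ρ P I (a * b) = phi ρ P I a * phi ρ P I b)
    (hone : phi ρ P I 1 = 1) : Subgroup (SL m K × G) where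
  carrier := {x | x.2 ∈ Γ ∧ ∃ c : K, c ≠ 0 ∧ (x.1 : Matrix (Fin m) (Fin m) K) = c • phi ρ P I x.2}
  one_mem' := ⟨one_mem _, 1, one_ne_zero, by simp [hone]⟩
  mul_mem' := by
    rintro ⟨a, g⟩ ⟨b, h⟩ ⟨hg, c, hc, hac⟩ ⟨hh, c', hc', hbc⟩
    refine ⟨mul_mem hg hh, c * c', mul_ne_zero hc hc', ?_⟩
    simp only at hac hbc hg hh
    show (((a * b : SL m K)) : Matrix (Fin m) (Fin m) K) = _ • phi ρ P I (g * h)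
    rw [Matrix.SpecialLinearGroup.coe_mul, hac, hbc, hmul g hg h hh, smul_mul_smul_comm]
  inv_mem' := by
    rintro ⟨a, g⟩ ⟨hg, c, hc, hac⟩
    refine ⟨inv_mem hg, c⁻¹, inv_ne_zero hc, ?_⟩
    simp only at hac hg
    show ((a⁻¹ : SL m K) : Matrix (Fin m) (Fin m) K) = _ • phi ρ P I g⁻¹
    have h1 : (a : Matrix (Fin m) (Fin m) K) * (c⁻¹ • phi ρ P I g⁻¹) = 1 := by
      rw [hac, smul_mul_smul_comm, ← hmul g hg _ (inv_mem hg), mul_inv_cancel, hone, mul_inv_cancel₀ hc,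
        one_smul]
    have h2 : ((a⁻¹ : SL m K) : Matrix (Fin m) (Fin m) K) * (a : Matrix (Fin m) (Fin m) K) = 1 := by
      rw [← Matrix.SpecialLinearGroup.coe_mul]; simp
    calc ((a⁻¹ : SL m K) : Matrix (Fin m) (Fin m) K)
        = ((a⁻¹ : SL m K) : Matrix (Fin m) (Fin m) K) *
          ((a : Matrix (Fin m) (Fin m) K) * (c⁻¹ • phi ρ P I g⁻¹)) := by rw [h1, mul_one]
      _ = _ := by rw [← mul_assoc, h2, one_mul]

theorem mem_relS {m : ℕ} {ρ : G →* Module.End K V} {P : V →ₗ[K] (Fin m → K)}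
    {I : (Fin m → K) →ₗ[K] V} {Γ : Subgroup G}
    {hmul : ∀ a ∈ Γ, ∀ b ∈ Γ, phi ρ P I (a * b) = phi ρ P I a * phi ρ P I b}
    {hone : phi ρ P I 1 = 1} {x : SL m K × G} : x ∈ relS ρ P I Γ hmul hone ↔
    x.2 ∈ Γ ∧ ∃ c : K, c ≠ 0 ∧ (x.1 : Matrix (Fin m) (Fin m) K) = c • phi ρ P I x.2 := Iff.rfl

theorem span_of_irr [IsAlgClosed K] {m : ℕ} (hm : 0 < m) (H : Subgroup (SL m K))
    (h : ∀ Y : Submodule K (Fin m → K), (∀ γ ∈ H, ∀ y ∈ Y, (γ : Matrix (Fin m) (Fin m) K) *ᵥ y ∈ Y) →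
      Y = ⊥ ∨ Y = ⊤) :
    Submodule.span K ((fun g : SL m K => (g : Matrix (Fin m) (Fin m) K)) '' H) = ⊤ := by
  have : Nonempty (Fin m) := ⟨⟨0, hm⟩⟩
  let T : Set (Matrix (Fin m) (Fin m) K) := (fun g : SL m K => (g : Matrix (Fin m) (Fin m) K)) '' H
  let A : Subalgebra K (Matrix (Fin m) (Fin m) K) := Algebra.adjoin K T
  let e : Matrix (Fin m) (Fin m) K ≃ₐ[K] Module.End K (Fin m → K) := Matrix.toLinAlgEquiv'
  have hb := burnside (A.map e.toAlgHom) (by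
    intro Y hY
    apply h Y
    intro γ hγ y hy
    have h1 : e γ ∈ A.map e.toAlgHom := ⟨γ, Algebra.subset_adjoin ⟨γ, hγ, rfl⟩, rfl⟩
    have h2 := hY _ h1 y hy
    simpa [e] using h2)
  have hA : A = ⊤ := by
    rw [eq_top_iff]
    intro x _
    have hx : e x ∈ A.map e.toAlgHom := by rw [hb]; trivial
    obtain ⟨y, hy, hxy⟩ := hx
    have : y = x := e.injective hxy
    rwa [← this]
  have h3 : Subalgebra.toSubmodule A = Submodule.span K T := by
    show Subalgebra.toSubmodule (Algebra.adjoin K T) = _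
    rw [Algebra.adjoin_eq_span]
    congr 1
    apply le_antisymm
    · intro x hx
      induction hx using Submonoid.closure_induction with
      | mem x hx => exact hx
      | one => exact ⟨1, one_mem _, by simp⟩
      | mul x y _ _ h1 h2 =>
        obtain ⟨a, ha, rfl⟩ := h1
        obtain ⟨b, hb, rfl⟩ := h2
        exact ⟨a * b, mul_mem ha hb, by simp⟩
    · exact Submonoid.subset_closure
  show Submodule.span K T = ⊤
  rw [← h3, hA]
  rfl

set_option maxHeartbeats 1000000 in
theorem to_SL [IsAlgClosed K] [FiniteDimensional K V] (ρ : G →* Module.End K V) (R : ℕ)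
    (T : Set G) (hT : T.Finite) (h1 : (1 : G) ∈ T) (W' W : Submodule K V) (hle : W' ≤ W)
    (hW' : Inv ρ (Subgroup.closure T) W') (hW : Inv ρ (Subgroup.closure T) W)
    (hVS : ¬ VS ρ (Subgroup.closure T) W' W) (hirr : Irr ρ R (Subgroup.closure T) W' W) :
    ∃ m ≤ Module.finrank K V, 0 < m ∧ ∃ S' : Set (SL m K), S'.Finite ∧ (1 : SL m K) ∈ S' ∧
      SpanR R (Subgroup.closure S') ∧ (Subgroup.closure S' : Set (SL m K)).Infinite ∧
      ∀ n, ∀ a ∈ S' ^ n, ∀ b ∈ S' ^ n,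
        ProjFree K (a : Matrix (Fin m) (Fin m) K) (b : Matrix (Fin m) (Fin m) K) →
        ∃ a' ∈ T ^ n, ∃ b' ∈ T ^ n,
          Function.Injective (FreeMonoid.lift ![a', b'] : FreeMonoid (Fin 2) →* G) := by
  classical
  obtain ⟨m, hmle, P, I, hP, hI, hPI⟩ := coords W' W
  set Γ := Subgroup.closure T with hΓ
  have hIP : ∀ w ∈ W, I (P w) - w ∈ W' := by
    intro w hw
    rw [← hP _ (sub_mem (hI _) hw), map_sub, hPI, sub_self]
  have happ : ∀ g ∈ Γ, ∀ w ∈ W, phi ρ P I g *ᵥ P w = P (ρ g w) := by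
    intro g hg w hw
    rw [phi_apply, ← sub_eq_zero, ← map_sub, ← map_sub]
    exact (hP _ (hW g hg _ (sub_mem (hI _) hw))).mpr (hW' g hg _ (hIP w hw))
  have hmul : ∀ a ∈ Γ, ∀ b ∈ Γ, phi ρ P I (a * b) = phi ρ P I a * phi ρ P I b := by
    intro a ha b hb
    apply mat_ext
    intro x
    rw [← Matrix.mulVec_mulVec, phi_apply ρ P I b, happ a ha _ (hW b hb _ (hI _)), phi_apply, rho_mul]
  have hone : phi ρ P I 1 = 1 := by
    apply mat_ext
    intro x
    rw [phi_apply, map_one, Matrix.one_mulVec]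
    exact hPI x
  have hdet : ∀ g ∈ Γ, (phi ρ P I g).det ≠ 0 := by
    intro g hg h0
    have := hmul g hg _ (inv_mem hg)
    rw [mul_inv_cancel, hone] at this
    have h2 := congrArg Matrix.det this
    rw [Matrix.det_one, Matrix.det_mul, h0, zero_mul] at h2
    exact one_ne_zero h2
  have hm : 0 < m := by
    by_contra hm0
    have hm0 : m = 0 := by omega
    subst hm0
    refine hVS ⟨Γ, le_rfl, by simp, 0, fun h hh w hw => ?_⟩
    rw [← hP _ (sub_mem (hW h hh w hw) hw)]
    exact Subsingleton.elim _ _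
  have hnz : NeZero m := ⟨hm.ne'⟩
  -- the lifts
  have hex : ∀ g : G, ∃ a : SL m K, (g = 1 → a = 1) ∧ (g ∈ Γ → ∃ c : K, c ≠ 0 ∧
      (a : Matrix (Fin m) (Fin m) K) = c • phi ρ P I g) := by
    intro g
    by_cases hg1 : g = 1
    · exact ⟨1, fun _ => rfl, fun _ => ⟨1, one_ne_zero, by rw [hg1, hone]; simp⟩⟩
    by_cases hg : g ∈ Γ
    · obtain ⟨c, hc⟩ := IsAlgClosed.exists_pow_nat_eq ((phi ρ P I g).det)⁻¹ hm
      have hc0 : c ≠ 0 := by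
        rintro rfl
        rw [zero_pow hm.ne'] at hc
        exact inv_ne_zero (hdet g hg) hc.symm
      refine ⟨⟨c • phi ρ P I g, ?_⟩, fun h => (hg1 h).elim, fun _ => ⟨c, hc0, rfl⟩⟩
      rw [Matrix.det_smul, Fintype.card_fin, hc, inv_mul_cancel₀ (hdet g hg)]
    · exact ⟨1, fun _ => rfl, fun h => (hg h).elim⟩
  choose ψ hψ1 hψ using hex
  set S' := ψ '' T with hS'
  set Γ' := Subgroup.closure S' with hΓ'
  obtain ⟨Q, mem_relS⟩ : ∃ Q : Subgroup (SL m K × G), ∀ {x : SL m K × G}, x ∈ Q ↔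
      x.2 ∈ Γ ∧ ∃ c : K, c ≠ 0 ∧ (x.1 : Matrix (Fin m) (Fin m) K) = c • phi ρ P I x.2 :=
    ⟨relS ρ P I Γ hmul hone, mem_relS⟩
  have qmul : ∀ {a b : SL m K} {g h : G}, (a, g) ∈ Q → (b, h) ∈ Q → (a * b, g * h) ∈ Q :=
    fun ha hb => Q.mul_mem ha hb
  have qinv : ∀ {a : SL m K} {g : G}, (a, g) ∈ Q → (a⁻¹, g⁻¹) ∈ Q := fun ha => Q.inv_mem ha
  have qone : ((1 : SL m K), (1 : G)) ∈ Q := Q.one_mem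
  have hψQ : ∀ g ∈ Γ, (ψ g, g) ∈ Q := fun g hg => mem_relS.mpr ⟨hg, hψ g hg⟩
  have hup : ∀ γ ∈ Γ', ∃ g ∈ Γ, (γ, g) ∈ Q := by
    intro γ hγ
    induction hγ using Subgroup.closure_induction with
    | mem x hx =>
      obtain ⟨t, ht, rfl⟩ := hx
      have := Subgroup.subset_closure ht
      exact ⟨t, this, hψQ t this⟩
    | one => exact ⟨1, one_mem _, qone⟩
    | mul x y _ _ hx hy =>
      obtain ⟨g, hg, hgQ⟩ := hx
      obtain ⟨h, hh, hhQ⟩ := hy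
      exact ⟨g * h, mul_mem hg hh, qmul hgQ hhQ⟩
    | inv x _ hx =>
      obtain ⟨g, hg, hgQ⟩ := hx
      exact ⟨g⁻¹, inv_mem hg, qinv hgQ⟩
  have hdown : ∀ g ∈ Γ, ∃ γ ∈ Γ', (γ, g) ∈ Q := by
    intro g hg
    induction hg using Subgroup.closure_induction with
    | mem x hx =>
      exact ⟨ψ x, Subgroup.subset_closure ⟨x, hx, rfl⟩, hψQ x (Subgroup.subset_closure hx)⟩
    | one => exact ⟨1, one_mem _, qone⟩
    | mul x y _ _ hx hy =>
      obtain ⟨g, hg, hgQ⟩ := hx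
      obtain ⟨h, hh, hhQ⟩ := hy
      exact ⟨g * h, mul_mem hg hh, qmul hgQ hhQ⟩
    | inv x _ hx =>
      obtain ⟨g, hg, hgQ⟩ := hx
      exact ⟨g⁻¹, inv_mem hg, qinv hgQ⟩
  refine ⟨m, hmle, hm, S', hT.image _, ⟨1, h1, hψ1 1 rfl⟩, ?_, ?_, ?_⟩
  · -- spanning
    intro H' hH' hi0 hiR
    apply span_of_irr hm
    intro Y hY
    let H : Subgroup G := (Q ⊓ H'.prod ⊤).map (MonoidHom.snd _ _)
    have hHmem : ∀ g, g ∈ H ↔ ∃ γ ∈ H', (γ, g) ∈ Q := by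
      intro g
      constructor
      · rintro ⟨⟨γ, g'⟩, ⟨hq, hp⟩, rfl⟩
        exact ⟨γ, hp.1, hq⟩
      · rintro ⟨γ, hγ, hq⟩
        exact ⟨(γ, g), ⟨hq, hγ, trivial⟩, rfl⟩
    have hHΓ : H ≤ Γ := by
      intro g hg
      obtain ⟨γ, _, hq⟩ := (hHmem g).mp hg
      exact (mem_relS.mp hq).1
    have hnot : ¬ (H.relIndex Γ = 0 ∨ R < H.relIndex Γ) := by
      rw [many_iff]
      rintro ⟨x, hx, hxx⟩
      choose γ hγ hγQ using fun i => hdown (x i) (hx i)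
      have := (many_iff H' Γ' R).mpr ⟨γ, hγ, fun i j hij hmem => hxx i j hij
        ((hHmem _).mpr ⟨_, hmem, qmul (qinv (hγQ i)) (hγQ j)⟩)⟩
      rcases this with h | h
      · exact hi0 h
      · exact absurd h (not_lt.mpr hiR)
    push Not at hnot
    have hXI : Inv ρ H (W ⊓ Y.comap P) := by
      intro g hg w hw
      have hgΓ := hHΓ hg
      obtain ⟨γ, hγ, hq⟩ := (hHmem g).mp hg
      obtain ⟨_, c, hc, hcγ⟩ := mem_relS.mp hq
      refine ⟨hW g hgΓ w hw.1, ?_⟩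
      have h5 := hY γ hγ (P w) hw.2
      simp only at hcγ
      rw [hcγ, Matrix.smul_mulVec, happ g hgΓ w hw.1] at h5
      exact (Submodule.smul_mem_iff Y hc).mp h5
    rcases hirr H hHΓ hnot.1 hnot.2 (W ⊓ Y.comap P) (le_inf hle (by
        intro w hw
        show P w ∈ Y
        rw [(hP w (hle hw)).mpr hw]
        exact zero_mem _)) inf_le_left hXI with h6 | h6
    · left
      rw [eq_bot_iff]
      intro y hy
      have h7 : I y ∈ W ⊓ Y.comap P := ⟨hI y, by show P (I y) ∈ Y; rwa [hPI]⟩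
      rw [h6, ← hP _ (hI y), hPI] at h7
      exact h7
    · right
      rw [eq_top_iff]
      intro y _
      have h7 : I y ∈ W ⊓ Y.comap P := by rw [h6]; exact hI y
      have h8 : P (I y) ∈ Y := h7.2
      rwa [hPI] at h8
  · -- infinite
    intro hfin
    apply hVS
    let H1 : Subgroup G := (Q ⊓ (Subgroup.prod (⊥ : Subgroup (SL m K)) ⊤)).map (MonoidHom.snd _ _)
    have hH1mem : ∀ g, g ∈ H1 ↔ ((1 : SL m K), g) ∈ Q := by
      intro g
      constructor
      · rintro ⟨⟨γ, g'⟩, ⟨hq, hp⟩, rfl⟩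
        have h2 : γ = 1 := hp.1
        rw [h2] at hq
        exact hq
      · intro hq
        exact ⟨(1, g), ⟨hq, rfl, trivial⟩, rfl⟩
    have hH1Γ : H1 ≤ Γ := by
      intro g hg
      exact (mem_relS.mp ((hH1mem g).mp hg)).1
    have hidx : H1.relIndex Γ ≠ 0 := by
      intro h0
      obtain ⟨x, hx, hxx⟩ := (many_iff H1 Γ (Nat.card Γ')).mp (Or.inl h0)
      choose γ hγ hγQ using fun i => hdown (x i) (hx i)
      have : Finite Γ' := hfin
      have hninj : ¬ Function.Injective (fun i => (⟨γ i, hγ i⟩ : Γ')) := by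
        intro hinj
        have := Nat.card_le_card_of_injective _ hinj
        rw [Nat.card_eq_fintype_card (α := Fin _), Fintype.card_fin] at this
        omega
      unfold Function.Injective at hninj
      push Not at hninj
      obtain ⟨i, j, hij, hne⟩ := hninj
      have hij' : γ i = γ j := congrArg Subtype.val hij
      apply hxx i j hne
      rw [hH1mem]
      have := qmul (qinv (hγQ i)) (hγQ j)
      rw [hij'] at this
      simpa using this
    refine ⟨H1, hH1Γ, hidx, 1, ?_⟩
    have hsc : ∀ g ∈ H1, ∃ c : K, c ≠ 0 ∧ phi ρ P I g = c • 1 := by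
      intro g hg
      obtain ⟨_, c, hc, h2⟩ := mem_relS.mp ((hH1mem g).mp hg)
      simp only [Matrix.SpecialLinearGroup.coe_one] at h2
      exact ⟨c⁻¹, inv_ne_zero hc, by rw [h2, smul_smul, inv_mul_cancel₀ hc, one_smul]⟩
    have hle2 : der H1 1 ≤ fixer ρ Γ W' W hW' hW := by
      show ⁅H1, H1⁆ ≤ _
      rw [Subgroup.commutator_le]
      intro a ha b hb
      obtain ⟨c, hc, hac⟩ := hsc a ha
      obtain ⟨c', hc', hbc⟩ := hsc b hb
      have haΓ := hH1Γ ha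
      have hbΓ := hH1Γ hb
      have habΓ : a * b * a⁻¹ * b⁻¹ ∈ Γ := mul_mem (mul_mem (mul_mem haΓ hbΓ) (inv_mem haΓ)) (inv_mem hbΓ)
      have h3 : phi ρ P I (a * b * a⁻¹ * b⁻¹) = 1 := by
        have h4 : phi ρ P I ((a * b * a⁻¹ * b⁻¹) * (b * a)) = phi ρ P I (a * b) := by
          congr 1
          group
        rw [hmul _ habΓ _ (mul_mem hbΓ haΓ), hmul b hbΓ a haΓ, hmul a haΓ b hbΓ, hac, hbc,
          smul_mul_smul_comm, smul_mul_smul_comm, mul_comm c' c, one_mul, mul_smul_comm, mul_one] at h4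
        exact smul_right_injective _ (mul_ne_zero hc hc') h4
      refine ⟨habΓ, fun w hw => ?_⟩
      rw [commutatorElement_def]
      rw [← hP _ (sub_mem (hW _ habΓ _ hw) hw), map_sub, ← happ _ habΓ w hw, h3, Matrix.one_mulVec,
        sub_self]
    intro h hh
    exact (hle2 hh).2
  · -- lifting free pairs
    have hpow : ∀ n, ∀ a ∈ S' ^ n, ∃ g ∈ T ^ n, (a, g) ∈ Q := by
      intro n
      induction n with
      | zero =>
        intro a ha
        rw [pow_zero, Set.mem_one] at ha
        exact ⟨1, by simp, by rw [ha]; exact qone⟩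
      | succ n ih =>
        intro a ha
        rw [pow_succ] at ha
        obtain ⟨b, hb, _, ⟨t, ht, rfl⟩, rfl⟩ := ha
        obtain ⟨g, hg, hq⟩ := ih b hb
        refine ⟨g * t, ?_, qmul hq (hψQ t (Subgroup.subset_closure ht))⟩
        rw [pow_succ]
        exact Set.mul_mem_mul hg ht
    intro n a ha b hb hfree
    obtain ⟨a', ha', haQ⟩ := hpow n a ha
    obtain ⟨b', hb', hbQ⟩ := hpow n b hb
    refine ⟨a', ha', b', hb', ?_⟩
    have hw : ∀ w : FreeMonoid (Fin 2), (FreeMonoid.lift ![a, b] w, FreeMonoid.lift ![a', b'] w) ∈ Q := by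
      intro w
      induction w using FreeMonoid.inductionOn with
      | one => simpa using qone
      | of x =>
        fin_cases x
        · simpa using haQ
        · simpa using hbQ
      | mul x y hx hy =>
        rw [map_mul, map_mul]
        exact qmul hx hy
    have hcoe : ∀ w : FreeMonoid (Fin 2), ((FreeMonoid.lift ![a, b] w : SL m K) :
        Matrix (Fin m) (Fin m) K) = FreeMonoid.lift ![(a : Matrix (Fin m) (Fin m) K),
          (b : Matrix (Fin m) (Fin m) K)] w := by
      intro w
      induction w using FreeMonoid.inductionOn with
      | one => simp
      | of x => fin_cases x <;> simp
      | mul x y hx hy => rw [map_mul, map_mul, Matrix.SpecialLinearGroup.coe_mul, hx, hy]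
    intro w w' hww
    obtain ⟨_, c, hc, hcw⟩ := mem_relS.mp (hw w)
    obtain ⟨_, c', hc', hcw'⟩ := mem_relS.mp (hw w')
    simp only at hcw hcw'
    refine hfree w w' (c * c'⁻¹) (mul_ne_zero hc (inv_ne_zero hc')) ?_
    rw [← hcoe, ← hcoe, hcw, hcw', hww, smul_smul, mul_assoc, inv_mul_cancel₀ hc', mul_one]

end

end LD

end

section
namespace LD

theorem ext_hom {R K L : Type} [CommRing R] [IsDomain R] [Countable R] [Field K] [Countable K] [Field L]
    [IsAlgClosed L] [Uncountable L] (f : R →+* K) (g : R →+* L) (hf : Function.Injective f)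
    (hg : Function.Injective g) : ∃ σ : K →+* L, σ.comp f = g := by
  algebraize [f, g]
  have : FaithfulSMul R K := (faithfulSMul_iff_algebraMap_injective R K).mpr hf
  have : FaithfulSMul R L := (faithfulSMul_iff_algebraMap_injective R L).mpr hg
  obtain ⟨s, hs⟩ := exists_isTranscendenceBasis R K
  obtain ⟨t, ht⟩ := exists_isTranscendenceBasis R L
  have hcard := IsAlgClosed.cardinal_eq_cardinal_transcendence_basis_of_aleph0_lt' _ ht
    (Cardinal.mk_le_aleph0) (Cardinal.aleph0_lt_mk)
  have hle : Cardinal.mk s ≤ Cardinal.mk t := by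
    rw [← hcard]
    exact (Cardinal.mk_le_aleph0 (α := s)).trans (Cardinal.aleph0_lt_mk (α := L)).le
  obtain ⟨e⟩ := hle
  have hind : AlgebraicIndependent R (fun i : s => ((e i : t) : L)) := ht.1.comp e e.injective
  let A := Algebra.adjoin R (Set.range ((↑) : s → K))
  let φ : A →ₐ[R] L := (MvPolynomial.aeval (fun i : s => ((e i : t) : L))).comp
    hs.1.aevalEquiv.symm.toAlgHom
  have hφ : Function.Injective φ := by
    intro x y hxy
    exact hs.1.aevalEquiv.symm.injective (hind hxy)
  have : Algebra.IsAlgebraic A K := hs.isAlgebraic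
  letI : Algebra A L := φ.toRingHom.toAlgebra
  have hA : FaithfulSMul A L := (faithfulSMul_iff_algebraMap_injective A L).mpr hφ
  have hT : IsScalarTower R A L := IsScalarTower.of_algebraMap_eq (fun r => (φ.commutes r).symm)
  let σ : K →ₐ[A] L := IsAlgClosed.lift
  refine ⟨σ.toRingHom, ?_⟩
  ext r
  show σ (algebraMap R K r) = algebraMap R L r
  rw [IsScalarTower.algebraMap_apply R A K, σ.commutes, ← IsScalarTower.algebraMap_apply R A L]

theorem ext_transc {F K L : Type} [Field F] [Countable F] [Field K] [Countable K] [Field L]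
    [IsAlgClosed L] [Uncountable L] [Algebra F K] [Algebra F L] (z : K) (w : L)
    (hz : Transcendental F z) (hw : Transcendental F w) :
    ∃ σ : K →+* L, σ z = w := by
  have : Countable (Polynomial F) := by
    rw [← Cardinal.mk_le_aleph0_iff]
    exact Polynomial.cardinalMk_le_max.trans (max_le (Cardinal.mk_le_aleph0) le_rfl)
  obtain ⟨σ, hσ⟩ := ext_hom (Polynomial.aeval z : Polynomial F →ₐ[F] K).toRingHom
    (Polynomial.aeval w : Polynomial F →ₐ[F] L).toRingHom
    (transcendental_iff_injective.mp hz) (transcendental_iff_injective.mp hw)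
  refine ⟨σ, ?_⟩
  have := RingHom.congr_fun hσ Polynomial.X
  simpa using this

theorem ext_alg {F K L : Type} [Field F] [Countable F] [Field K] [Countable K] [Field L]
    [IsAlgClosed L] [Uncountable L] [Algebra F K] [Algebra F L] (z : K) (w : L)
    (hz : IsIntegral F z) (hw : Polynomial.aeval w (minpoly F z) = 0) :
    ∃ σ : K →+* L, σ z = w := by
  have : Countable (Polynomial F) := by
    rw [← Cardinal.mk_le_aleph0_iff]
    exact Polynomial.cardinalMk_le_max.trans (max_le (Cardinal.mk_le_aleph0) le_rfl)
  have : Fact (Irreducible (minpoly F z)) := ⟨minpoly.irreducible hz⟩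
  have : Countable (AdjoinRoot (minpoly F z)) := AdjoinRoot.mk_surjective.countable
  obtain ⟨σ, hσ⟩ := ext_hom
    (AdjoinRoot.lift (algebraMap F K) z (by rw [← Polynomial.aeval_def]; exact minpoly.aeval F z) :
      AdjoinRoot (minpoly F z) →+* K)
    (AdjoinRoot.lift (algebraMap F L) w (by rw [← Polynomial.aeval_def]; exact hw))
    (RingHom.injective _) (RingHom.injective _)
  refine ⟨σ, ?_⟩
  have := RingHom.congr_fun hσ (AdjoinRoot.root _)
  simpa using this

end LD

end

section
namespace LD

/-- the conclusion of theorem A with given constants -/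
def ThA (m : ℕ) (C : ℝ) (N0 : ℕ) : Prop := ∀ (L : Type) [Field L] [IsAlgClosed L]
    (v : AbsoluteValue L ℝ) (S : Set (SL m L)), S.Finite → (1 : SL m L) ∈ S →
    SpanR ((m ^ 2 + 1) ^ m) (Subgroup.closure S) →
    (∀ h k : Matrix (Fin m) (Fin m) L, h * k = 1 → ∃ s ∈ S, ¬ Bd v C (h * (s : Matrix (Fin m) (Fin m) L) * k)) →
    ∃ a ∈ S ^ N0, ∃ b ∈ S ^ N0,
      ProjFree L (a : Matrix (Fin m) (Fin m) L) (b : Matrix (Fin m) (Fin m) L)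

/-- there is a free pair -/
def HasFree {m : ℕ} {K : Type} [Field K] (S : Set (SL m K)) (N : ℕ) : Prop :=
  ∃ a ∈ S ^ N, ∃ b ∈ S ^ N,
      ProjFree K (a : Matrix (Fin m) (Fin m) K) (b : Matrix (Fin m) (Fin m) K)

/-- map on special linear groups -/
abbrev slMap (m : ℕ) {K L : Type} [Field K] [Field L] (σ : K →+* L) : SL m K →* SL m L :=
  Matrix.SpecialLinearGroup.map σ

theorem slMap_coe {m : ℕ} {K L : Type} [Field K] [Field L] (σ : K →+* L) (g : SL m K) :
    ((slMap m σ g : SL m L) : Matrix (Fin m) (Fin m) L) = (g : Matrix (Fin m) (Fin m) K).map σ := rfl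

theorem slMap_inj {m : ℕ} {K L : Type} [Field K] [Field L] (σ : K →+* L) :
    Function.Injective (slMap m σ) := by
  intro a b h
  have h2 := congrArg Subtype.val h
  apply Subtype.ext
  exact Matrix.map_injective σ.injective h2

theorem SpanR.map {m : ℕ} {K L : Type} [Field K] [Field L] (σ : K →+* L) {R : ℕ} {Γ : Subgroup (SL m K)}
    (h : SpanR R Γ) : SpanR R (Γ.map (slMap m σ)) := by
  intro H' hH' h0 hR
  have hnot : ¬ ((H'.comap (slMap m σ) ⊓ Γ).relIndex Γ = 0 ∨ R < (H'.comap (slMap m σ) ⊓ Γ).relIndex Γ) := by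
    rw [many_iff]
    rintro ⟨x, hx, hxx⟩
    have := (many_iff H' (Γ.map (slMap m σ)) R).mpr ⟨fun i => slMap m σ (x i),
      fun i => ⟨x i, hx i, rfl⟩, fun i j hij hmem => hxx i j hij ⟨by
        rw [← map_inv, ← map_mul] at hmem
        exact hmem, Γ.mul_mem (Γ.inv_mem (hx i)) (hx j)⟩⟩
    omega
  push Not at hnot
  have hs := h _ inf_le_right hnot.1 hnot.2
  have key : ∀ x : Matrix (Fin m) (Fin m) K, x.map σ ∈ Submodule.span L
      ((fun g : SL m L => (g : Matrix (Fin m) (Fin m) L)) '' H') := by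
    intro x
    have hx : x ∈ Submodule.span K ((fun g : SL m K => (g : Matrix (Fin m) (Fin m) K)) ''
        (H'.comap (slMap m σ) ⊓ Γ : Subgroup (SL m K))) := by rw [hs]; trivial
    induction hx using Submodule.span_induction with
    | mem x hx =>
      obtain ⟨g, hg, rfl⟩ := hx
      exact Submodule.subset_span ⟨slMap m σ g, hg.1, rfl⟩
    | zero =>
      rw [Matrix.map_zero _ (map_zero σ)]
      exact zero_mem _
    | add x y _ _ h1 h2 =>
      rw [Matrix.map_add _ (map_add σ)]
      exact add_mem h1 h2
    | smul c x _ h1 =>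
      have : (c • x).map σ = σ c • x.map σ := by
        ext i j; simp
      rw [this]
      exact Submodule.smul_mem _ _ h1
  rw [eq_top_iff]
  intro x _
  rw [Matrix.matrix_eq_sum_single x]
  refine sum_mem fun i _ => sum_mem fun j _ => ?_
  have : Matrix.single i j (x i j) = x i j • (Matrix.single i j (1 : K)).map σ := by
    rw [Matrix.map_single, map_one, Matrix.smul_single, smul_eq_mul, mul_one]
  rw [this]
  exact Submodule.smul_mem _ _ (key _)

theorem ProjFree.of_map {m : ℕ} {K L : Type} [Field K] [Field L] (σ : K →+* L)
    {a b : Matrix (Fin m) (Fin m) K} (h : ProjFree L (a.map σ) (b.map σ)) : ProjFree K a b := by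
  have hl : ∀ w : FreeMonoid (Fin 2), (FreeMonoid.lift ![a, b] w).map σ =
      FreeMonoid.lift ![a.map σ, b.map σ] w := by
    intro w
    induction w using FreeMonoid.inductionOn with
    | one => simp
    | of x => fin_cases x <;> simp
    | mul x y hx hy => rw [map_mul, map_mul, Matrix.map_mul, hx, hy]
  intro w w' c hc hw
  refine h w w' (σ c) (by simpa using hc) ?_
  rw [← hl, ← hl, hw]
  ext i j; simp

theorem HasFree.of_map {m : ℕ} {K L : Type} [Field K] [Field L] (σ : K →+* L) {S : Set (SL m K)} {N : ℕ}
    (h : HasFree (slMap m σ '' S) N) : HasFree S N := by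
  obtain ⟨a, ha, b, hb, hab⟩ := h
  rw [← Set.image_pow] at ha hb
  obtain ⟨a, ha, rfl⟩ := ha
  obtain ⟨b, hb, rfl⟩ := hb
  exact ⟨a, ha, b, hb, ProjFree.of_map σ hab⟩

/-- theorem A through an embedding -/
theorem ThA.apply {m : ℕ} {C : ℝ} {N0 : ℕ} (hA : ThA m C N0) {K L : Type} [Field K] [Field L]
    [IsAlgClosed L] (σ : K →+* L) (v : AbsoluteValue L ℝ) {S : Set (SL m K)} (hS : S.Finite)
    (h1 : (1 : SL m K) ∈ S) (hspan : SpanR ((m ^ 2 + 1) ^ m) (Subgroup.closure S))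
    (hfree : ¬ HasFree S N0) :
    ∃ h k : Matrix (Fin m) (Fin m) L, h * k = 1 ∧
      ∀ s ∈ S, Bd v C (h * (s : Matrix (Fin m) (Fin m) K).map σ * k) := by
  by_contra hcon
  push Not at hcon
  apply hfree
  apply HasFree.of_map σ
  apply hA L v (slMap m σ '' S) (hS.image _) ⟨1, h1, map_one _⟩
  · rw [← MonoidHom.map_closure]
    exact hspan.map σ
  · intro h k hk
    obtain ⟨s, hs, hs'⟩ := hcon h k hk
    exact ⟨slMap m σ s, ⟨s, hs, rfl⟩, hs'⟩

theorem bd_closure {m : ℕ} (C : ℝ) (hC : 1 ≤ C) {K L : Type} [Field K] [Field L] (σ : K →+* L)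
    {S : Set (SL m K)} : ∀ γ ∈ Subgroup.closure S, ∃ D : ℝ, 1 ≤ D ∧ ∀ (v : AbsoluteValue L ℝ)
      (h k : Matrix (Fin m) (Fin m) L), h * k = 1 →
      (∀ s ∈ S, Bd v C (h * (s : Matrix (Fin m) (Fin m) K).map σ * k)) →
      Bd v D (h * (γ : Matrix (Fin m) (Fin m) K).map σ * k) := by
  intro γ hγ
  induction hγ using Subgroup.closure_induction with
  | mem x hx => exact ⟨C, hC, fun v h k hk hs => hs x hx⟩
  | one =>
    refine ⟨1, le_rfl, fun v h k hk hs => ?_⟩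
    rw [Matrix.SpecialLinearGroup.coe_one, Matrix.map_one _ (map_zero σ) (map_one σ), mul_one, hk]
    exact Bd.one
  | mul x y _ _ hx hy =>
    obtain ⟨D, hD, hx⟩ := hx
    obtain ⟨D', hD', hy⟩ := hy
    refine ⟨max 1 (m * (D * D')), le_max_left _ _, fun v h k hk hs => ?_⟩
    have hkh : k * h = 1 := mul_eq_one_comm.mp hk
    have h3 := (hx v h k hk hs).mul (hy v h k hk hs) (by linarith)
    have h4 : h * (x : Matrix (Fin m) (Fin m) K).map σ * k * (h * (y : Matrix (Fin m) (Fin m) K).map σ * k)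
        = h * ((x * y : SL m K) : Matrix (Fin m) (Fin m) K).map σ * k := by
      rw [Matrix.SpecialLinearGroup.coe_mul, Matrix.map_mul]
      calc h * (x : Matrix (Fin m) (Fin m) K).map σ * k * (h * (y : Matrix (Fin m) (Fin m) K).map σ * k)
          = h * (x : Matrix (Fin m) (Fin m) K).map σ * (k * h) * (y : Matrix (Fin m) (Fin m) K).map σ * k := by
            simp only [mul_assoc]
        _ = _ := by rw [hkh, mul_one]; simp only [mul_assoc]
    rw [h4] at h3
    exact h3.mono (le_max_right _ _)
  | inv x _ hx =>
    obtain ⟨D, hD, hx⟩ := hx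
    refine ⟨max 1 ((m.factorial : ℝ) * D ^ m), le_max_left _ _, fun v h k hk hs => ?_⟩
    have h3 := (hx v h k hk hs).adjugate hD
    have h4 : (h * (x : Matrix (Fin m) (Fin m) K).map σ * k).adjugate =
        h * ((x⁻¹ : SL m K) : Matrix (Fin m) (Fin m) K).map σ * k := by
      have e1 := Matrix.SpecialLinearGroup.coe_inv (conjHom h k hk (slMap m σ x))
      rw [← map_inv, ← map_inv, conjHom_coe, conjHom_coe] at e1
      exact e1.symm
    rw [h4] at h3
    exact h3.mono (le_max_right _ _)

/-- powers of a nonarchimedean absolute value -/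
noncomputable def vpow {L : Type} [Field L] (v : AbsoluteValue L ℝ)
    (hv : ∀ x y, v (x + y) ≤ max (v x) (v y)) (n : ℕ) (hn : n ≠ 0) : AbsoluteValue L ℝ where
  toFun x := v x ^ n
  map_mul' x y := by rw [map_mul, mul_pow]
  nonneg' x := pow_nonneg (v.nonneg x) n
  eq_zero' x := by simp [hn]
  add_le' x y := by
    have h1 := pow_le_pow_left₀ (v.nonneg _) (hv x y) n
    have h2 := pow_nonneg (v.nonneg x) n
    have h3 := pow_nonneg (v.nonneg y) n
    rcases max_choice (v x) (v y) with h | h <;> rw [h] at h1 <;> linarith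

theorem nonarch_trace {m : ℕ} {C : ℝ} {N0 : ℕ} (hC : 1 ≤ C) (hA : ThA m C N0) {K L : Type} [Field K] [Field L]
    [IsAlgClosed L] (σ : K →+* L) (v : AbsoluteValue L ℝ) (hv : ∀ x y, v (x + y) ≤ max (v x) (v y))
    {S : Set (SL m K)} (hS : S.Finite)
    (h1 : (1 : SL m K) ∈ S) (hspan : SpanR ((m ^ 2 + 1) ^ m) (Subgroup.closure S))
    (hfree : ¬ HasFree S N0) (γ : SL m K) (hγ : γ ∈ Subgroup.closure S) :
    v (σ (γ : Matrix (Fin m) (Fin m) K).trace) ≤ 1 := by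
  obtain ⟨D, hD, hb⟩ := bd_closure C hC σ γ hγ
  have key : ∀ n : ℕ, n ≠ 0 → v (σ (γ : Matrix (Fin m) (Fin m) K).trace) ^ n ≤ m * D := by
    intro n hn
    obtain ⟨h, k, hk, hs⟩ := hA.apply σ (vpow v hv n hn) hS h1 hspan hfree
    have h2 := (hb _ h k hk hs).trace
    rw [Matrix.trace_mul_comm, ← mul_assoc, mul_eq_one_comm.mp hk, one_mul] at h2
    have h3 : ((γ : Matrix (Fin m) (Fin m) K).map σ).trace = σ (γ : Matrix (Fin m) (Fin m) K).trace := by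
      simp [Matrix.trace]
    rw [h3] at h2
    exact h2
  by_contra hlt
  push Not at hlt
  obtain ⟨n, hn⟩ := pow_unbounded_of_one_lt ((m : ℝ) * D) hlt
  have hn0 : n ≠ 0 ∨ n = 0 := by omega
  rcases hn0 with h | h
  · linarith [key n h]
  · subst h
    have := key 1 one_ne_zero
    rw [pow_zero] at hn
    rw [pow_one] at this
    linarith

end LD

end

section
namespace LD

theorem spec_val (F : Type) [NontriviallyNormedField F] [IsUltrametricDist F] [CompleteSpace F] :
    ∃ v : AbsoluteValue (AlgebraicClosure F) ℝ, (∀ x y, v (x + y) ≤ max (v x) (v y)) ∧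
      ∀ c : F, v (algebraMap F (AlgebraicClosure F) c) = ‖c‖ := by
  let f := spectralMulAlgNorm F (AlgebraicClosure F)
  have hna : IsNonarchimedean (spectralNorm F (AlgebraicClosure F)) := isNonarchimedean_spectralNorm
  refine ⟨{ toFun := f, map_mul' := fun x y => map_mul f x y, nonneg' := fun x => apply_nonneg f x,
            eq_zero' := fun x => map_eq_zero_iff_eq_zero f, add_le' := fun x y => map_add_le_add f x y },
    fun x y => hna x y, fun c => spectralNorm_extends c⟩

theorem uncountable_closure (F : Type) [NontriviallyNormedField F] [CompleteSpace F] :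
    Uncountable (AlgebraicClosure F) := by
  have h1 : Uncountable F := by
    rw [← Cardinal.aleph0_lt_mk_iff]
    exact Cardinal.aleph0_lt_continuum.trans_le (continuum_le_cardinal_of_nontriviallyNormedField F)
  exact (algebraMap F (AlgebraicClosure F)).injective.uncountable

theorem exists_transc_big (p : ℕ) [Fact p.Prime] :
    ∃ w : ℚ_[p], Transcendental ℚ w ∧ 1 < ‖w‖ := by
  have hun : Uncountable ℚ_[p] := by
    rw [← Cardinal.aleph0_lt_mk_iff]
    exact Cardinal.aleph0_lt_continuum.trans_le (continuum_le_cardinal_of_nontriviallyNormedField ℚ_[p])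
  obtain ⟨t, ht⟩ : ∃ t : ℚ_[p], Transcendental ℚ t := by
    by_contra hcon
    push Not at hcon
    have hc := Algebraic.countable ℚ ℚ_[p]
    have : {x : ℚ_[p] | IsAlgebraic ℚ x} = Set.univ := by
      ext x
      simp only [Set.mem_ofPred_eq, Set.mem_univ, iff_true]
      have := hcon x
      rwa [Transcendental, not_not] at this
    rw [this, Set.countable_univ_iff] at hc
    exact not_countable hc
  have ht0 : t ≠ 0 := by
    rintro rfl
    exact ht isAlgebraic_zero
  obtain ⟨n, hn⟩ := pow_unbounded_of_one_lt (‖t‖⁻¹) (show (1 : ℝ) < p by exact_mod_cast (Fact.out : p.Prime).one_lt)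
  refine ⟨((p : ℚ_[p]) ^ n)⁻¹ * t, ?_, ?_⟩
  · intro halg
    apply ht
    have h2 : IsAlgebraic ℚ ((p : ℚ_[p]) ^ n) := (isAlgebraic_natCast p).pow n
    have h3 := h2.mul halg
    rwa [← mul_assoc, mul_inv_cancel₀, one_mul] at h3
    exact pow_ne_zero _ (by exact_mod_cast (Fact.out : p.Prime).ne_zero)
  · rw [norm_mul, norm_inv, norm_pow, Padic.norm_p, inv_pow, inv_inv]
    have : 0 < ‖t‖ := norm_pos_iff.mpr ht0
    rw [inv_lt_iff_one_lt_mul₀ this] at hn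
    rw [mul_comm]; linarith [mul_comm ((p:ℝ)^n) ‖t‖]

/-- coefficients of a product of linear factors with small roots -/
theorem coeff_le_one {L : Type} [Field L] (v : AbsoluteValue L ℝ) (hv : ∀ x y, v (x + y) ≤ max (v x) (v y))
    (s : Multiset L) (hs : ∀ a ∈ s, v a ≤ 1) (n : ℕ) :
    v ((s.map (fun a => Polynomial.X - Polynomial.C a)).prod.coeff n) ≤ 1 := by
  induction s using Multiset.induction_on generalizing n with
  | empty =>
    simp only [Multiset.map_zero, Multiset.prod_zero, Polynomial.coeff_one]
    split_ifs <;> simp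
  | cons a s ih =>
    have ih' := ih (fun b hb => hs b (Multiset.mem_cons_of_mem hb))
    have ha := hs a (Multiset.mem_cons_self a s)
    rw [Multiset.map_cons, Multiset.prod_cons, sub_mul]
    set q := (s.map (fun a => Polynomial.X - Polynomial.C a)).prod
    have h2 : v ((Polynomial.C a * q).coeff n) ≤ 1 := by
      rw [Polynomial.coeff_C_mul, map_mul]
      exact mul_le_one₀ ha (v.nonneg _) (ih' n)
    have h3 : v ((Polynomial.X * q).coeff n) ≤ 1 := by
      cases n with
      | zero => simp
      | succ n => rw [Polynomial.coeff_X_mul]; exact ih' n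
    rw [Polynomial.coeff_sub, sub_eq_add_neg]
    exact (hv _ _).trans (max_le h3 (by rwa [v.map_neg]))

theorem rat_int (q : ℚ) (h : ∀ (p : ℕ) [Fact p.Prime], ‖(q : ℚ_[p])‖ ≤ 1) : q.den = 1 := by
  by_contra hne
  obtain ⟨p, hp, hpd⟩ := Nat.exists_prime_and_dvd hne
  have : Fact p.Prime := ⟨hp⟩
  have h1 := h p
  have hnum : ‖((q.num : ℤ) : ℚ_[p])‖ = 1 := by
    apply le_antisymm (Padic.norm_int_le_one _)
    by_contra hlt
    push Not at hlt
    rw [Padic.norm_intCast_lt_one_iff] at hlt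
    have h2 : p ∣ q.num.natAbs := Int.natCast_dvd.mp hlt
    have := Nat.Coprime.eq_one_of_dvd (Nat.Coprime.coprime_dvd_left h2 q.reduced) hpd
    exact hp.one_lt.ne' this
  have hden : ‖((q.den : ℕ) : ℚ_[p])‖ < 1 := by
    have := (Padic.norm_intCast_lt_one_iff (p := p) (k := (q.den : ℤ))).mpr (by exact_mod_cast hpd)
    simpa using this
  have hq : (q : ℚ_[p]) * (q.den : ℚ_[p]) = (q.num : ℚ_[p]) := by
    exact_mod_cast Rat.mul_den_eq_num q
  have h3 := congrArg norm hq
  rw [norm_mul, hnum] at h3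
  nlinarith [norm_nonneg ((q.den : ℕ) : ℚ_[p]), norm_nonneg (q : ℚ_[p])]

theorem integral_of_nonarch {K : Type} [Field K] [CharZero K] [Countable K] (z : K)
    (h : ∀ (p : ℕ) [Fact p.Prime] (v : AbsoluteValue (AlgebraicClosure ℚ_[p]) ℝ),
      (∀ x y, v (x + y) ≤ max (v x) (v y)) → ∀ σ : K →+* AlgebraicClosure ℚ_[p], v (σ z) ≤ 1) :
    IsIntegral ℤ z := by
  have halg : IsAlgebraic ℚ z := by
    by_contra htr
    have : Fact (Nat.Prime 2) := ⟨Nat.prime_two⟩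
    obtain ⟨w, hw, hw1⟩ := exists_transc_big 2
    obtain ⟨v, hv, hvn⟩ := spec_val ℚ_[2]
    have := uncountable_closure ℚ_[2]
    obtain ⟨σ, hσ⟩ := ext_transc (F := ℚ) z (algebraMap ℚ_[2] (AlgebraicClosure ℚ_[2]) w) htr (by
      rw [transcendental_algebraMap_iff (algebraMap ℚ_[2] (AlgebraicClosure ℚ_[2])).injective]
      exact hw)
    have h2 := h 2 v hv σ
    rw [hσ, hvn] at h2
    linarith
  have hint : IsIntegral ℚ z := halg.isIntegral
  set f := minpoly ℚ z with hf
  have hmon : f.Monic := minpoly.monic hint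
  have hco : ∀ n, (f.coeff n).den = 1 := by
    intro n
    apply rat_int
    intro p hp
    obtain ⟨v, hv, hvn⟩ := spec_val ℚ_[p]
    have := uncountable_closure ℚ_[p]
    let L := AlgebraicClosure ℚ_[p]
    let g : Polynomial L := f.map (algebraMap ℚ L)
    have hgm : g.Monic := hmon.map _
    have hsp := (IsAlgClosed.splits g).eq_prod_roots_of_monic hgm
    have hroot : ∀ a ∈ g.roots, v a ≤ 1 := by
      intro a ha
      have h3 : Polynomial.aeval a f = 0 := by
        have := (Polynomial.mem_roots'.mp ha).2
        rwa [Polynomial.IsRoot.def, Polynomial.eval_map_algebraMap] at this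
      obtain ⟨σ, hσ⟩ := ext_alg (F := ℚ) z a hint h3
      rw [← hσ]
      exact h p v hv σ
    have h4 := coeff_le_one v hv g.roots hroot n
    rw [← hsp, Polynomial.coeff_map] at h4
    rw [← hvn]
    convert h4 using 2
    simp
  have hl : f ∈ Polynomial.lifts (algebraMap ℤ ℚ) := by
    rw [Polynomial.lifts_iff_coeff_lifts]
    intro n
    exact ⟨(f.coeff n).num, by simpa using Rat.coe_int_num_of_den_eq_one (hco n)⟩
  obtain ⟨g, hg, _, hgm⟩ := Polynomial.lifts_and_degree_eq_and_monic hl hmon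
  refine ⟨g, hgm, ?_⟩
  have h5 : Polynomial.aeval z f = 0 := minpoly.aeval ℚ z
  rw [← hg, Polynomial.aeval_map_algebraMap] at h5
  exact h5

theorem transc_charP (p : ℕ) [Fact p.Prime] (F : Type) [NormedField F] [Algebra (ZMod p) F]
    (w : F) (hw : 1 < ‖w‖) : Transcendental (ZMod p) w := by
  intro halg
  have hint : IsIntegral (ZMod p) w := halg.isIntegral
  have := IntermediateField.adjoin.finiteDimensional hint
  have hfin : Finite (IntermediateField.adjoin (ZMod p) {w}) := Module.finite_of_finite (ZMod p)
  let x : IntermediateField.adjoin (ZMod p) {w} := IntermediateField.AdjoinSimple.gen (ZMod p) w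
  have hni : ¬ Function.Injective (fun n : ℕ => x ^ n) := not_injective_infinite_finite _
  apply hni
  intro a b hab
  have h2 : w ^ a = w ^ b := by
    have hab' : x ^ a = x ^ b := hab
    have := congrArg (fun y : ↥(IntermediateField.adjoin (ZMod p) {w}) => (y : F)) hab'
    simpa [x] using this
  have h3 := congrArg norm h2
  rw [norm_pow, norm_pow] at h3
  exact pow_right_injective₀ (by linarith) hw.ne' h3

end LD

end

section
namespace LD

theorem SpanR.span_top {K : Type} [Field K] {m R : ℕ} {Γ : Subgroup (SL m K)} (h : SpanR R Γ)
    (hR : 1 ≤ R) : Submodule.span K ((fun g : SL m K => (g : Matrix (Fin m) (Fin m) K)) '' Γ) = ⊤ :=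
  h Γ le_rfl (by simp) (by simpa using hR)

/-- nondegeneracy of the trace form against a spanning set -/
theorem eq_of_traces {K : Type} [Field K] {m : ℕ} {B : Set (Matrix (Fin m) (Fin m) K)}
    (hB : Submodule.span K B = ⊤) {x y : Matrix (Fin m) (Fin m) K}
    (h : ∀ b ∈ B, (x * b).trace = (y * b).trace) : x = y := by
  have h2 : ∀ b : Matrix (Fin m) (Fin m) K, (x * b).trace = (y * b).trace := by
    intro b
    have hb : b ∈ Submodule.span K B := by rw [hB]; trivial
    induction hb using Submodule.span_induction with
    | mem b hb => exact h b hb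
    | zero => simp
    | add b c _ _ h1 h2 => rw [mul_add, mul_add, Matrix.trace_add, Matrix.trace_add, h1, h2]
    | smul c b _ h1 => rw [mul_smul_comm, mul_smul_comm, Matrix.trace_smul, Matrix.trace_smul, h1]
  ext i j
  have := h2 (Matrix.single j i 1)
  simpa [Matrix.trace_mul_single] using this

theorem exists_basis {K : Type} [Field K] {m : ℕ} {A : Set (Matrix (Fin m) (Fin m) K)}
    (hA : Submodule.span K A = ⊤) : ∃ B ⊆ A, B.Finite ∧ Submodule.span K B = ⊤ ∧
      LinearIndependent K ((↑) : B → Matrix (Fin m) (Fin m) K) := by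
  obtain ⟨B, hBA, hsp, hli⟩ := exists_linearIndependent K A
  exact ⟨B, hBA, hli.setFinite, hsp.trans hA, hli⟩

theorem coe_injective {K : Type} [Field K] {m : ℕ} :
    Function.Injective (fun g : SL m K => (g : Matrix (Fin m) (Fin m) K)) := Subtype.val_injective

theorem finite_of_traces {K : Type} [Field K] {m : ℕ} (Γ : Subgroup (SL m K))
    (hsp : Submodule.span K ((fun g : SL m K => (g : Matrix (Fin m) (Fin m) K)) '' Γ) = ⊤)
    (T : Set K) (hT : T.Finite) (h : ∀ γ ∈ Γ, (γ : Matrix (Fin m) (Fin m) K).trace ∈ T) :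
    (Γ : Set (SL m K)).Finite := by
  obtain ⟨B, hBA, hBf, hBs, -⟩ := exists_basis hsp
  have : Finite B := hBf
  have hfin : (Set.univ.pi (fun _ : B => T)).Finite := Set.Finite.pi' (fun _ => hT) |>.subset
    (fun f hf i => hf i trivial)
  refine Set.Finite.of_finite_image (f := fun (g : SL m K) (b : B) => ((g : Matrix (Fin m) (Fin m) K) * b).trace)
    (hfin.subset ?_) ?_
  · rintro _ ⟨g, hg, rfl⟩ b -
    obtain ⟨β, hβ, hβe⟩ := hBA b.2
    have := h (g * β) (Γ.mul_mem hg hβ)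
    rw [Matrix.SpecialLinearGroup.coe_mul] at this
    simp only at hβe
    simpa only [← hβe] using this
  · intro g _ g' _ hgg
    apply coe_injective
    exact eq_of_traces hBs (fun b hb => congrFun hgg ⟨b, hb⟩)

/-- membership in the span over a subfield -/
theorem span_subfield {K : Type} [Field K] {m : ℕ} (F : Subfield K) (B : Set (Matrix (Fin m) (Fin m) K))
    (hBf : B.Finite) (hBs : Submodule.span K B = ⊤)
    (hli : LinearIndependent K ((↑) : B → Matrix (Fin m) (Fin m) K))
    (hB : ∀ b ∈ B, ∀ c ∈ B, (b * c).trace ∈ F) (x : Matrix (Fin m) (Fin m) K)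
    (hx : ∀ c ∈ B, (x * c).trace ∈ F) :
    ∃ c : B → F, letI := hBf.fintype; x = ∑ b : B, (c b : K) • (b : Matrix (Fin m) (Fin m) K) := by
  classical
  let _ := hBf.fintype
  let T' : Matrix B B F := fun b c => ⟨_, hB b b.2 c c.2⟩
  have hdet : T'.det ≠ 0 := by
    intro h0
    have h1 : (T'.map F.subtype).det = 0 := by
      rw [← RingHom.mapMatrix_apply, ← RingHom.map_det, h0, map_zero]
    obtain ⟨v, hv0, hv⟩ := Matrix.exists_vecMul_eq_zero_iff.mpr h1
    apply hv0
    have hz : ∑ b : B, v b • (b : Matrix (Fin m) (Fin m) K) = 0 := by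
      apply eq_of_traces hBs
      intro c hc
      have := congrFun hv ⟨c, hc⟩
      rw [Finset.sum_mul, Matrix.trace_sum, zero_mul, Matrix.trace_zero]
      rw [Pi.zero_apply] at this
      refine Eq.trans (Finset.sum_congr rfl fun b _ => ?_) this
      rw [smul_mul_assoc, Matrix.trace_smul]
      rfl
    have := Fintype.linearIndependent_iff.mp hli v hz
    ext i; exact this i
  let t : B → F := fun c => ⟨_, hx c c.2⟩
  refine ⟨t ᵥ* T'⁻¹, ?_⟩
  apply eq_of_traces hBs
  intro c hc
  have h2 : (t ᵥ* T'⁻¹) ᵥ* T' = t := by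
    rw [Matrix.vecMul_vecMul, Matrix.nonsing_inv_mul _ (isUnit_iff_ne_zero.mpr hdet), Matrix.vecMul_one]
  have h3 := congrArg (fun z : F => (z : K)) (congrFun h2 ⟨c, hc⟩)
  rw [Finset.sum_mul, Matrix.trace_sum]
  have h4 : (x * c).trace = ((t ⟨c, hc⟩ : F) : K) := rfl
  rw [h4, ← h3]
  generalize t ᵥ* T'⁻¹ = u
  simp [Matrix.vecMul, dotProduct, T', Matrix.trace_smul]

theorem finite_of_subfield {K : Type} [Field K] {m : ℕ} (S : Set (SL m K)) (F : Subfield K) [Finite F]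
    (B : Set (Matrix (Fin m) (Fin m) K))
    (hBΓ : B ⊆ (fun g : SL m K => (g : Matrix (Fin m) (Fin m) K)) '' (Subgroup.closure S : Set (SL m K)))
    (hBf : B.Finite) (hBs : Submodule.span K B = ⊤)
    (hli : LinearIndependent K ((↑) : B → Matrix (Fin m) (Fin m) K))
    (h1 : ∀ b ∈ B, ∀ c ∈ B, (b * c).trace ∈ F)
    (h2 : ∀ s ∈ S, ∀ b ∈ B, ∀ c ∈ B, ((s : Matrix (Fin m) (Fin m) K) * b * c).trace ∈ F) :
    (Subgroup.closure S : Set (SL m K)).Finite := by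
  classical
  by_cases hne : B.Nonempty
  swap
  · rw [Set.not_nonempty_iff_eq_empty] at hne
    subst hne
    rw [Submodule.span_empty] at hBs
    have hsub : Subsingleton (Matrix (Fin m) (Fin m) K) := by
      refine ⟨fun a b => ?_⟩
      have ha : a ∈ (⊥ : Submodule K (Matrix (Fin m) (Fin m) K)) := by rw [hBs]; trivial
      have hb : b ∈ (⊥ : Submodule K (Matrix (Fin m) (Fin m) K)) := by rw [hBs]; trivial
      rw [Submodule.mem_bot] at ha hb
      rw [ha, hb]
    have : Finite (SL m K) := Finite.of_injective _ (coe_injective (K := K) (m := m))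
    exact Set.toFinite _
  obtain ⟨b0, hb0⟩ := hne
  obtain ⟨β, hβ, hβe⟩ := hBΓ hb0
  simp only at hβe
  let _ := hBf.fintype
  let A : Set (Matrix (Fin m) (Fin m) K) :=
    Set.range (fun c : B → F => ∑ b : B, (c b : K) • (b : Matrix (Fin m) (Fin m) K))
  have hAf : A.Finite := Set.finite_range _
  let A' : Set (SL m K) := (fun g : SL m K => (g : Matrix (Fin m) (Fin m) K)) ⁻¹' A
  have hA'f : A'.Finite := hAf.preimage coe_injective.injOn
  have hBA : ∀ b ∈ B, b ∈ A := by
    intro b hb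
    obtain ⟨c, hc⟩ := span_subfield F B hBf hBs hli h1 b (h1 b hb)
    exact ⟨c, hc.symm⟩
  have hsA : ∀ s ∈ S, ∀ a ∈ A', s • a ∈ A' := by
    rintro s hs a ⟨c, hc⟩
    simp only at hc
    have hx : ∀ e ∈ B, ((s : Matrix (Fin m) (Fin m) K) * (a : Matrix (Fin m) (Fin m) K) * e).trace ∈ F := by
      intro e he
      rw [← hc, Finset.mul_sum, Finset.sum_mul, Matrix.trace_sum]
      refine sum_mem (fun b _ => ?_)
      rw [mul_smul_comm, smul_mul_assoc, Matrix.trace_smul, smul_eq_mul]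
      exact mul_mem (c b).2 (h2 s hs b b.2 e he)
    obtain ⟨c', hc'⟩ := span_subfield F B hBf hBs hli h1 _ hx
    refine ⟨c', ?_⟩
    simp only [smul_eq_mul, Matrix.SpecialLinearGroup.coe_mul]
    exact hc'.symm
  have hβA : β ∈ A' := by
    change (β : Matrix (Fin m) (Fin m) K) ∈ A
    rw [hβe]; exact hBA _ hb0
  have hst := stable_closure S A' hA'f hsA
  refine (hA'f.image (fun g => g * β⁻¹)).subset ?_
  intro g hg
  exact ⟨g * β, hst g hg β hβA, by simp⟩

/-- positive characteristic -/
theorem charP_main {m : ℕ} {C : ℝ} {N0 : ℕ} (hC : 1 ≤ C) (hA : ThA m C N0) {K : Type} [Field K] [Countable K]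
    (p : ℕ) [Fact p.Prime] [CharP K p]
    (k : Type) [NontriviallyNormedField k] [CompleteSpace k] [CharP k p]
    {S : Set (SL m K)} (hS : S.Finite)
    (h1 : (1 : SL m K) ∈ S) (hspan : SpanR ((m ^ 2 + 1) ^ m) (Subgroup.closure S))
    (hinf : (Subgroup.closure S : Set (SL m K)).Infinite) : HasFree S N0 := by
  by_contra hfree
  let _ : Algebra (ZMod p) K := ZMod.algebra K p
  let _ : Algebra (ZMod p) k := ZMod.algebra k p
  have hult : IsUltrametricDist k := by
    apply IsUltrametricDist.isUltrametricDist_of_forall_norm_natCast_le_one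
    intro n
    by_contra hlt
    push Not at hlt
    exact transc_charP p k (n : k) hlt (isAlgebraic_natCast n)
  obtain ⟨v, hv, hvn⟩ := spec_val k
  have := uncountable_closure k
  obtain ⟨w, hw⟩ := NormedField.exists_one_lt_norm k
  have htrw : Transcendental (ZMod p) (algebraMap k (AlgebraicClosure k) w) := by
    rw [transcendental_algebraMap_iff (algebraMap k (AlgebraicClosure k)).injective]
    exact transc_charP p k w hw
  have halg : ∀ γ ∈ Subgroup.closure S, IsAlgebraic (ZMod p) (γ : Matrix (Fin m) (Fin m) K).trace := by
    intro γ hγ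
    by_contra htr
    obtain ⟨σ, hσ⟩ := ext_transc (F := ZMod p) _ _ htr htrw
    have h2 := nonarch_trace hC hA σ v hv hS h1 hspan hfree γ hγ
    rw [hσ, hvn] at h2
    linarith
  have hsp := hspan.span_top (Nat.one_le_pow _ _ (by positivity))
  obtain ⟨B, hBA, hBf, hBs, hli⟩ := exists_basis hsp
  let t : Set K := ⋃ s ∈ S, ⋃ b ∈ B, ⋃ c ∈ B, {((s : Matrix (Fin m) (Fin m) K) * b * c).trace}
  have htf : t.Finite := hS.biUnion fun s _ => hBf.biUnion fun b _ => hBf.biUnion fun c _ => Set.finite_singleton _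
  have htm : ∀ s ∈ S, ∀ b ∈ B, ∀ c ∈ B, ((s : Matrix (Fin m) (Fin m) K) * b * c).trace ∈ t := by
    intro s hs b hb c hc
    simp only [t, Set.mem_iUnion]
    exact ⟨s, hs, b, hb, c, hc, rfl⟩
  have hti : ∀ x ∈ t, IsIntegral (ZMod p) x := by
    intro x hx
    simp only [t, Set.mem_iUnion] at hx
    obtain ⟨s, hs, b, hb, c, hc, rfl⟩ := hx
    obtain ⟨β, hβ, rfl⟩ := hBA hb
    obtain ⟨δ, hδ, rfl⟩ := hBA hc
    have := halg (s * β * δ) (mul_mem (mul_mem (Subgroup.subset_closure hs) hβ) hδ)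
    simpa using this.isIntegral
  have : Finite t := htf
  have hfd := IntermediateField.finiteDimensional_adjoin hti
  have hff : Finite (IntermediateField.adjoin (ZMod p) t) := Module.finite_of_finite (ZMod p)
  have : Finite (IntermediateField.adjoin (ZMod p) t).toSubfield := hff
  have hsub := IntermediateField.subset_adjoin (ZMod p) t
  refine hinf (finite_of_subfield S (IntermediateField.adjoin (ZMod p) t).toSubfield B hBA hBf hBs hli ?_ ?_)
  · intro b hb c hc
    have := hsub (htm 1 h1 b hb c hc)
    rw [Matrix.SpecialLinearGroup.coe_one, one_mul] at this
    exact this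
  · intro s hs b hb c hc
    exact hsub (htm s hs b hb c hc)

end LD

end

section
namespace LD

theorem common_eigen {K V ι : Type} [Field K] [IsAlgClosed K] [AddCommGroup V] [Module K V]
    [FiniteDimensional K V] [Nontrivial V] (f : ι → Module.End K V)
    (hc : ∀ i j, f i * f j = f j * f i) : ∃ w : V, w ≠ 0 ∧ ∃ χ : ι → K, ∀ i, f i w = χ i • w := by
  have wf : WellFounded (fun a b : Submodule K V => a < b) := wellFounded_lt
  obtain ⟨W, ⟨hW0, hWi⟩, hmin⟩ := wf.has_min {W : Submodule K V | W ≠ ⊥ ∧ ∀ i, ∀ w ∈ W, f i w ∈ W}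
    ⟨⊤, ⟨top_ne_bot, fun _ _ _ => trivial⟩⟩
  have key : ∀ i, ∃ μ : K, ∀ w ∈ W, f i w = μ • w := by
    intro i
    have hnt : Nontrivial W := Submodule.nontrivial_iff_ne_bot.mpr hW0
    obtain ⟨μ, hμ⟩ := Module.End.exists_eigenvalue ((f i).restrict (hWi i))
    obtain ⟨u, hu⟩ := hμ.exists_hasEigenvector
    have hu1 := hu.apply_eq_smul
    have hu2 : f i u = μ • (u : V) := by
      have := congrArg Subtype.val hu1
      simpa using this
    refine ⟨μ, ?_⟩
    let W' : Submodule K V := W ⊓ Module.End.eigenspace (f i) μ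
    have hW'0 : W' ≠ ⊥ := by
      intro h0
      have hm : (u : V) ∈ W' := ⟨u.2, Module.End.mem_eigenspace_iff.mpr hu2⟩
      rw [h0, Submodule.mem_bot] at hm
      exact hu.2 (Subtype.ext hm)
    have hW'i : ∀ j, ∀ w ∈ W', f j w ∈ W' := by
      intro j w hw
      refine ⟨hWi j w hw.1, Module.End.mem_eigenspace_iff.mpr ?_⟩
      have h1 := Module.End.mem_eigenspace_iff.mp hw.2
      have h2 : f i (f j w) = f j (f i w) := LinearMap.congr_fun (hc i j) w
      rw [h2, h1, map_smul]
    have hnlt := hmin W' ⟨hW'0, hW'i⟩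
    have hEq : W' = W := by
      by_contra hne
      exact hnlt (lt_of_le_of_ne inf_le_left hne)
    intro w hw
    rw [← hEq] at hw
    exact Module.End.mem_eigenspace_iff.mp hw.2
  obtain ⟨w, hw, hw0⟩ := Submodule.exists_mem_ne_zero_of_ne_bot hW0
  choose χ hχ using key
  exact ⟨w, hw0, χ, fun i => hχ i w hw⟩

/-- the stabilizer of a subspace -/
def stabV {K : Type} [Field K] {m : ℕ} (V : Submodule K (Fin m → K)) : Subgroup (SL m K) where
  carrier := {x | ∀ u, (x : Matrix (Fin m) (Fin m) K) *ᵥ u ∈ V ↔ u ∈ V}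
  mul_mem' := fun {x y} hx hy u => by
    rw [Matrix.SpecialLinearGroup.coe_mul, ← Matrix.mulVec_mulVec, hx, hy]
  one_mem' := fun u => by simp
  inv_mem' := fun {x} hx u => by
    rw [← hx, Matrix.mulVec_mulVec, ← Matrix.SpecialLinearGroup.coe_mul, mul_inv_cancel]
    simp

theorem conj_comm_aux {G : Type} [Group G] (x a b : G)
    (h : x * ((a⁻¹ * b) * x * (a⁻¹ * b)⁻¹) = ((a⁻¹ * b) * x * (a⁻¹ * b)⁻¹) * x) :
    (a * x * a⁻¹) * (b * x * b⁻¹) = (b * x * b⁻¹) * (a * x * a⁻¹) := by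
  have e1 : (a * x * a⁻¹) * (b * x * b⁻¹) = a * (x * ((a⁻¹ * b) * x * (a⁻¹ * b)⁻¹)) * a⁻¹ := by group
  have e2 : (b * x * b⁻¹) * (a * x * a⁻¹) = a * (((a⁻¹ * b) * x * (a⁻¹ * b)⁻¹) * x) * a⁻¹ := by group
  rw [e1, e2, h]

set_option maxHeartbeats 1000000 in
theorem comm_scalar {K : Type} [Field K] [IsAlgClosed K] {m R : ℕ} (hm : 0 < m) (Γ : Subgroup (SL m K))
    (hspan : SpanR R Γ) (hR : m ≤ R) (x : SL m K)
    (hx : ∀ g ∈ Γ, x * (g * x * g⁻¹) = (g * x * g⁻¹) * x) :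
    ∃ c : K, (x : Matrix (Fin m) (Fin m) K) = c • 1 := by
  classical
  have : Nonempty (Fin m) := ⟨⟨0, hm⟩⟩
  let f : Γ → Module.End K (Fin m → K) := fun g =>
    Matrix.toLin' (((g : SL m K) * x * (g : SL m K)⁻¹ : SL m K) : Matrix (Fin m) (Fin m) K)
  have hfa : ∀ (g : Γ) u, f g u = (((g : SL m K) * x * (g : SL m K)⁻¹ : SL m K) : Matrix (Fin m) (Fin m) K) *ᵥ u :=
    fun g u => Matrix.toLin'_apply _ _
  have hc : ∀ i j, f i * f j = f j * f i := by
    intro i j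
    have h1 := hx _ (Γ.mul_mem (Γ.inv_mem i.2) j.2)
    have h2 : ((i : SL m K) * x * (i : SL m K)⁻¹) * ((j : SL m K) * x * (j : SL m K)⁻¹) =
        ((j : SL m K) * x * (j : SL m K)⁻¹) * ((i : SL m K) * x * (i : SL m K)⁻¹) := by
      exact conj_comm_aux x i j h1
    apply LinearMap.ext
    intro u
    change f i (f j u) = f j (f i u)
    rw [hfa, hfa, hfa, hfa, Matrix.mulVec_mulVec, Matrix.mulVec_mulVec, ← Matrix.SpecialLinearGroup.coe_mul,
      ← Matrix.SpecialLinearGroup.coe_mul, h2]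
  obtain ⟨w, hw0, χ, hχ⟩ := common_eigen f hc
  let V : Submodule K (Fin m → K) :=
    { carrier := {u | ∀ g, f g u = χ g • u}
      add_mem' := fun {a b} ha hb g => by rw [map_add, ha g, hb g, smul_add]
      zero_mem' := fun g => by simp
      smul_mem' := fun c a ha g => by rw [map_smul, ha g, smul_comm] }
  have htr : ∀ (γ g : Γ) (u : Fin m → K), f g (((γ : SL m K) : Matrix (Fin m) (Fin m) K) *ᵥ u) =
      ((γ : SL m K) : Matrix (Fin m) (Fin m) K) *ᵥ (f (γ⁻¹ * g) u) := by
    intro γ g u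
    rw [hfa, hfa, Matrix.mulVec_mulVec, Matrix.mulVec_mulVec, ← Matrix.SpecialLinearGroup.coe_mul,
      ← Matrix.SpecialLinearGroup.coe_mul]
    have e : ((g : SL m K) * x * (g : SL m K)⁻¹) * (γ : SL m K) =
        (γ : SL m K) * (((γ⁻¹ * g : Γ) : SL m K) * x * ((γ⁻¹ * g : Γ) : SL m K)⁻¹) := by
      rw [Subgroup.coe_mul, Subgroup.coe_inv]
      group
    rw [e]
  have hinj : ∀ (γ : SL m K) (a b : Fin m → K), (γ : Matrix (Fin m) (Fin m) K) *ᵥ a =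
      (γ : Matrix (Fin m) (Fin m) K) *ᵥ b → a = b := by
    intro γ a b hab
    have := congrArg (fun z => ((γ⁻¹ : SL m K) : Matrix (Fin m) (Fin m) K) *ᵥ z) hab
    simp only [Matrix.mulVec_mulVec, ← Matrix.SpecialLinearGroup.coe_mul, inv_mul_cancel] at this
    simpa using this
  have hindex : ¬ ((stabV V).relIndex Γ = 0 ∨ m < (stabV V).relIndex Γ) := by
    rw [many_iff]
    rintro ⟨y, hy, hyy⟩
    let Y : Fin (m + 1) → Γ := fun i => ⟨y i, hy i⟩
    let wt : Fin (m + 1) → (Γ → K) := fun i g => χ ((Y i)⁻¹ * g)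
    have hwt : ∀ i g, f g ((y i : Matrix (Fin m) (Fin m) K) *ᵥ w) = wt i g • ((y i : Matrix (Fin m) (Fin m) K) *ᵥ w) := by
      intro i g
      have := htr (Y i) g w
      rw [hχ, Matrix.mulVec_smul] at this
      exact this
    have hwinj : Function.Injective wt := by
      intro i j hij
      by_contra hne
      apply hyy i j hne
      intro u
      have e1 : ∀ (l : Fin (m+1)) (u : Fin m → K), u ∈ V ↔ ∀ g, f g ((y l : Matrix (Fin m) (Fin m) K) *ᵥ u) = wt l g • ((y l : Matrix (Fin m) (Fin m) K) *ᵥ u) := by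
        intro l u
        constructor
        · intro hu g
          have := htr (Y l) g u
          rw [hu, Matrix.mulVec_smul] at this
          exact this
        · intro hu g
          have h1 := htr (Y l) (Y l * g) u
          have h2 := hu (Y l * g)
          rw [h1] at h2
          simp only [wt, inv_mul_cancel_left] at h2
          rw [← Matrix.mulVec_smul] at h2
          exact hinj _ _ _ h2
      rw [e1 i, e1 j, hij, Matrix.mulVec_mulVec, ← Matrix.SpecialLinearGroup.coe_mul, mul_inv_cancel_left]
    have hind := Module.End.independent_iInf_maxGenEigenspace_of_forall_mapsTo f
      (fun i j φ => Module.End.mapsTo_maxGenEigenspace_of_comm (hc j i) φ)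
    have hind2 := hind.comp hwinj
    have hli : LinearIndependent K (fun i => (y i : Matrix (Fin m) (Fin m) K) *ᵥ w) := by
      refine hind2.linearIndependent _ (fun i => ?_) (fun i h0 => ?_)
      · simp only [Function.comp, Submodule.mem_iInf]
        intro g
        have h1 : (y i : Matrix (Fin m) (Fin m) K) *ᵥ w ∈ (f g).eigenspace (wt i g) :=
          Module.End.mem_eigenspace_iff.mpr (hwt i g)
        exact (f g).genEigenspace_le_maximal (wt i g) 1 h1
      · apply hw0
        apply hinj (y i)
        rw [h0, Matrix.mulVec_zero]
    have := hli.fintype_card_le_finrank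
    simp at this
  push Not at hindex
  have hs := hspan (stabV V ⊓ Γ) inf_le_right (by rw [Subgroup.inf_relIndex_right]; exact hindex.1)
    (by rw [Subgroup.inf_relIndex_right]; exact hindex.2.trans hR)
  have hinv : ∀ (A : Matrix (Fin m) (Fin m) K), A *ᵥ w ∈ V := by
    intro A
    have hA : A ∈ Submodule.span K ((fun g : SL m K => (g : Matrix (Fin m) (Fin m) K)) ''
      ((stabV V ⊓ Γ : Subgroup (SL m K)) : Set (SL m K))) := by rw [hs]; trivial
    induction hA using Submodule.span_induction with
    | mem a ha =>
      obtain ⟨g, hg, rfl⟩ := ha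
      exact (hg.1 w).mpr (fun g => hχ g)
    | zero => rw [Matrix.zero_mulVec]; exact V.zero_mem
    | add a b _ _ h1 h2 => rw [Matrix.add_mulVec]; exact V.add_mem h1 h2
    | smul c a _ h1 => rw [Matrix.smul_mulVec]; exact V.smul_mem c h1
  obtain ⟨i0, hi0⟩ := Function.ne_iff.mp hw0
  have hall : ∀ u : Fin m → K, u ∈ V := by
    intro u
    have := hinv (Matrix.vecMulVec u (Pi.single i0 (w i0)⁻¹))
    have e : Matrix.vecMulVec u (Pi.single i0 (w i0)⁻¹) *ᵥ w = u := by
      funext i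
      have hi : w i0 ≠ 0 := hi0
      simp [Matrix.mulVec, dotProduct, Matrix.vecMulVec_apply, Pi.single_apply, hi]
    rwa [e] at this
  refine ⟨χ 1, ?_⟩
  apply Matrix.toLin'.injective
  apply LinearMap.ext
  intro u
  have := hall u 1
  rw [hfa] at this
  simpa [Matrix.smul_mulVec] using this

end LD

end

section
namespace LD

/-- the complex absolute value -/
noncomputable def cabs : AbsoluteValue ℂ ℝ where
  toFun := fun z => ‖z‖
  map_mul' := norm_mul
  nonneg' := norm_nonneg
  eq_zero' := fun _ => norm_eq_zero
  add_le' := norm_add_le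

theorem cabs_apply (z : ℂ) : cabs z = ‖z‖ := rfl

theorem Bd.inv {L : Type} [Field L] {v : AbsoluteValue L ℝ} {m : ℕ} {C : ℝ} {a : SL m L}
    (h : Bd v C (a : Matrix (Fin m) (Fin m) L)) (hC : 1 ≤ C) :
    Bd v ((m.factorial : ℝ) * C ^ m) ((a⁻¹ : SL m L) : Matrix (Fin m) (Fin m) L) := by
  rw [Matrix.SpecialLinearGroup.coe_inv]
  exact h.adjugate hC

theorem net (m : ℕ) (C ε : ℝ) (hε : 0 < ε) : ∃ t : Finset (Matrix (Fin m) (Fin m) ℂ),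
    ∀ A : Matrix (Fin m) (Fin m) ℂ, Bd cabs C A → ∃ B ∈ t, Bd cabs ε (A - B) := by
  by_cases hC : 0 ≤ C
  swap
  · by_cases hm : m = 0
    · subst hm
      exact ⟨{0}, fun A _ => ⟨0, Finset.mem_singleton_self _, fun i => i.elim0⟩⟩
    · refine ⟨∅, fun A hA => ?_⟩
      have := hA ⟨0, Nat.pos_of_ne_zero hm⟩ ⟨0, Nat.pos_of_ne_zero hm⟩
      exact absurd ((cabs.nonneg _).trans this) hC
  have hcp : IsCompact (Metric.closedBall (0 : Fin m → Fin m → ℂ) C) := isCompact_closedBall 0 C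
  obtain ⟨t, -, htf, hcov⟩ := hcp.finite_cover_balls hε
  refine ⟨htf.toFinset.image (fun f => Matrix.of f), fun A hA => ?_⟩
  have hAm : (fun i j => A i j) ∈ Metric.closedBall (0 : Fin m → Fin m → ℂ) C := by
    rw [mem_closedBall_zero_iff, pi_norm_le_iff_of_nonneg hC]
    intro i
    rw [pi_norm_le_iff_of_nonneg hC]
    intro j
    exact hA i j
  have := hcov hAm
  simp only [Set.mem_iUnion] at this
  obtain ⟨f, hf, hfd⟩ := this
  refine ⟨Matrix.of f, Finset.mem_image_of_mem _ (htf.mem_toFinset.mpr hf), fun i j => ?_⟩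
  rw [Metric.mem_ball, dist_eq_norm] at hfd
  have h1 := (norm_le_pi_norm ((fun i j => A i j) - f) i)
  have h2 := (norm_le_pi_norm (((fun i j => A i j) - f) i) j)
  rw [cabs_apply]
  exact (h2.trans h1).trans hfd.le

theorem pigeon (m : ℕ) (C ε : ℝ) (hC : 1 ≤ C) (hε : 0 < ε) : ∃ J : ℕ, 1 ≤ J ∧ ∀ a : SL m ℂ,
    (∀ i ≤ J, Bd cabs C ((a ^ i : SL m ℂ) : Matrix (Fin m) (Fin m) ℂ)) →
    ∃ i, 1 ≤ i ∧ i ≤ J ∧ Bd cabs ε (((a ^ i : SL m ℂ) : Matrix (Fin m) (Fin m) ℂ) - 1) := by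
  classical
  set D : ℝ := m * ((m.factorial : ℝ) * C ^ m) + 1 with hD
  have hDp : 0 < D := by positivity
  set η : ℝ := ε / (2 * D) with hη
  have hηp : 0 < η := by positivity
  obtain ⟨t, ht⟩ := net m C η hηp
  refine ⟨t.card + 1, by omega, fun a ha => ?_⟩
  have hch : ∀ i : Fin (t.card + 1), ∃ B ∈ t, Bd cabs η (((a ^ (i : ℕ) : SL m ℂ) : Matrix (Fin m) (Fin m) ℂ) - B) :=
    fun i => ht _ (ha i (by omega))
  choose F hF hFd using hch
  obtain ⟨i, -, j, -, hij, hFe⟩ := Finset.exists_ne_map_eq_of_card_lt_of_maps_to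
    (s := (Finset.univ : Finset (Fin (t.card + 1)))) (t := t) (by simp) (f := F) (fun i _ => hF i)
  have key : ∀ i j : Fin (t.card + 1), i < j → F i = F j → ∃ i, 1 ≤ i ∧ i ≤ t.card + 1 ∧
      Bd cabs ε (((a ^ i : SL m ℂ) : Matrix (Fin m) (Fin m) ℂ) - 1) := by
    intro i j hlt hF
    refine ⟨j - i, by omega, by omega, ?_⟩
    have h1 : Bd cabs (η + η) (((a ^ (j : ℕ) : SL m ℂ) : Matrix (Fin m) (Fin m) ℂ) -
        ((a ^ (i : ℕ) : SL m ℂ) : Matrix (Fin m) (Fin m) ℂ)) := by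
      have := (hFd j).sub (hFd i)
      rw [hF] at this
      simpa using this
    have h2 := (Bd.inv (ha i (by omega)) hC).mul h1 (by positivity)
    have h3 : ((((a ^ (i : ℕ))⁻¹ : SL m ℂ) : Matrix (Fin m) (Fin m) ℂ)) *
        (((a ^ (j : ℕ) : SL m ℂ) : Matrix (Fin m) (Fin m) ℂ) -
        ((a ^ (i : ℕ) : SL m ℂ) : Matrix (Fin m) (Fin m) ℂ)) =
        ((a ^ ((j : ℕ) - (i : ℕ)) : SL m ℂ) : Matrix (Fin m) (Fin m) ℂ) - 1 := by
      rw [mul_sub, ← Matrix.SpecialLinearGroup.coe_mul, ← Matrix.SpecialLinearGroup.coe_mul, inv_mul_cancel,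
        Matrix.SpecialLinearGroup.coe_one, pow_sub a (le_of_lt hlt)]
      congr 2
      exact (Commute.inv_left (Commute.pow_pow_self a _ _))
    rw [h3] at h2
    refine h2.mono ?_
    rw [hη]
    have : (m : ℝ) * ((m.factorial : ℝ) * C ^ m * (ε / (2 * D) + ε / (2 * D))) = (D - 1) * ε / D := by
      rw [hD]; field_simp; ring
    rw [this, div_le_iff₀ hDp]
    nlinarith
  rcases lt_or_gt_of_ne hij with h | h
  · exact key i j h hFe
  · exact key j i h hFe.symm

theorem approx (m : ℕ) (C : ℝ) (hC : 1 ≤ C) (l : ℕ) : ∀ η : ℝ, 0 < η → ∃ n : ℕ,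
    ∀ {G : Type} [Group G] (φ : G →* SL m ℂ) (X : Set G), (1 : G) ∈ X →
    (∀ g ∈ X ^ n, Bd cabs C (φ g : Matrix (Fin m) (Fin m) ℂ)) → ∀ w ∈ (X ∪ X⁻¹) ^ l, ∃ u ∈ X ^ n,
      Bd cabs η ((φ w : Matrix (Fin m) (Fin m) ℂ) - (φ u : Matrix (Fin m) (Fin m) ℂ)) := by
  induction l with
  | zero =>
    intro η hη
    refine ⟨0, ?_⟩
    intro G _ φ X h1 hb w hw
    rw [pow_zero] at hw
    refine ⟨w, by rw [pow_zero]; exact hw, ?_⟩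
    intro i j
    simp [hη.le]
  | succ l ih =>
    intro η hη
    set C' : ℝ := (m.factorial : ℝ) * C ^ m with hC'
    have hC'0 : 0 ≤ C' := by positivity
    set D : ℝ := m * C' + m * C + 1 with hD
    have hDp : 0 < D := by positivity
    obtain ⟨n', hn'⟩ := ih (η / (2 * D)) (by positivity)
    set E : ℝ := m * (C * (m * C')) + 1 with hE
    have hEp : 0 < E := by positivity
    obtain ⟨J, hJ1, hJ⟩ := pigeon m C (η / (2 * E)) hC (by positivity)
    refine ⟨n' + J, ?_⟩
    intro G _ φ X h1 hb w hw
    rw [pow_succ] at hw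
    obtain ⟨w', hw', t, ht, rfl⟩ := hw
    obtain ⟨u', hu', hd⟩ := hn' φ X h1 (fun g hg => hb g (pow_subset h1 (by omega) hg)) w' hw'
    have hu'b := hb u' (pow_subset h1 (by omega) hu')
    have hsplit1 : (m : ℝ) * (η / (2 * D) * C') ≤ η / 2 := by
      rw [show (m : ℝ) * (η / (2 * D) * C') = η * (m * C') / (2 * D) by ring, div_le_div_iff₀ (by positivity) (by norm_num)]
      have : (m : ℝ) * C' ≤ D := by
        have : 0 ≤ (m : ℝ) * C := by positivity
        linarith
      nlinarith
    have hsplit2 : (m : ℝ) * (η / (2 * D) * C) ≤ η / 2 := by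
      rw [show (m : ℝ) * (η / (2 * D) * C) = η * (m * C) / (2 * D) by ring, div_le_div_iff₀ (by positivity) (by norm_num)]
      have : (m : ℝ) * C ≤ D := by
        have : 0 ≤ (m : ℝ) * C' := by positivity
        linarith
      nlinarith
    rcases ht with ht | ht
    · refine ⟨u' * t, ?_, ?_⟩
      · refine pow_subset h1 (a := n' + 1) (by omega) ?_
        rw [pow_succ]
        exact Set.mul_mem_mul hu' ht
      · have htb := hb t (pow_subset h1 (a := 1) (by omega) (by simpa using ht))
        have := hd.mul htb (by positivity)
        rw [sub_mul, ← coe_map_mul, ← coe_map_mul] at this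
        exact this.mono (by linarith)
    · obtain ⟨s, rfl⟩ : ∃ s, t = s⁻¹ := ⟨t⁻¹, by simp⟩
      have hsX : s ∈ X := by simpa using ht
      have hpow : ∀ i ≤ J, s ^ i ∈ X ^ J := fun i hi => pow_subset h1 hi (Set.pow_mem_pow hsX)
      obtain ⟨p, hp1, hpJ, hpd⟩ := hJ (φ s) (fun i hi => by
        rw [← map_pow]
        exact hb _ (pow_subset h1 (by omega) (hpow i hi)))
      refine ⟨u' * s ^ (p - 1), ?_, ?_⟩
      · rw [pow_add]
        exact Set.mul_mem_mul hu' (hpow _ (by omega))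
      · have hsb := hb s (pow_subset h1 (a := 1) (by omega) (by simpa using hsX))
        have hsi := Bd.inv hsb hC
        have t1 := hd.mul hsi (by positivity)
        have t2 := hu'b.mul (hsi.mul hpd hC'0) (by linarith)
        have t3 := t1.sub t2
        have heq : ((φ w' : Matrix (Fin m) (Fin m) ℂ) - (φ u' : Matrix (Fin m) (Fin m) ℂ)) *
            (((φ s)⁻¹ : SL m ℂ) : Matrix (Fin m) (Fin m) ℂ) -
            (φ u' : Matrix (Fin m) (Fin m) ℂ) * ((((φ s)⁻¹ : SL m ℂ) : Matrix (Fin m) (Fin m) ℂ) *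
              (((φ s ^ p : SL m ℂ) : Matrix (Fin m) (Fin m) ℂ) - 1)) =
            (φ (w' * s⁻¹) : Matrix (Fin m) (Fin m) ℂ) - (φ (u' * s ^ (p - 1)) : Matrix (Fin m) (Fin m) ℂ) := by
          have e1 : (((φ s)⁻¹ : SL m ℂ) : Matrix (Fin m) (Fin m) ℂ) * ((φ s ^ p : SL m ℂ) : Matrix (Fin m) (Fin m) ℂ)
              = ((φ s ^ (p - 1) : SL m ℂ) : Matrix (Fin m) (Fin m) ℂ) := by
            rw [← Matrix.SpecialLinearGroup.coe_mul]
            congr 1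
            obtain ⟨q, rfl⟩ : ∃ q, p = q + 1 := ⟨p - 1, by omega⟩
            rw [pow_succ', inv_mul_cancel_left, Nat.add_sub_cancel]
          rw [coe_map_mul, coe_map_mul, map_inv, map_pow, mul_sub ((((φ s)⁻¹ : SL m ℂ) : Matrix (Fin m) (Fin m) ℂ)), e1, mul_one, mul_sub, sub_mul]
          abel
        rw [heq] at t3
        refine t3.mono ?_
        have : (m : ℝ) * (C * (m * (C' * (η / (2 * E))))) ≤ η / 2 := by
          rw [show (m : ℝ) * (C * (m * (C' * (η / (2 * E))))) = η * (m * (C * (m * C'))) / (2 * E) by ring,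
            div_le_div_iff₀ (by positivity) (by norm_num)]
          nlinarith
        linarith

theorem words_bd (m : ℕ) (C : ℝ) (hC : 1 ≤ C) (l : ℕ) : ∃ n : ℕ, l ≤ n ∧
    ∀ {G : Type} [Group G] (φ : G →* SL m ℂ) (X : Set G), (1 : G) ∈ X →
    (∀ g ∈ X ^ n, Bd cabs C (φ g : Matrix (Fin m) (Fin m) ℂ)) → ∀ w ∈ (X ∪ X⁻¹) ^ l,
      Bd cabs (C + 1) (φ w : Matrix (Fin m) (Fin m) ℂ) := by
  obtain ⟨n, hn⟩ := approx m C hC l 1 one_pos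
  refine ⟨n + l, by omega, ?_⟩
  intro G _ φ X h1 hb w hw
  obtain ⟨u, hu, hd⟩ := hn φ X h1 (fun g hg => hb g (pow_subset h1 (by omega) hg)) w hw
  have := hd.add (hb u (pow_subset h1 (by omega) hu))
  rw [sub_add_cancel] at this
  exact this.mono (by linarith)

/-- commutator estimate -/
theorem comm_est {m : ℕ} {c ε : ℝ} (hc : 0 ≤ c) (hε : 0 ≤ ε) (x g : SL m ℂ)
    (h1 : Bd cabs c (g : Matrix (Fin m) (Fin m) ℂ))
    (h2 : Bd cabs c ((g⁻¹ : SL m ℂ) : Matrix (Fin m) (Fin m) ℂ))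
    (h3 : Bd cabs c ((x⁻¹ * (g * x * g⁻¹)⁻¹ : SL m ℂ) : Matrix (Fin m) (Fin m) ℂ))
    (h4 : Bd cabs ε ((x : Matrix (Fin m) (Fin m) ℂ) - 1)) :
    Bd cabs (2 * m ^ 4 * c ^ 3 * ε ^ 2)
      (((x * (g * x * g⁻¹) * x⁻¹ * (g * x * g⁻¹)⁻¹ : SL m ℂ) : Matrix (Fin m) (Fin m) ℂ) - 1) := by
  set d : Matrix (Fin m) (Fin m) ℂ := (x : Matrix (Fin m) (Fin m) ℂ) - 1 with hd
  set x' : SL m ℂ := g * x * g⁻¹ with hx'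
  have hd' : (x' : Matrix (Fin m) (Fin m) ℂ) - 1 = (g : Matrix (Fin m) (Fin m) ℂ) * d *
      ((g⁻¹ : SL m ℂ) : Matrix (Fin m) (Fin m) ℂ) := by
    rw [hd, mul_sub, sub_mul, mul_one, ← Matrix.SpecialLinearGroup.coe_mul, ← Matrix.SpecialLinearGroup.coe_mul,
      ← Matrix.SpecialLinearGroup.coe_mul, mul_inv_cancel, Matrix.SpecialLinearGroup.coe_one]
  have b1 : Bd cabs (m * ((m * (c * ε)) * c)) ((x' : Matrix (Fin m) (Fin m) ℂ) - 1) := by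
    rw [hd']
    exact (h1.mul h4 hc).mul h2 (by positivity)
  clear_value x'
  have b2 := (h4.mul b1 hε).sub (b1.mul h4 (by positivity))
  have b3 := b2.mul h3 (by positivity)
  have heq : (d * ((x' : Matrix (Fin m) (Fin m) ℂ) - 1) - ((x' : Matrix (Fin m) (Fin m) ℂ) - 1) * d) *
      ((x⁻¹ * x'⁻¹ : SL m ℂ) : Matrix (Fin m) (Fin m) ℂ) =
      ((x * x' * x⁻¹ * x'⁻¹ : SL m ℂ) : Matrix (Fin m) (Fin m) ℂ) - 1 := by
    have e1 : d * ((x' : Matrix (Fin m) (Fin m) ℂ) - 1) - ((x' : Matrix (Fin m) (Fin m) ℂ) - 1) * d =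
        ((x * x' : SL m ℂ) : Matrix (Fin m) (Fin m) ℂ) - ((x' * x : SL m ℂ) : Matrix (Fin m) (Fin m) ℂ) := by
      rw [hd, Matrix.SpecialLinearGroup.coe_mul, Matrix.SpecialLinearGroup.coe_mul]
      noncomm_ring
    rw [e1, sub_mul, ← Matrix.SpecialLinearGroup.coe_mul, ← Matrix.SpecialLinearGroup.coe_mul]
    congr 1
    · rw [show x * x' * (x⁻¹ * x'⁻¹) = x * x' * x⁻¹ * x'⁻¹ from (mul_assoc _ _ _).symm]
    · rw [show x' * x * (x⁻¹ * x'⁻¹) = 1 by group, Matrix.SpecialLinearGroup.coe_one]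
  rw [heq] at b3
  refine b3.mono (le_of_eq ?_)
  ring

end LD

end

section
namespace LD

theorem norm_prod_lt_one (s : Multiset ℂ) (hs : ∀ a ∈ s, ‖a‖ < 1) (h0 : s ≠ 0) : ‖s.prod‖ < 1 := by
  induction s using Multiset.induction_on with
  | empty => exact absurd rfl h0
  | cons a s ih =>
    rw [Multiset.prod_cons, norm_mul]
    have ha := hs a (Multiset.mem_cons_self a s)
    by_cases hs0 : s = 0
    · subst hs0; simpa using ha
    · have := ih (fun b hb => hs b (Multiset.mem_cons_of_mem hb)) hs0
      nlinarith [norm_nonneg a, norm_nonneg s.prod]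

theorem small_int {K : Type} [Field K] [CharZero K] [Countable K] (z : K) (hz : IsIntegral ℤ z)
    (h : ∀ σ : K →+* ℂ, ‖σ z‖ < 1) : z = 0 := by
  have hzQ : IsIntegral ℚ z := hz.tower_top
  have hmap : minpoly ℚ z = (minpoly ℤ z).map (algebraMap ℤ ℚ) := minpoly.isIntegrallyClosed_eq_field_fractions' ℚ hz
  set f := minpoly ℚ z with hf
  let g : Polynomial ℂ := f.map (algebraMap ℚ ℂ)
  have hmon : f.Monic := minpoly.monic hzQ
  have hgm : g.Monic := hmon.map _
  have hunc : Uncountable ℂ := by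
    rw [← Cardinal.aleph0_lt_mk_iff]
    exact Cardinal.aleph0_lt_continuum.trans_le (continuum_le_cardinal_of_nontriviallyNormedField ℂ)
  have hroot : ∀ a ∈ g.roots, ‖a‖ < 1 := by
    intro a ha
    have h3 : Polynomial.aeval a f = 0 := by
      have := (Polynomial.mem_roots'.mp ha).2
      rwa [Polynomial.IsRoot.def, Polynomial.eval_map_algebraMap] at this
    obtain ⟨σ, hσ⟩ := ext_alg (F := ℚ) z a hzQ h3
    rw [← hσ]
    exact h σ
  have hdeg : 0 < g.natDegree := by
    rw [Polynomial.natDegree_map]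
    exact minpoly.natDegree_pos hzQ
  have hsp := IsAlgClosed.splits g
  have hne : g.roots ≠ 0 := by
    intro h0
    have h1 := hsp.natDegree_eq_card_roots
    rw [h0] at h1
    simp at h1
    omega
  have hco := hsp.coeff_zero_eq_prod_roots_of_monic hgm
  have hlt : ‖g.coeff 0‖ < 1 := by
    rw [hco, norm_mul, norm_pow, norm_neg, norm_one, one_pow, one_mul]
    exact norm_prod_lt_one _ hroot hne
  have hint : g.coeff 0 = (((minpoly ℤ z).coeff 0 : ℤ) : ℂ) := by
    simp only [g]
    rw [Polynomial.coeff_map, hmap, Polynomial.coeff_map]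
    simp
  rw [hint, Complex.norm_intCast] at hlt
  have h0 : (minpoly ℤ z).coeff 0 = 0 := by
    have : |(minpoly ℤ z).coeff 0| < 1 := by exact_mod_cast hlt
    exact Int.abs_lt_one_iff.mp this
  have h00 : f.coeff 0 = 0 := by
    rw [hmap, Polynomial.coeff_map, h0, map_zero]
  exact (minpoly.coeff_zero_eq_zero hzQ).mp h00

theorem eigen_pow {K : Type} [Field K] {m : ℕ} (A : Matrix (Fin m) (Fin m) K) (e : ℕ) (hA : A ^ e = 1) (t : K)
    (ht : A.charpoly.IsRoot t) : t ^ e = 1 := by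
  rw [Polynomial.IsRoot.def, Matrix.eval_charpoly] at ht
  obtain ⟨w, hw0, hw⟩ := Matrix.exists_mulVec_eq_zero_iff.mpr ht
  rw [Matrix.sub_mulVec, sub_eq_zero] at hw
  have hw1 : A *ᵥ w = t • w := by
    rw [← hw]
    ext i; simp [Matrix.scalar_apply, Matrix.mulVec_diagonal]
  have hp : ∀ n : ℕ, (A ^ n) *ᵥ w = t ^ n • w := by
    intro n
    induction n with
    | zero => simp
    | succ n ih => rw [pow_succ, ← Matrix.mulVec_mulVec, hw1, Matrix.mulVec_smul, ih, smul_smul, pow_succ, mul_comm]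
  have h1 := hp e
  rw [hA, Matrix.one_mulVec] at h1
  obtain ⟨i, hi⟩ := Function.ne_iff.mp hw0
  have h2 := congrFun h1 i
  simp only [Pi.smul_apply, smul_eq_mul] at h2
  have hi' : w i ≠ 0 := hi
  exact mul_right_cancel₀ hi' (by rw [← h2, one_mul])

theorem finite_of_exponent {K : Type} [Field K] [IsAlgClosed K] {m : ℕ} (Γ : Subgroup (SL m K))
    (hsp : Submodule.span K ((fun g : SL m K => (g : Matrix (Fin m) (Fin m) K)) '' Γ) = ⊤)
    (e : ℕ) (he : 0 < e) (h : ∀ γ ∈ Γ, γ ^ e = 1) : (Γ : Set (SL m K)).Finite := by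
  classical
  let U : Finset K := (Polynomial.nthRoots e (1 : K)).toFinset
  let T : Finset K := ((Multiset.powersetCard m (m • U.val)).map Multiset.sum).toFinset
  refine finite_of_traces Γ hsp T T.finite_toSet (fun γ hγ => ?_)
  have h1 : (γ : Matrix (Fin m) (Fin m) K) ^ e = 1 := by
    have := congrArg (fun g : SL m K => (g : Matrix (Fin m) (Fin m) K)) (h γ hγ)
    simpa using this
  have hcard := (charpoly_eq_prod (γ : Matrix (Fin m) (Fin m) K)).2
  have htr : (γ : Matrix (Fin m) (Fin m) K).trace = (γ : Matrix (Fin m) (Fin m) K).charpoly.roots.sum :=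
    Matrix.trace_eq_sum_roots_charpoly _
  rw [htr, Finset.mem_coe, Multiset.mem_toFinset]
  refine Multiset.mem_map_of_mem _ ?_
  rw [Multiset.mem_powersetCard]
  refine ⟨?_, hcard⟩
  rw [Multiset.le_iff_count]
  intro a
  by_cases ha : a ∈ (γ : Matrix (Fin m) (Fin m) K).charpoly.roots
  · have hr := eigen_pow _ e h1 a (Polynomial.mem_roots'.mp ha).2
    have hU : a ∈ U := by
      simp only [U, Multiset.mem_toFinset]
      exact (Polynomial.mem_nthRoots he).mpr hr
    rw [Multiset.count_nsmul, Multiset.count_eq_one_of_mem U.nodup hU, mul_one]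
    exact (Multiset.count_le_card _ _).trans hcard.le
  · rw [Multiset.count_eq_zero_of_notMem ha]
    exact Nat.zero_le _

section entries
variable {G K : Type} [Group G] [Field K] {m : ℕ}

theorem mul_entry {P Q : Submodule K (G → K)} {X Y : G → Matrix (Fin m) (Fin m) K}
    (hX : ∀ i j, (fun g => X g i j) ∈ P) (hY : ∀ i j, (fun g => Y g i j) ∈ Q) (i j : Fin m) :
    (fun g => (X g * Y g) i j) ∈ P * Q := by
  have : (fun g => (X g * Y g) i j) = ∑ l, (fun g => X g i l) * (fun g => Y g l j) := by
    funext g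
    simp [Matrix.mul_apply, Finset.sum_apply]
  rw [this]
  exact sum_mem fun l _ => Submodule.mul_mem_mul (hX i l) (hY l j)

theorem const_mul_entry {P : Submodule K (G → K)} (A : Matrix (Fin m) (Fin m) K) {X : G → Matrix (Fin m) (Fin m) K}
    (hX : ∀ i j, (fun g => X g i j) ∈ P) (i j : Fin m) : (fun g => (A * X g) i j) ∈ P := by
  have : (fun g => (A * X g) i j) = ∑ l, A i l • (fun g => X g l j) := by
    funext g
    simp [Matrix.mul_apply, Finset.sum_apply]
  rw [this]
  exact sum_mem fun l _ => P.smul_mem _ (hX l j)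

theorem mul_const_entry {P : Submodule K (G → K)} (A : Matrix (Fin m) (Fin m) K) {X : G → Matrix (Fin m) (Fin m) K}
    (hX : ∀ i j, (fun g => X g i j) ∈ P) (i j : Fin m) : (fun g => (X g * A) i j) ∈ P := by
  have : (fun g => (X g * A) i j) = ∑ l, A l j • (fun g => X g i l) := by
    funext g
    simp [Matrix.mul_apply, Finset.sum_apply, mul_comm]
  rw [this]
  exact sum_mem fun l _ => P.smul_mem _ (hX i l)

theorem const_mem_pow (φ : G →* SL m K) (D : ℕ) (c : K) : (fun _ => c : G → K) ∈ E1 φ ^ D := by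
  have h0 : (1 : G → K) ∈ E1 φ ^ D := pow_mono_E1 φ (Nat.zero_le D) (by
    rw [pow_zero]; exact Submodule.one_le.mp le_rfl)
  have := (E1 φ ^ D).smul_mem c h0
  convert this using 1
  funext g; simp

theorem pow_entry (φ : G →* SL m K) (e : ℕ) (i j : Fin m) :
    (fun g => ((φ g : Matrix (Fin m) (Fin m) K) ^ e) i j) ∈ E1 φ ^ e := by
  induction e generalizing i j with
  | zero =>
    simp only [pow_zero]
    exact const_mem_pow φ 0 _
  | succ e ih =>
    simp only [pow_succ]
    exact mul_entry ih (entry_mem_E1 φ) i j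

theorem adj_entry (φ : G →* SL m K) (i j : Fin m) :
    (fun g => ((φ g : Matrix (Fin m) (Fin m) K).adjugate) i j) ∈ E1 φ ^ m := by
  have : (fun g => ((φ g : Matrix (Fin m) (Fin m) K).adjugate) i j) =
      fun g => ((φ g : Matrix (Fin m) (Fin m) K).updateRow j (Pi.single i 1)).det := by
    funext g
    rw [Matrix.adjugate_apply]
  rw [this]
  apply det_mem_pow
  intro a b
  by_cases hab : a = j
  · subst hab
    simp only [Matrix.updateRow_self]
    exact const_mem_E1 φ _
  · simp only [Matrix.updateRow_ne hab]
    exact entry_mem_E1 φ a b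

end entries

/-- escape from a power relation -/
theorem escape_pow {K : Type} [Field K] {m : ℕ} (S : Set (SL m K)) (h1 : (1 : SL m K) ∈ S) (e : ℕ)
    (h : ∀ g ∈ S ^ ((m ^ 2 + 1) ^ e), g ^ e = 1) : ∀ g ∈ Subgroup.closure S, g ^ e = 1 := by
  intro g hg
  apply coe_injective
  ext i j
  let φ : SL m K →* SL m K := MonoidHom.id _
  have := fd_E1_pow φ e
  have hF := (E1 φ ^ e).sub_mem (pow_entry φ e i j) (const_mem_pow φ e ((1 : Matrix (Fin m) (Fin m) K) i j))
  have key := escape (E1 φ ^ e) (tinv_pow φ e) S h1 _ (finrank_E1_pow φ e) _ hF (fun g hg => by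
    have h2 := congrArg (fun g : SL m K => (g : Matrix (Fin m) (Fin m) K) i j) (h g hg)
    simp only [Matrix.SpecialLinearGroup.coe_pow, Matrix.SpecialLinearGroup.coe_one] at h2
    simp only [Pi.sub_apply, φ, MonoidHom.id_apply]
    rw [h2, sub_self]) g hg
  simp only [Pi.sub_apply, φ, MonoidHom.id_apply, sub_eq_zero] at key
  simpa using key

theorem escape_comm {K : Type} [Field K] {m : ℕ} (S : Set (SL m K)) (h1 : (1 : SL m K) ∈ S) (y : SL m K)
    (h : ∀ g ∈ S ^ ((m ^ 2 + 1) ^ (1 + m)), y * (g * y * g⁻¹) = (g * y * g⁻¹) * y) :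
    ∀ g ∈ Subgroup.closure S, y * (g * y * g⁻¹) = (g * y * g⁻¹) * y := by
  intro g hg
  apply coe_injective
  ext i j
  let φ : SL m K →* SL m K := MonoidHom.id _
  have := fd_E1_pow φ (1 + m)
  let Y : Matrix (Fin m) (Fin m) K := y
  have hX : ∀ i j, (fun g => ((φ g : Matrix (Fin m) (Fin m) K) * Y * (φ g : Matrix (Fin m) (Fin m) K).adjugate) i j)
      ∈ E1 φ ^ (1 + m) := by
    intro i j
    rw [pow_add, pow_one]
    exact mul_entry (mul_const_entry Y (entry_mem_E1 φ)) (adj_entry φ) i j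
  have hF := (E1 φ ^ (1 + m)).sub_mem (const_mul_entry Y hX i j) (mul_const_entry Y hX i j)
  have key := escape (E1 φ ^ (1 + m)) (tinv_pow φ (1 + m)) S h1 _ (finrank_E1_pow φ (1 + m)) _ hF (fun g hg => by
    have h2 := congrArg (fun g : SL m K => (g : Matrix (Fin m) (Fin m) K) i j) (h g hg)
    simp only [Matrix.SpecialLinearGroup.coe_mul, Matrix.SpecialLinearGroup.coe_inv] at h2
    simp only [Pi.sub_apply, φ, MonoidHom.id_apply, Y]
    rw [h2, sub_self]) g hg
  simp only [Pi.sub_apply, φ, MonoidHom.id_apply, sub_eq_zero, Y] at key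
  simp only [Matrix.SpecialLinearGroup.coe_mul, Matrix.SpecialLinearGroup.coe_inv]
  exact key

theorem escape_trace {K : Type} [Field K] {m : ℕ} (S : Set (SL m K)) (h1 : (1 : SL m K) ∈ S)
    (hsp : Submodule.span K ((fun g : SL m K => (g : Matrix (Fin m) (Fin m) K)) ''
      (Subgroup.closure S : Set (SL m K))) = ⊤)
    (A : Matrix (Fin m) (Fin m) K) (hA : A ≠ 0) :
    ∃ x ∈ S ^ (m ^ 2 + 1), (A * (x : Matrix (Fin m) (Fin m) K)).trace ≠ 0 := by
  by_contra hcon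
  push Not at hcon
  apply hA
  let φ : SL m K →* SL m K := MonoidHom.id _
  have := fd_E1_pow φ 1
  have hF : (fun g => (A * (φ g : Matrix (Fin m) (Fin m) K)).trace) ∈ E1 φ ^ 1 := by
    have e : (fun g => (A * (φ g : Matrix (Fin m) (Fin m) K)).trace) =
        ∑ i, fun g => (A * (φ g : Matrix (Fin m) (Fin m) K)) i i := by
      funext g
      simp [Matrix.trace, Finset.sum_apply]
    rw [e, pow_one]
    exact sum_mem fun i _ => const_mul_entry A (entry_mem_E1 φ) i i
  have key := escape (E1 φ ^ 1) (tinv_pow φ 1) S h1 (m ^ 2 + 1)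
    (by simpa using finrank_E1_pow φ 1) _ hF (fun g hg => hcon g hg)
  apply eq_of_traces hsp
  rintro _ ⟨g, hg, rfl⟩
  have := key g hg
  simp only [φ, MonoidHom.id_apply] at this
  rw [zero_mul, Matrix.trace_zero]
  exact this

end LD

end

section
namespace LD

theorem root_gap (m : ℕ) (hm : 0 < m) : ∃ δ : ℝ, 0 < δ ∧ ∀ z : ℂ, z ^ m = 1 → ‖z - 1‖ < δ → z = 1 := by
  have hfin : {z : ℂ | z ^ m = 1 ∧ z ≠ 1}.Finite := by
    refine (Polynomial.nthRoots m (1 : ℂ)).toFinset.finite_toSet.subset ?_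
    intro z hz
    rw [Finset.mem_coe, Multiset.mem_toFinset]
    exact (Polynomial.mem_nthRoots hm).mpr hz.1
  have hn : {z : ℂ | z ^ m = 1 ∧ z ≠ 1}ᶜ ∈ nhds (1 : ℂ) :=
    hfin.isClosed.isOpen_compl.mem_nhds (fun h => h.2 rfl)
  obtain ⟨δ, hδ, hb⟩ := Metric.mem_nhds_iff.mp hn
  refine ⟨δ, hδ, fun z hz hd => ?_⟩
  by_contra hne
  exact hb (show z ∈ Metric.ball (1 : ℂ) δ by rwa [Metric.mem_ball, dist_eq_norm]) ⟨hz, hne⟩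

/-- scalar elements of the special linear group -/
def IsSc {m : ℕ} {K : Type} [Field K] (g : SL m K) : Prop :=
  ∃ c : K, (g : Matrix (Fin m) (Fin m) K) = c • 1

theorem IsSc.root {m : ℕ} {K : Type} [Field K] {g : SL m K} {c : K}
    (h : (g : Matrix (Fin m) (Fin m) K) = c • 1) : c ^ m = 1 := by
  have h2 := g.2
  rw [h, Matrix.det_smul, Matrix.det_one] at h2
  simpa using h2

theorem IsSc.pow_eq {m : ℕ} {K : Type} [Field K] {g : SL m K} (h : IsSc g) : g ^ m = 1 := by
  obtain ⟨c, hc⟩ := h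
  apply coe_injective
  have := IsSc.root hc
  simp only [Matrix.SpecialLinearGroup.coe_pow, Matrix.SpecialLinearGroup.coe_one]
  rw [hc, smul_pow, this, one_smul, one_pow]

/-- a compatible family of bounded complex representations -/
structure Fam {m : ℕ} {K : Type} [Field K] (Φ : (K →+* ℂ) → (SL m K →* SL m ℂ)) (T : Set (SL m K)) (ℓ : ℕ)
    (c : ℝ) : Prop where
  sc : ∀ σ (g : SL m K) (ω : K), (g : Matrix (Fin m) (Fin m) K) = ω • 1 →
    (Φ σ g : Matrix (Fin m) (Fin m) ℂ) = σ ω • 1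
  tr : ∀ σ (g x : SL m K),
    σ ((((g : Matrix (Fin m) (Fin m) K) - 1) * (x : Matrix (Fin m) (Fin m) K)).trace) =
      (((Φ σ g : Matrix (Fin m) (Fin m) ℂ) - 1) * (Φ σ x : Matrix (Fin m) (Fin m) ℂ)).trace
  bd : ∀ σ, ∀ w ∈ T ^ ℓ, Bd cabs c (Φ σ w : Matrix (Fin m) (Fin m) ℂ)

theorem inv_mem_T {G : Type} [Group G] {T : Set G} (hT : T⁻¹ = T) (n : ℕ) {g : G} (hg : g ∈ T ^ n) : g⁻¹ ∈ T ^ n := by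
  have : (T ^ n)⁻¹ = T ^ n := by rw [← inv_pow, hT]
  rw [← this]
  simpa using hg

theorem comm_eq_one {G : Type} [Group G] {x y : G} (h : x * y * x⁻¹ * y⁻¹ = 1) : x * y = y * x := by
  have := congrArg (fun z => z * y * x) h
  simpa [mul_assoc] using this

theorem comm_inv_form {G : Type} [Group G] (y g : G) : y⁻¹ * (g * y * g⁻¹)⁻¹ = y⁻¹ * (g * y⁻¹ * g⁻¹) := by group

theorem fam_step {m : ℕ} (hm : 0 < m) {K : Type} [Field K] [IsAlgClosed K] 
    {Φ : (K →+* ℂ) → (SL m K →* SL m ℂ)} {S T : Set (SL m K)} {ℓ : ℕ} {c : ℝ} (hc : 1 ≤ c)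
    (hΦ : Fam Φ T ℓ c) (hT : T⁻¹ = T) (hST : S ⊆ T) (h1 : (1 : SL m K) ∈ S) {R : ℕ} (hR : m ≤ R)
    (hspan : SpanR R (Subgroup.closure S)) {δ ε0 : ℝ}
    (hδ : ∀ z : ℂ, z ^ m = 1 → ‖z - 1‖ < δ → z = 1) (hεδ : ε0 < δ)
    (hε0 : 2 * (2 * m ^ 4 * c ^ 3) * ε0 ≤ 1) {L : ℕ} {M : ℕ} (hM : M = (m ^ 2 + 1) ^ (1 + m))
    (hℓ : 4 * L + 4 * M ≤ ℓ) (y : SL m K) (hy : y ∈ T ^ L) (hns : ¬ IsSc y) (σ0 : K →+* ℂ)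
    (hσ0 : Bd cabs ε0 ((Φ σ0 y : Matrix (Fin m) (Fin m) ℂ) - 1)) :
    ∃ y' ∈ T ^ (4 * L + 4 * M), ¬ IsSc y' ∧ ∀ σ, ∀ ε : ℝ, 0 ≤ ε → ε ≤ ε0 →
      Bd cabs ε ((Φ σ y : Matrix (Fin m) (Fin m) ℂ) - 1) →
      Bd cabs (ε / 2) ((Φ σ y' : Matrix (Fin m) (Fin m) ℂ) - 1) := by
  have h1T : (1 : SL m K) ∈ T := hST h1
  obtain ⟨g, hg, hgne⟩ : ∃ g ∈ S ^ M, y * (g * y * g⁻¹) ≠ (g * y * g⁻¹) * y := by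
    by_contra hcon
    push Not at hcon
    subst hM
    exact hns (comm_scalar hm _ hspan hR y (escape_comm S h1 y hcon))
  have hgT : g ∈ T ^ M := Set.pow_subset_pow_left hST hg
  have hgi := inv_mem_T hT M hgT
  have hyi := inv_mem_T hT L hy
  have hconj : g * y * g⁻¹ ∈ T ^ (M + L + M) := by
    rw [pow_add, pow_add]; exact Set.mul_mem_mul (Set.mul_mem_mul hgT hy) hgi
  have hconji := inv_mem_T hT _ hconj
  have hy' : y * (g * y * g⁻¹) * y⁻¹ * (g * y * g⁻¹)⁻¹ ∈ T ^ (4 * L + 4 * M) := by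
    have : 4 * L + 4 * M = L + (M + L + M) + L + (M + L + M) := by ring
    rw [this, pow_add, pow_add, pow_add]
    exact Set.mul_mem_mul (Set.mul_mem_mul (Set.mul_mem_mul hy hconj) hyi) hconji
  have hx3 : y⁻¹ * (g * y * g⁻¹)⁻¹ ∈ T ^ (L + (M + L + M)) := by
    rw [pow_add]; exact Set.mul_mem_mul hyi hconji
  have hbd : ∀ σ, ∀ ε : ℝ, 0 ≤ ε → ε ≤ ε0 →
      Bd cabs ε ((Φ σ y : Matrix (Fin m) (Fin m) ℂ) - 1) →
      Bd cabs (ε / 2) ((Φ σ (y * (g * y * g⁻¹) * y⁻¹ * (g * y * g⁻¹)⁻¹) : Matrix (Fin m) (Fin m) ℂ) - 1) := by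
    intro σ ε hε hle hb
    have e1 := comm_est (by linarith) hε (Φ σ y) (Φ σ g) (hΦ.bd σ g (pow_subset h1T (by omega) hgT))
      (by rw [← map_inv]; exact hΦ.bd σ _ (pow_subset h1T (by omega) hgi))
      (by
        have := hΦ.bd σ _ (pow_subset h1T (by omega) hx3)
        rw [map_mul, map_inv, map_inv, map_mul, map_mul, map_inv] at this
        exact this) hb
    have e2 : Φ σ (y * (g * y * g⁻¹) * y⁻¹ * (g * y * g⁻¹)⁻¹) =
        Φ σ y * (Φ σ g * Φ σ y * (Φ σ g)⁻¹) * (Φ σ y)⁻¹ * (Φ σ g * Φ σ y * (Φ σ g)⁻¹)⁻¹ := by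
      simp only [map_mul, map_inv]
    rw [e2]
    refine e1.mono ?_
    have h5 : 0 ≤ 2 * (m : ℝ) ^ 4 * c ^ 3 := by positivity
    have h6 := mul_le_mul_of_nonneg_left hle h5
    nlinarith
  refine ⟨_, hy', ?_, hbd⟩
  rintro ⟨ω, hω⟩
  have hroot := IsSc.root hω
  have hε00 : 0 ≤ ε0 := hσ0.nonneg ⟨0, hm⟩
  have hb0 := hbd σ0 ε0 hε00 le_rfl hσ0
  have hsc := hΦ.sc σ0 _ ω hω
  have e00 := hb0 ⟨0, hm⟩ ⟨0, hm⟩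
  rw [hsc] at e00
  simp only [Matrix.sub_apply, Matrix.smul_apply, Matrix.one_apply_eq, smul_eq_mul, mul_one, cabs_apply] at e00
  have hone : σ0 ω = 1 := hδ _ (by rw [← map_pow, hroot, map_one]) (by linarith)
  have hω1 : ω = 1 := σ0.injective (by rw [hone, map_one])
  rw [hω1, one_smul] at hω
  have hy1 : y * (g * y * g⁻¹) * y⁻¹ * (g * y * g⁻¹)⁻¹ = 1 := coe_injective hω
  exact hgne (comm_eq_one hy1)

theorem fam_iter {m : ℕ} (hm : 0 < m) {K : Type} [Field K] [IsAlgClosed K] 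
    {Φ : (K →+* ℂ) → (SL m K →* SL m ℂ)} {S T : Set (SL m K)} {ℓ : ℕ} {c : ℝ} (hc : 1 ≤ c)
    (hΦ : Fam Φ T ℓ c) (hT : T⁻¹ = T) (hST : S ⊆ T) (h1 : (1 : SL m K) ∈ S) {R : ℕ} (hR : m ≤ R)
    (hspan : SpanR R (Subgroup.closure S)) {δ ε0 : ℝ}
    (hδ : ∀ z : ℂ, z ^ m = 1 → ‖z - 1‖ < δ → z = 1) (hεδ : ε0 < δ)
    (hε0 : 2 * (2 * m ^ 4 * c ^ 3) * ε0 ≤ 1) {L : ℕ} {M : ℕ} (hM : M = (m ^ 2 + 1) ^ (1 + m))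
    (y : SL m K) (hy : y ∈ T ^ L) (hns : ¬ IsSc y) (σ0 : K →+* ℂ)
    (hσ0 : Bd cabs ε0 ((Φ σ0 y : Matrix (Fin m) (Fin m) ℂ) - 1)) (l : ℕ) (hℓ : 8 ^ l * (L + M) ≤ ℓ) :
    ∃ y' ∈ T ^ (8 ^ l * (L + M)), ¬ IsSc y' ∧ ∀ σ,
      Bd cabs ε0 ((Φ σ y : Matrix (Fin m) (Fin m) ℂ) - 1) →
      Bd cabs (ε0 / 2 ^ l) ((Φ σ y' : Matrix (Fin m) (Fin m) ℂ) - 1) := by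
  have h1T : (1 : SL m K) ∈ T := hST h1
  have hε00 : 0 ≤ ε0 := hσ0.nonneg ⟨0, hm⟩
  induction l with
  | zero =>
    exact ⟨y, pow_subset h1T (by omega) hy, hns, fun σ h => by simpa using h⟩
  | succ l ih =>
    have h8 : 1 ≤ 8 ^ l := Nat.one_le_pow _ _ (by norm_num)
    have hXM : M ≤ 8 ^ l * (L + M) := by nlinarith
    have hX : 8 ^ (l + 1) * (L + M) = 8 * (8 ^ l * (L + M)) := by ring
    rw [hX] at hℓ ⊢
    obtain ⟨z, hz, hzns, hzb⟩ := ih (by omega)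
    have hle : ε0 / 2 ^ l ≤ ε0 := div_le_self hε00 (one_le_pow₀ (by norm_num))
    obtain ⟨z', hz', hz'ns, hz'b⟩ := fam_step hm hc hΦ hT hST h1 hR hspan hδ hεδ hε0 hM
      (by omega) z hz hzns σ0 ((hzb σ0 hσ0).mono hle)
    refine ⟨z', pow_subset h1T (by omega) hz', hz'ns, fun σ hσ => ?_⟩
    have := hz'b σ (ε0 / 2 ^ l) (by positivity) hle (hzb σ hσ)
    rw [pow_succ, ← div_div]
    exact this

end LD

end

section
namespace LD

theorem fam_exists {m : ℕ} {C : ℝ} {N0 : ℕ} (hA : ThA m C N0) {K : Type} [Field K] {X : Set (SL m K)} (hX : X.Finite)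
    (h1 : (1 : SL m K) ∈ X) (hspan : SpanR ((m ^ 2 + 1) ^ m) (Subgroup.closure X))
    (hfree : ¬ HasFree X N0) : ∃ Φ : (K →+* ℂ) → (SL m K →* SL m ℂ), Fam Φ X 1 C := by
  have hex : ∀ σ : K →+* ℂ, ∃ φ : SL m K →* SL m ℂ, 
      (∀ (g : SL m K) (ω : K), (g : Matrix (Fin m) (Fin m) K) = ω • 1 →
        (φ g : Matrix (Fin m) (Fin m) ℂ) = σ ω • 1) ∧
      (∀ (g x : SL m K), σ ((((g : Matrix (Fin m) (Fin m) K) - 1) * (x : Matrix (Fin m) (Fin m) K)).trace) =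
        (((φ g : Matrix (Fin m) (Fin m) ℂ) - 1) * (φ x : Matrix (Fin m) (Fin m) ℂ)).trace) ∧
      ∀ w ∈ X ^ 1, Bd cabs C (φ w : Matrix (Fin m) (Fin m) ℂ) := by
    intro σ
    obtain ⟨h, k, hk, hb⟩ := hA.apply σ cabs hX h1 hspan hfree
    have hkh : k * h = 1 := mul_eq_one_comm.mp hk
    have hco : ∀ g : SL m K, (((conjHom h k hk).comp (slMap m σ)) g : Matrix (Fin m) (Fin m) ℂ) =
      h * (g : Matrix (Fin m) (Fin m) K).map σ * k := fun g => rfl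
    refine ⟨(conjHom h k hk).comp (slMap m σ), ?_, ?_, ?_⟩
    · intro g ω hg
      rw [hco, hg]
      have : (ω • (1 : Matrix (Fin m) (Fin m) K)).map σ = σ ω • 1 := by
        ext i j
        by_cases hij : i = j
        · subst hij; simp
        · simp [hij]
      rw [this, mul_smul_comm, mul_one, smul_mul_assoc, hk]
    · intro g x
      rw [hco, hco]
      have e1 : h * (g : Matrix (Fin m) (Fin m) K).map σ * k - 1 =
          h * ((g : Matrix (Fin m) (Fin m) K) - 1).map σ * k := by
        rw [Matrix.map_sub _ (map_sub σ), Matrix.map_one _ (map_zero σ) (map_one σ), mul_sub, sub_mul, mul_one, hk]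
      rw [e1]
      have e2 : h * ((g : Matrix (Fin m) (Fin m) K) - 1).map σ * k * (h * (x : Matrix (Fin m) (Fin m) K).map σ * k) =
          h * (((g : Matrix (Fin m) (Fin m) K) - 1) * (x : Matrix (Fin m) (Fin m) K)).map σ * k := by
        rw [Matrix.map_mul]
        calc h * ((g : Matrix (Fin m) (Fin m) K) - 1).map σ * k * (h * (x : Matrix (Fin m) (Fin m) K).map σ * k)
            = h * ((g : Matrix (Fin m) (Fin m) K) - 1).map σ * (k * h) * (x : Matrix (Fin m) (Fin m) K).map σ * k := by
              simp only [mul_assoc]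
          _ = _ := by rw [hkh, mul_one]; simp only [mul_assoc]
      rw [e2, Matrix.trace_mul_comm (h * _) k, ← mul_assoc, hkh, one_mul]
      simp only [Matrix.trace, Matrix.diag_apply, Matrix.map_apply, map_sum]
    · intro w hw
      rw [pow_one] at hw
      exact hb w hw
  choose Φ h2 h3 h4 using hex
  exact ⟨Φ, h2, h3, h4⟩

theorem caseA {m : ℕ} (hm : 0 < m) {K : Type} [Field K] [IsAlgClosed K] [CharZero K] [Countable K]
    {Φ : (K →+* ℂ) → (SL m K →* SL m ℂ)} {S T : Set (SL m K)} {ℓ : ℕ} {c : ℝ} (hc : 1 ≤ c)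
    (hΦ : Fam Φ T ℓ c) (hT : T⁻¹ = T) (hST : S ⊆ T) (hTS : T ⊆ Subgroup.closure S)
    (h1 : (1 : SL m K) ∈ S) {R : ℕ} (hR : m ≤ R)
    (hspan : SpanR R (Subgroup.closure S))
    (hint : ∀ g ∈ Subgroup.closure S, IsIntegral ℤ (g : Matrix (Fin m) (Fin m) K).trace)
    {δ ε0 : ℝ}
    (hδ : ∀ z : ℂ, z ^ m = 1 → ‖z - 1‖ < δ → z = 1) (hεδ : ε0 < δ)
    (hε0 : 2 * (2 * m ^ 4 * c ^ 3) * ε0 ≤ 1) (hpos : 0 < ε0) (hε1 : ε0 ≤ 1)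
    {M : ℕ} (hM : M = (m ^ 2 + 1) ^ (1 + m))
    {J L l : ℕ} (hℓ : 8 ^ l * (L + M) + (m ^ 2 + 1) ≤ ℓ) {D : ℝ} (hD1 : 1 ≤ D) (hD : m * (m * ((c + 1) * c)) ≤ D)
    (hl : m * (m * c) * D ^ J < 2 ^ l)
    (a : SL m K) (ha : ∀ i ≤ J, a ^ i ∈ T ^ L)
    (hns : ∀ i, 1 ≤ i → i ≤ J → ¬ IsSc (a ^ i))
    (hpig : ∀ σ, ∃ i, 1 ≤ i ∧ i ≤ J ∧ Bd cabs ε0 ((Φ σ (a ^ i) : Matrix (Fin m) (Fin m) ℂ) - 1)) : False := by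
  classical
  have h1T : (1 : SL m K) ∈ T := hST h1
  have hTn : ∀ n, T ^ n ⊆ Subgroup.closure S := by
    intro n g hg
    have h3 := pow_subset_closure T n hg
    exact (Subgroup.closure_le _).mpr hTS h3
  have hz : ∀ i : ℕ, ∃ z : K, 1 ≤ i → i ≤ J → z ≠ 0 ∧ IsIntegral ℤ z ∧ (∀ σ : K →+* ℂ, ‖σ z‖ ≤ D) ∧
      ∀ σ : K →+* ℂ, Bd cabs ε0 ((Φ σ (a ^ i) : Matrix (Fin m) (Fin m) ℂ) - 1) → ‖σ z‖ ≤ m * (m * (ε0 / 2 ^ l * c)) := by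
    intro i
    by_cases hgood : 1 ≤ i ∧ i ≤ J ∧ ∃ σ0 : K →+* ℂ, Bd cabs ε0 ((Φ σ0 (a ^ i) : Matrix (Fin m) (Fin m) ℂ) - 1)
    · obtain ⟨hi1, hiJ, σ0, hσ0⟩ := hgood
      obtain ⟨y, hy, hyns, hyb⟩ := fam_iter hm hc hΦ hT hST h1 hR hspan hδ hεδ hε0 hM (a ^ i) (ha i hiJ)
        (hns i hi1 hiJ) σ0 hσ0 l (by omega)
      have hy1 : (y : Matrix (Fin m) (Fin m) K) - 1 ≠ 0 := by
        intro h0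
        exact hyns ⟨1, by rw [one_smul]; exact sub_eq_zero.mp h0⟩
      obtain ⟨x, hx, hxt⟩ := escape_trace S h1 (hspan.span_top (by omega)) _ hy1
      have hxT : x ∈ T ^ (m ^ 2 + 1) := Set.pow_subset_pow_left hST hx
      have hxb : ∀ σ, Bd cabs c (Φ σ x : Matrix (Fin m) (Fin m) ℂ) := fun σ =>
        hΦ.bd σ x (pow_subset h1T (by omega) hxT)
      have hyc : ∀ σ, Bd cabs (c + 1) ((Φ σ y : Matrix (Fin m) (Fin m) ℂ) - 1) := fun σ =>
        (hΦ.bd σ y (pow_subset h1T (by omega) hy)).sub Bd.one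
      refine ⟨_, fun _ _ => ⟨hxt, ?_, fun σ => ?_, fun σ hσ => ?_⟩⟩
      · rw [sub_mul, one_mul, Matrix.trace_sub, ← Matrix.SpecialLinearGroup.coe_mul]
        exact (hint _ (mul_mem (hTn _ hy) (hTn _ hxT))).sub (hint _ (hTn _ hxT))
      · rw [hΦ.tr σ y x]
        exact (((hyc σ).mul (hxb σ) (by linarith)).trace).trans hD
      · rw [hΦ.tr σ y x]
        exact ((hyb σ hσ).mul (hxb σ) (by positivity)).trace
    · refine ⟨1, fun hi1 hiJ => ⟨one_ne_zero, isIntegral_one, fun σ => by simpa using hD1, fun σ hσ => ?_⟩⟩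
      exact absurd ⟨hi1, hiJ, σ, hσ⟩ hgood
  choose z hz using hz
  have hprod : ∏ i ∈ Finset.Icc 1 J, z i = 0 := by
    refine small_int _ (IsIntegral.prod _ fun i hi => ?_) fun σ => ?_
    · rw [Finset.mem_Icc] at hi
      exact (hz i hi.1 hi.2).2.1
    · obtain ⟨i, hi1, hiJ, hb⟩ := hpig σ
      have hiI : i ∈ Finset.Icc 1 J := Finset.mem_Icc.mpr ⟨hi1, hiJ⟩
      rw [map_prod, norm_prod, ← Finset.mul_prod_erase _ _ hiI]
      have hs := (hz i hi1 hiJ).2.2.2 σ hb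
      have hr : ∏ x ∈ (Finset.Icc 1 J).erase i, ‖σ (z x)‖ ≤ D ^ J := by
        calc ∏ x ∈ (Finset.Icc 1 J).erase i, ‖σ (z x)‖ ≤ ∏ x ∈ (Finset.Icc 1 J).erase i, D :=
              Finset.prod_le_prod (fun _ _ => norm_nonneg _) (fun x hx => by
                have := Finset.mem_Icc.mp (Finset.mem_of_mem_erase hx)
                exact (hz x this.1 this.2).2.2.1 σ)
          _ = D ^ ((Finset.Icc 1 J).erase i).card := by rw [Finset.prod_const]
          _ ≤ D ^ J := pow_le_pow_right₀ hD1 (by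
                have := Finset.card_erase_le (s := Finset.Icc 1 J) (a := i)
                simpa using this)
      have hD0 : 0 < D ^ J := by positivity
      calc ‖σ (z i)‖ * ∏ x ∈ (Finset.Icc 1 J).erase i, ‖σ (z x)‖ ≤ (m * (m * (ε0 / 2 ^ l * c))) * D ^ J :=
            mul_le_mul hs hr (Finset.prod_nonneg fun _ _ => norm_nonneg _) (by positivity)
        _ = ε0 * (m * (m * c) * D ^ J) / 2 ^ l := by ring
        _ ≤ 1 * (m * (m * c) * D ^ J) / 2 ^ l := by gcongr
        _ < 1 := by
            rw [one_mul, div_lt_one (by positivity)]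
            exact hl
  rw [Finset.prod_eq_zero_iff] at hprod
  obtain ⟨i, hi, hi0⟩ := hprod
  rw [Finset.mem_Icc] at hi
  exact (hz i hi.1 hi.2).1 hi0

theorem closure_pow_eq {G : Type} [Group G] {S : Set G} (h1 : (1 : G) ∈ S) {n : ℕ} (hn : 1 ≤ n) :
    Subgroup.closure (S ^ n) = Subgroup.closure S := by
  apply le_antisymm
  · rw [Subgroup.closure_le]
    exact pow_subset_closure S n
  · apply Subgroup.closure_mono
    have := pow_subset h1 hn
    rwa [pow_one] at this

theorem char0_main {m : ℕ} (hm : 0 < m) {C : ℝ} {N0 : ℕ} (hC : 1 ≤ C) (hA : ThA m C N0) :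
    ∃ N : ℕ, ∀ (K : Type) [Field K] [IsAlgClosed K] [CharZero K] [Countable K] (S : Set (SL m K)), S.Finite →
      (1 : SL m K) ∈ S → SpanR ((m ^ 2 + 1) ^ m) (Subgroup.closure S) →
      (Subgroup.closure S : Set (SL m K)).Infinite → HasFree S N := by
  obtain ⟨δ, hδ0, hδ⟩ := root_gap m hm
  obtain ⟨c, hc⟩ : ∃ c : ℝ, c = C + 1 := ⟨_, rfl⟩
  have hc1 : 1 ≤ c := by linarith
  have hm' : (0 : ℝ) < m := by exact_mod_cast hm
  have hB : 0 < 2 * (2 * (m : ℝ) ^ 4 * c ^ 3) := by positivity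
  obtain ⟨ε0, hε⟩ : ∃ ε0 : ℝ, ε0 = min (δ / 2) (min 1 (1 / (2 * (2 * (m : ℝ) ^ 4 * c ^ 3)))) := ⟨_, rfl⟩
  have hpos : 0 < ε0 := by rw [hε]; positivity
  have hεδ : ε0 < δ := by
    have : ε0 ≤ δ / 2 := by rw [hε]; exact min_le_left _ _
    linarith
  have hε1 : ε0 ≤ 1 := by rw [hε]; exact (min_le_right _ _).trans (min_le_left _ _)
  have hε0 : 2 * (2 * (m : ℝ) ^ 4 * c ^ 3) * ε0 ≤ 1 := by
    have : ε0 ≤ 1 / (2 * (2 * (m : ℝ) ^ 4 * c ^ 3)) := by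
      rw [hε]; exact (min_le_right _ _).trans (min_le_right _ _)
    rw [le_div_iff₀ hB] at this
    linarith
  clear hε
  obtain ⟨J, hJ1, hJ⟩ := pigeon m C ε0 hC hpos
  obtain ⟨e, he⟩ : ∃ e : ℕ, e = m * J.factorial := ⟨_, rfl⟩
  have he0 : 0 < e := by rw [he]; exact Nat.mul_pos hm (Nat.factorial_pos J)
  obtain ⟨M1, hM1⟩ : ∃ M1 : ℕ, M1 = (m ^ 2 + 1) ^ e := ⟨_, rfl⟩
  obtain ⟨M, hM⟩ : ∃ M : ℕ, M = (m ^ 2 + 1) ^ (1 + m) := ⟨_, rfl⟩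
  obtain ⟨D, hD⟩ : ∃ D : ℝ, D = max 1 (m * (m * ((c + 1) * c))) := ⟨_, rfl⟩
  obtain ⟨l, hl⟩ := pow_unbounded_of_one_lt (m * (m * c) * D ^ J) (one_lt_two (α := ℝ))
  obtain ⟨ℓ, hℓ⟩ : ∃ ℓ : ℕ, ℓ = 8 ^ l * (M1 * J + M) + (m ^ 2 + 1) := ⟨_, rfl⟩
  obtain ⟨n, hln, hn⟩ := words_bd m C hC ℓ
  refine ⟨n * N0, ?_⟩
  intro K _ _ _ _ S hS h1 hspan hinf
  by_contra hfree0
  have hn1 : 1 ≤ n := by omega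
  have hfree : ¬ HasFree (S ^ n) N0 := by
    intro h
    apply hfree0
    unfold HasFree at h ⊢
    rw [pow_mul]
    exact h
  have hcl := closure_pow_eq h1 hn1
  have hspan' : SpanR ((m ^ 2 + 1) ^ m) (Subgroup.closure (S ^ n)) := by rw [hcl]; exact hspan
  have hfin := finite_pow hS n
  have h1n := one_mem_pow h1 n
  have hint : ∀ g ∈ Subgroup.closure S, IsIntegral ℤ (g : Matrix (Fin m) (Fin m) K).trace := by
    intro g hg
    refine integral_of_nonarch _ fun p _ v hv σ => ?_
    exact nonarch_trace hC hA σ v hv hfin h1n hspan' hfree g (by rw [hcl]; exact hg)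
  obtain ⟨Φ, hΦ⟩ := fam_exists hA hfin h1n hspan' hfree
  have hΦn : ∀ σ, ∀ w ∈ S ^ n, Bd cabs C (Φ σ w : Matrix (Fin m) (Fin m) ℂ) := fun σ w hw =>
    hΦ.bd σ w (by rw [pow_one]; exact hw)
  have hFam : Fam Φ (S ∪ S⁻¹) ℓ c := ⟨hΦ.sc, hΦ.tr, fun σ w hw => by
    rw [hc]; exact hn (Φ σ) S h1 (hΦn σ) w hw⟩
  have hR : m ≤ (m ^ 2 + 1) ^ m := by
    have h2 : m < 2 ^ m := Nat.lt_two_pow_self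
    have h3 : 2 ^ m ≤ (m ^ 2 + 1) ^ m := Nat.pow_le_pow_left (by nlinarith) m
    omega
  have h8 : 1 ≤ 8 ^ l := Nat.one_le_pow _ _ (by norm_num)
  have hMJ : M1 * J ≤ ℓ := by nlinarith
  by_cases hcase : ∃ a ∈ S ^ M1, ∀ i, 1 ≤ i → i ≤ J → ¬ IsSc (a ^ i)
  · obtain ⟨a, ha, hns⟩ := hcase
    have hai : ∀ i ≤ J, a ^ i ∈ S ^ (M1 * J) := by
      intro i hi
      have h2 := Set.pow_mem_pow (n := i) ha
      rw [← pow_mul] at h2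
      exact pow_subset h1 (Nat.mul_le_mul_left _ hi) h2
    refine caseA hm hc1 hFam (by rw [Set.union_inv, inv_inv, Set.union_comm]) Set.subset_union_left ?_ h1 hR hspan hint
      hδ hεδ hε0 hpos hε1 hM hℓ.ge (by rw [hD]; exact le_max_left _ _) (by rw [hD]; exact le_max_right _ _) hl
      a (fun i hi => Set.pow_subset_pow_left Set.subset_union_left (hai i hi)) hns ?_
    · rintro x (hx | hx)
      · exact Subgroup.subset_closure hx
      · have := Subgroup.inv_mem _ (Subgroup.subset_closure (Set.mem_inv.mp hx))
        rwa [inv_inv] at this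
    · intro σ
      obtain ⟨i, hi1, hiJ, hb⟩ := hJ (Φ σ a) (fun i hi => by
        rw [← map_pow]
        exact hΦn σ _ (pow_subset h1 (by omega) (hai i hi)))
      refine ⟨i, hi1, hiJ, ?_⟩
      rw [map_pow]
      simpa using hb
  · push Not at hcase
    have hexp : ∀ g ∈ S ^ ((m ^ 2 + 1) ^ e), g ^ e = 1 := by
      intro g hg
      rw [← hM1] at hg
      obtain ⟨i, hi1, hiJ, hsc⟩ := hcase g hg
      have h3 := hsc.pow_eq
      obtain ⟨q, hq⟩ := Nat.dvd_factorial (by omega) hiJ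
      rw [he, hq, show m * (i * q) = i * m * q by ring, pow_mul, pow_mul, h3, one_pow]
    have hall := escape_pow S h1 e hexp
    exact hinf (finite_of_exponent _ (hspan.span_top (by omega)) e he0 hall)

end LD

end

section
namespace LD

theorem SpanR.anti {K : Type} [Field K] {m R R' : ℕ} {Γ : Subgroup (SL m K)} (h : SpanR R Γ) (hR : R' ≤ R) :
    SpanR R' Γ := fun H hH h0 h1 => h H hH h0 (h1.trans hR)

theorem theoremB (m : ℕ) : ∃ N : ℕ, ∀ (k : Type) [NontriviallyNormedField k] [CompleteSpace k] (k0 : Subfield k)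
      (K : Type) [Field K] [IsAlgClosed K] [Countable K] (_ : k0 →+* K) (S : Set (SL m K)), 0 < m → S.Finite →
      (1 : SL m K) ∈ S → SpanR ((m ^ 2 + 1) ^ m) (Subgroup.closure S) →
      (Subgroup.closure S : Set (SL m K)).Infinite → HasFree S N := by
  by_cases hm : 0 < m
  swap
  · exact ⟨0, fun _ _ _ _ _ _ _ _ _ _ h => absurd h hm⟩
  obtain ⟨C, N0, hC, hA⟩ := theoremA m
  have hA' : ThA m C N0 := hA
  obtain ⟨N1, hN1⟩ := char0_main hm hC hA'
  have hmono : ∀ {K : Type} [Field K] {S : Set (SL m K)} {a b : ℕ}, (1 : SL m K) ∈ S → a ≤ b → HasFree S a →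
      HasFree S b := by
    rintro K _ S a b h1 hab ⟨x, hx, y, hy, h⟩
    exact ⟨x, pow_subset h1 hab hx, y, pow_subset h1 hab hy, h⟩
  refine ⟨max N0 N1, ?_⟩
  intro k _ _ k0 K _ _ _ ι S _ hS h1 hspan hinf
  obtain ⟨p, hp⟩ := CharP.exists k
  have hp0 : CharP k0 p := (RingHom.charP_iff k0.subtype k0.subtype.injective p).mpr hp
  have hpK : CharP K p := (RingHom.charP_iff ι ι.injective p).mp hp0
  rcases CharP.char_is_prime_or_zero k p with h | h
  · have : Fact p.Prime := ⟨h⟩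
    exact hmono h1 (le_max_left _ _) (charP_main hC hA' p k hS h1 hspan hinf)
  · subst h
    have : CharZero K := CharP.charP_to_charZero K
    exact hmono h1 (le_max_right _ _) (hN1 K S hS h1 hspan hinf)

theorem solvable_of_der {G : Type} [Group G] (H : Subgroup G) (n : ℕ) (h : der H n = ⊥) : Group.IsSolvable H := by
  have key : ∀ n, (derivedSeries H n).map H.subtype ≤ der H n := by
    intro n
    induction n with
    | zero =>
      rintro _ ⟨x, _, rfl⟩
      exact x.2
    | succ n ih =>
      rw [derivedSeries_succ, Subgroup.map_commutator]
      exact Subgroup.commutator_mono ih ih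
  refine ⟨n, ?_⟩
  have h2 := key n
  rw [h, le_bot_iff, Subgroup.map_eq_bot_iff_of_injective _ H.subtype_injective] at h2
  exact h2

theorem lift_map {G H : Type} [Group G] [Group H] (f : G →* H) (hf : Function.Injective f) (a b : G)
    (h : Function.Injective (FreeMonoid.lift ![a, b] : FreeMonoid (Fin 2) →* G)) :
    Function.Injective (FreeMonoid.lift ![f a, f b] : FreeMonoid (Fin 2) →* H) := by
  have e : (FreeMonoid.lift ![f a, f b] : FreeMonoid (Fin 2) →* H) = f.comp (FreeMonoid.lift ![a, b]) := by
    apply FreeMonoid.hom_eq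
    intro x
    fin_cases x <;> simp
  rw [e]
  exact hf.comp h

theorem countable_closure {k : Type} [Field k] (s : Set k) (hs : s.Countable) : Countable (Subfield.closure s) := by
  have := hs.to_subtype
  exact Cardinal.mk_le_aleph0_iff.mp (Subfield.cardinalMk_closure_le_max s |>.trans (by simp))

theorem main (d : ℕ) : ∃ N : ℕ, 0 < N ∧ ∀ (k : Type) [NontriviallyNormedField k] [CompleteSpace k]
    (S : Set (SL d k)), S.Finite → (1 : SL d k) ∈ S →
    (¬ ∃ H : Subgroup ↥(Subgroup.closure S), H.FiniteIndex ∧ IsSolvable ↥H) →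
    ∃ a ∈ S ^ N, ∃ b ∈ S ^ N, Function.Injective (FreeMonoid.lift ![a, b] : FreeMonoid (Fin 2) →* SL d k) := by
  choose NB hNB using theoremB
  let R : ℕ := (d ^ 2 + 1) ^ d
  let NM : ℕ := ∑ m ∈ Finset.range (d + 1), NB m
  refine ⟨(2 * R + 1) ^ d * NM + 1, Nat.succ_pos _, ?_⟩
  intro k _ _ S hS h1 hnvs
  let E : Set k := ⋃ s ∈ S, Set.range (fun ij : Fin d × Fin d => (s : Matrix (Fin d) (Fin d) k) ij.1 ij.2)
  have hE : E.Countable := hS.countable.biUnion fun s _ => (Set.finite_range _).countable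
  let k0 : Subfield k := Subfield.closure E
  have hk0 : Countable k0 := countable_closure E hE
  let K : Type := AlgebraicClosure k0
  have hK : Countable K := by
    have := Algebra.IsAlgebraic.cardinalMk_le_max k0 K
    exact Cardinal.mk_le_aleph0_iff.mp (this.trans (max_le (Cardinal.mk_le_aleph0_iff.mpr hk0) le_rfl))
  let f : SL d k0 →* SL d k := slMap d k0.subtype
  have hf : Function.Injective f := slMap_inj _
  let S0 : Set (SL d k0) := f ⁻¹' S
  have hS0 : S0.Finite := hS.preimage hf.injOn
  have h10 : (1 : SL d k0) ∈ S0 := by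
    show f 1 ∈ S
    rw [map_one]; exact h1
  have himg : f '' S0 = S := by
    apply Set.image_preimage_eq_of_subset
    intro s hs
    have hmem : ∀ i j, (s : Matrix (Fin d) (Fin d) k) i j ∈ k0 := fun i j =>
      Subfield.subset_closure (Set.mem_biUnion hs ⟨(i, j), rfl⟩)
    let A : Matrix (Fin d) (Fin d) k0 := fun i j => ⟨(s : Matrix (Fin d) (Fin d) k) i j, hmem i j⟩
    have hA : A.map k0.subtype = (s : Matrix (Fin d) (Fin d) k) := by ext i j; rfl
    have hdet : A.det = 1 := by
      apply k0.subtype.injective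
      rw [RingHom.map_det, map_one]
      have : k0.subtype.mapMatrix A = (s : Matrix (Fin d) (Fin d) k) := hA
      rw [this]
      exact s.2
    exact ⟨⟨A, hdet⟩, Subtype.ext hA⟩
  let φ : SL d k0 →* SL d K := slMap d (algebraMap k0 K)
  have hφ : Function.Injective φ := slMap_inj _
  let ρ : SL d k0 →* Module.End K (Fin d → K) :=
    (((Matrix.toLinAlgEquiv' : Matrix (Fin d) (Fin d) K ≃ₐ[K] _) : Matrix (Fin d) (Fin d) K →* _)).comp
      ((Matrix.SpecialLinearGroup.toGL.comp φ |> fun g => (Units.coeHom _).comp g))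
  have hρ : ∀ g w, ρ g w = (φ g : Matrix (Fin d) (Fin d) K) *ᵥ w := fun g w => rfl
  have hvs : ¬ VS ρ (Subgroup.closure S0) ⊥ ⊤ := by
    rintro ⟨H1, hH1, hidx, n, hn⟩
    apply hnvs
    have hder : der H1 n = ⊥ := by
      rw [eq_bot_iff]
      intro h hh
      rw [Subgroup.mem_bot]
      apply hφ
      rw [map_one]
      apply coe_injective
      apply Matrix.toLin'.injective
      apply LinearMap.ext
      intro w
      have := hn h hh w trivial
      rw [Submodule.mem_bot, sub_eq_zero, hρ] at this
      rw [Matrix.toLin'_apply, this]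
      simp
    have hsol : Group.IsSolvable H1 := solvable_of_der H1 n hder
    have hcl : Subgroup.closure S = (Subgroup.closure S0).map f := by
      rw [MonoidHom.map_closure, himg]
    have hle : H1.map f ≤ Subgroup.closure S := by
      rw [hcl]; exact Subgroup.map_mono hH1
    refine ⟨(H1.map f).subgroupOf (Subgroup.closure S), ⟨?_⟩, ?_⟩
    · change (H1.map f).relIndex (Subgroup.closure S) ≠ 0
      rw [hcl, Subgroup.relIndex_map_map_of_injective _ _ hf]
      exact hidx
    · have h2 : Group.IsSolvable (H1.map f) :=
        Group.isSolvable_of_surjective (f := (H1.equivMapOfInjective f hf).toMonoidHom) (H1.equivMapOfInjective f hf).surjective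
      exact Group.isSolvable_of_isSolvable_injective (f := (Subgroup.subgroupOfEquivOfLe hle).toMonoidHom)
        (Subgroup.subgroupOfEquivOfLe hle).injective
  obtain ⟨T', hT'sub, hT'fin, h1T', W1', W1, hWle, hI', hI, hVS', hirr⟩ := reduce ρ R d S0 ⊥ ⊤ hS0 h10 bot_le
    (fun h _ w hw => by
      rw [Submodule.mem_bot] at hw ⊢
      rw [hw, map_zero]) (fun h _ w _ => trivial) (by simp) hvs
  obtain ⟨m, hmle, hm, S', hS', h1S', hspan, hinf, hback⟩ := to_SL ρ R T' hT'fin h1T' W1' W1 hWle hI' hI hVS' hirr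
  have hmd : m ≤ d := by simpa using hmle
  have hRm : (m ^ 2 + 1) ^ m ≤ R :=
    (Nat.pow_le_pow_left (by nlinarith) m).trans (Nat.pow_le_pow_right (by positivity) hmd)
  obtain ⟨a, ha, b, hb, hab⟩ := hNB m k k0 K (algebraMap k0 K) S' hm hS' h1S' (hspan.anti hRm) hinf
  obtain ⟨a', ha', b', hb', hinj⟩ := hback (NB m) a ha b hb hab
  have hNle : NB m ≤ NM := Finset.single_le_sum (f := NB) (fun _ _ => Nat.zero_le _) (Finset.mem_range.mpr (by omega))
  have htr : ∀ x ∈ T' ^ (NB m), f x ∈ S ^ ((2 * R + 1) ^ d * NM + 1) := by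
    intro x hx
    have h3 : x ∈ S0 ^ ((2 * R + 1) ^ d * NB m) := by
      rw [pow_mul]
      exact Set.pow_subset_pow_left hT'sub hx
    have h4 : x ∈ S0 ^ ((2 * R + 1) ^ d * NM + 1) :=
      pow_subset h10 ((Nat.mul_le_mul_left _ hNle).trans (Nat.le_succ _)) h3
    rw [← himg, ← Set.image_pow]
    exact ⟨x, h4, rfl⟩
  exact ⟨f a', htr a' ha', f b', htr b' hb', lift_map f hf a' b' hinj⟩

end LD

end

/-- **Large displacement forces bounded positive independence diameter.** For every `d ≥ 1`
there are `C = C(d) > 0` and `N = N(d) > 0` such that for every local field `k` and every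
finite `S ⊆ SL_d(k)` with `1 ∈ S` generating a non-virtually-solvable group, if
`E(S) = inf_h sup_{s ∈ S} ‖h s h⁻¹‖ > C` then `S ^ N` contains two elements generating a free
semigroup. -/
theorem large_displacement_positive_independence (d : ℕ) (hd : 1 ≤ d) :
    ∃ (C : ℝ) (N : ℕ), 0 < C ∧ 0 < N ∧
      ∀ (k : Type) [NontriviallyNormedField k] [CompleteSpace k] [LocallyCompactSpace k],
        ∀ S : Finset (Matrix.SpecialLinearGroup (Fin d) k),
          (1 : Matrix.SpecialLinearGroup (Fin d) k) ∈ S →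
          (¬ ∃ H : Subgroup
              ↥(Subgroup.closure (S : Set (Matrix.SpecialLinearGroup (Fin d) k))),
            H.FiniteIndex ∧ IsSolvable ↥H) →
          C < (⨅ h : Matrix.SpecialLinearGroup (Fin d) k,
              sSup ((fun s : Matrix.SpecialLinearGroup (Fin d) k =>
                  kOpNorm ((h * s * h⁻¹ : Matrix.SpecialLinearGroup (Fin d) k) :
                    Matrix (Fin d) (Fin d) k)) ''
                (S : Set (Matrix.SpecialLinearGroup (Fin d) k)))) →
          ∃ a ∈ (S : Set (Matrix.SpecialLinearGroup (Fin d) k)) ^ N,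
            ∃ b ∈ (S : Set (Matrix.SpecialLinearGroup (Fin d) k)) ^ N,
              Function.Injective
                (FreeMonoid.lift ![a, b] :
                  FreeMonoid (Fin 2) →* Matrix.SpecialLinearGroup (Fin d) k) := by
  obtain ⟨N, hN, h⟩ := LD.main d
  refine ⟨1, N, one_pos, hN, ?_⟩
  intro k _ _ _ S h1 hvs _
  exact h k (S : Set (Matrix.SpecialLinearGroup (Fin d) k)) S.finite_toSet (Finset.mem_coe.mpr h1) hvs
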